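/- Let K be a field of characteristic zero, A_1,...,A_n finite-dimensional K-vector spaces with dim A_j = a_j, and let b_j ≤ a_j be nonnegative integers. Then the subspace variety Sub_{b_1,...,b_n} ⊂ A_1*⊗...⊗A_n* is normal, with rational singularities. -/

import Mathlib

/-!
Statement 6: over a field `K` of characteristic zero, the subspace variety
`Sub_{b₁,...,b_n} ⊂ A₁* ⊗ ... ⊗ A_n*` (`b_j ≤ a_j = dim A_j`) is normal with rational
singularities: its coordinate ring is an integrally closed domain, and it admits a
resolution of singularities (a proper birational morphism from a scheme smooth over
`K`) with vanishing higher cohomology of the structure sheaf (`R^i π_* O_Y = 0`,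
`i > 0`, expressed via Čech cohomology over the affine base).
-/

open MvPolynomial AlgebraicGeometry CategoryTheory Opposite

variable {n : ℕ}

/-- Index set of the natural basis of `A₁ ⊗ ... ⊗ A_n`, `dim A_j = a j`. -/
abbrev Ind (a : Fin n → ℕ) := ∀ j, Fin (a j)

/-- The subspace variety `Sub_{b₁,...,b_n} ⊆ A₁* ⊗ ... ⊗ A_n*`: tensors `T` lying in
`A₁'* ⊗ ... ⊗ A_n'*` for some subspaces `A_j'` with `dim A_j' = b j`. -/
def subspaceVariety (K : Type) [Field K] (a b : Fin n → ℕ) : Set (Ind a → K) :=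
  { T | ∃ A' : ∀ j, Submodule K (Fin (a j) → K),
      (∀ j, Module.finrank K (A' j) = b j) ∧
      ∀ (j : Fin n) (w : Ind a), (fun i => T (Function.update w j i)) ∈ A' j }

/-- The ideal of the subspace variety: all polynomials vanishing on it. -/
noncomputable def subIdeal (K : Type) [Field K] (a b : Fin n → ℕ) :
    Ideal (MvPolynomial (Ind a) K) :=
  ⨅ (T : Ind a → K) (_ : T ∈ subspaceVariety K a b), RingHom.ker (MvPolynomial.eval T)

/-- Čech `p`-cochains of the structure sheaf with respect to the cover `U`. -/
abbrev cech (Y : Scheme) {m : ℕ} (U : Fin m → Y.Opens) (p : ℕ) : Type :=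
  ∀ f : Fin (p+1) → Fin m, (Y.presheaf.obj (op (⨅ j, U (f j))) : Type)

/-- The Čech differential of the structure sheaf. -/
noncomputable def cechD (Y : Scheme) {m : ℕ} (U : Fin m → Y.Opens) (p : ℕ)
    (s : cech Y U p) : cech Y U (p+1) :=
  fun g => ∑ j : Fin (p+2),
    ((-1 : ℤ) ^ (j : ℕ)) •
      (Y.presheaf.map
        (homOfLE (le_iInf fun j' => iInf_le (fun t => U (g t)) (j.succAbove j'))).op
        (s (g ∘ j.succAbove)))

/-- The structure sheaf of `Y` has vanishing higher Čech cohomology with respect to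
every finite affine open cover (for `Y` separated this says `H^i(Y, O_Y) = 0` for all
`i > 0`). -/
def AcyclicStructureSheaf (Y : Scheme) : Prop :=
  ∀ (m : ℕ) (U : Fin m → Y.Opens), (∀ i, IsAffineOpen (U i)) → iSup U = ⊤ →
    ∀ (p : ℕ) (s : cech Y U (p+1)), cechD Y U (p+1) s = 0 →
      ∃ t : cech Y U p, cechD Y U p t = s

/-- A `K`-algebra `R` has rational singularities if there is a resolution of
singularities `π : Y → Spec R` — a proper morphism from a scheme smooth over `K` which
is an isomorphism over a dense open subset — such that `R^i π_* O_Y = 0` for `i > 0`;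
over the affine base this is the vanishing of the higher Čech cohomology of `O_Y` for
affine open covers of `Y`. -/
def HasRationalSingularities (K R : Type) [Field K] [CommRing R] [Algebra K R] :
    Prop :=
  ∃ (Y : Scheme) (π : Y ⟶ Spec (CommRingCat.of R)),
    IsProper π ∧
    IsSmooth (π ≫ Spec.map (CommRingCat.ofHom (algebraMap K R))) ∧
    (∃ U : (Spec (CommRingCat.of R)).Opens, Dense U.carrier ∧ IsIso (π ∣_ U)) ∧
    AcyclicStructureSheaf Y

section CechComplex

/-- Restriction of sections of the structure sheaf. -/
noncomputable def res {Y : Scheme} {U V : Y.Opens} (h : U ≤ V) : Γ(Y, V) →+* Γ(Y, U) :=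
  (Y.presheaf.map (homOfLE h).op).hom

lemma res_res {Y : Scheme} {U V W : Y.Opens} (h : U ≤ V) (h' : V ≤ W) (x : Γ(Y, W)) :
    res h (res h' x) = res (h.trans h') x := by
  simp only [res, ← CommRingCat.comp_apply, ← Functor.map_comp]
  rfl

lemma res_self {Y : Scheme} {U : Y.Opens} (h : U ≤ U) (x : Γ(Y, U)) : res h x = x := by
  simp [res]

variable {Y : Scheme.{0}} {β : Type} {O : ∀ q, (Fin q → β) → Y.Opens}
  (hO : ∀ q g (j : Fin (q + 1)), O (q + 1) g ≤ O q (g ∘ j.succAbove))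

/-- The alternating sum differential for a simplicial family of opens. -/
noncomputable def altDiff (q : ℕ) (s : ∀ g : Fin q → β, Γ(Y, O q g)) (g : Fin (q + 1) → β) :
    Γ(Y, O (q + 1) g) :=
  ∑ j : Fin (q + 1), ((-1 : ℤ) ^ (j : ℕ)) • res (hO q g j) (s (g ∘ j.succAbove))

lemma res_congr_index {q : ℕ} (s : ∀ g : Fin q → β, Γ(Y, O q g)) {f g : Fin q → β} (h : f = g)
    {W : Y.Opens} (hf : W ≤ O q f) (hg : W ≤ O q g) : res hf (s f) = res hg (s g) := by
  subst h; rfl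

/-- Cocycles can be contracted over a basic open contained in a member of the cover. -/
lemma exists_altDiff_eq_pow_mul [Finite β] {W : Y.Opens} {V : β → Y.Opens}
    (hOV : ∀ q g, O q g = W ⊓ ⨅ j, V (g j)) (haff : ∀ q g, IsAffineOpen (O q g))
    (hW : ∀ q g, O q g ≤ W) (x : Γ(Y, W)) (i : β) (hx : Y.basicOpen x ≤ V i)
    (q : ℕ) (s : ∀ g : Fin (q + 1) → β, Γ(Y, O (q + 1) g)) (hs : altDiff hO (q + 1) s = 0) :
    ∃ (N : ℕ) (t : ∀ g : Fin q → β, Γ(Y, O q g)),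
      ∀ g, altDiff hO q t g = res (hW _ _) x ^ N * s g := by
  classical
  have hle : ∀ q (f : Fin q → β), Y.basicOpen (res (hW q f) x) ≤ O (q + 1) (Fin.cons i f) := by
    intro q f
    have h1 : Y.basicOpen (res (hW q f) x) = O q f ⊓ Y.basicOpen x :=
      Scheme.basicOpen_res _ _ _
    rw [h1, hOV (q + 1)]
    refine le_inf (inf_le_left.trans (hW q f)) (le_iInf fun j => ?_)
    refine Fin.cases ?_ (fun j => ?_) j
    · exact inf_le_right.trans hx
    · refine inf_le_left.trans ?_
      rw [hOV q]
      exact inf_le_right.trans (iInf_le _ j)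
  have hy : ∀ f : Fin q → β, ∃ (n : ℕ) (y : Γ(Y, O q f)),
      res (Y.basicOpen_le (res (hW q f) x)) y =
        res (Y.basicOpen_le (res (hW q f) x)) (res (hW q f) x) ^ n *
          res (hle q f) (s (Fin.cons i f)) := fun f =>
    exists_eq_pow_mul_of_isAffineOpen Y (O q f) (haff q f) _ _
  choose n y hy using hy
  have := Fintype.ofFinite β
  let N := ∑ f, n f
  have hnN : ∀ f, n f ≤ N := fun f => Finset.single_le_sum (fun _ _ => Nat.zero_le _)
    (Finset.mem_univ f)
  let t : ∀ f : Fin q → β, Γ(Y, O q f) := fun f => res (hW q f) x ^ (N - n f) * y f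
  have ht : ∀ f, res (Y.basicOpen_le (res (hW q f) x)) (t f) =
      res (Y.basicOpen_le (res (hW q f) x)) (res (hW q f) x) ^ N *
          res (hle q f) (s (Fin.cons i f)) := by
    intro f
    simp only [t, map_mul, map_pow, hy, ← mul_assoc, ← pow_add, Nat.sub_add_cancel (hnN f)]
  have key : ∀ g : Fin (q + 1) → β, ∃ M : ℕ, res (hW _ g) x ^ M *
      (altDiff hO q t g - res (hW _ g) x ^ N * s g) = 0 := by
    intro g
    refine exists_pow_mul_eq_zero_of_res_basicOpen_eq_zero_of_isAffineOpen Y (haff _ g) _ _ ?_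
    change res (Y.basicOpen_le (res (hW _ g) x)) _ = 0
    have h0 := congrArg (res (hle (q + 1) g)) (congrFun hs (Fin.cons i g))
    simp only [altDiff, Pi.zero_apply, map_zero, map_sum, map_zsmul, res_res] at h0
    rw [Fin.sum_univ_succ] at h0
    have e0 : (Fin.cons i g : Fin (q + 2) → β) ∘ (0 : Fin (q + 2)).succAbove = g := by
      ext j; simp
    have es : ∀ j : Fin (q + 1), (Fin.cons i g : Fin (q + 2) → β) ∘ (j.succ).succAbove =
        Fin.cons i (g ∘ j.succAbove) := by
      intro j
      funext k
      refine Fin.cases ?_ (fun k => ?_) k <;> simp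
    rw [res_congr_index s e0 _ (Y.basicOpen_le _)] at h0
    have hb : ∀ j : Fin (q + 1), Y.basicOpen (res (hW _ g) x) ≤
        Y.basicOpen (res (hW _ (g ∘ j.succAbove)) x) := by
      intro j
      have h1 : Y.basicOpen (res (hW _ g) x) = _ ⊓ Y.basicOpen x := Scheme.basicOpen_res _ _ _
      have h2 : Y.basicOpen (res (hW _ (g ∘ j.succAbove)) x) = _ ⊓ Y.basicOpen x :=
        Scheme.basicOpen_res _ _ _
      rw [h1, h2]
      exact inf_le_inf_right _ (hO q g j)
    have hsum : res (Y.basicOpen_le (res (hW _ g) x)) (altDiff hO q t g) =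
        res (Y.basicOpen_le (res (hW _ g) x)) (res (hW _ g) x) ^ N *
          ∑ j : Fin (q + 1), ((-1 : ℤ) ^ (j : ℕ)) •
            res ((hb j).trans (hle q _)) (s (Fin.cons i (g ∘ j.succAbove))) := by
      simp only [altDiff, map_sum, map_zsmul, res_res, Finset.mul_sum]
      refine Finset.sum_congr rfl fun j _ => ?_
      rw [mul_smul_comm]
      congr 1
      have := congrArg (res (hb j)) (ht (g ∘ j.succAbove))
      simp only [map_mul, map_pow, res_res] at this
      exact this
    rw [map_sub, hsum, map_mul, map_pow, ← mul_sub]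
    have : ∑ j : Fin (q + 1), ((-1 : ℤ) ^ (j : ℕ)) •
            res ((hb j).trans (hle q _)) (s (Fin.cons i (g ∘ j.succAbove))) =
          res (Y.basicOpen_le (res (hW _ g) x)) (s g) := by
      simp only [Fin.val_zero, pow_zero, one_smul, Fin.val_succ, pow_succ, mul_neg, mul_one,
        neg_smul, Finset.sum_neg_distrib] at h0
      rw [add_neg_eq_zero] at h0
      rw [h0]
      refine Finset.sum_congr rfl fun j _ => ?_
      congr 1
      exact (res_congr_index s (es j) _ _).symm
    rw [this, sub_self, mul_zero]
  choose M hM using key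
  let M' := ∑ f, M f
  have hMM : ∀ f, M f ≤ M' := fun f => Finset.single_le_sum (fun _ _ => Nat.zero_le _)
    (Finset.mem_univ f)
  refine ⟨M' + N, fun f => res (hW q f) x ^ M' * t f, fun g => ?_⟩
  have h1 : altDiff hO q (fun f => res (hW q f) x ^ M' * t f) g =
      res (hW _ g) x ^ M' * altDiff hO q t g := by
    simp only [altDiff, map_mul, map_pow, res_res, Finset.mul_sum, mul_smul_comm]
  rw [h1, pow_add, mul_assoc, ← sub_eq_zero, ← mul_sub, ← Nat.sub_add_cancel (hMM g), pow_add,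
    mul_assoc, hM, mul_zero]

/-- A cover of an affine open whose pieces are basic opens of members of `V` spans the unit ideal;
membership of all powers suffices. -/
lemma ideal_eq_top_of_basicOpen {W : Y.Opens} (hWaff : IsAffineOpen W) {V : β → Y.Opens}
    (hcov : W ≤ ⨆ i, V i) (I : Ideal Γ(Y, W))
    (hI : ∀ (x : Γ(Y, W)) (i : β), Y.basicOpen x ≤ V i → ∃ N, x ^ N ∈ I) : I = ⊤ := by
  have h : Ideal.span {x : Γ(Y, W) | ∃ i, Y.basicOpen x ≤ V i} = ⊤ := by
    rw [← hWaff.self_le_iSup_basicOpen_iff]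
    intro p hp
    have h1 := hcov hp
    rw [TopologicalSpace.Opens.mem_iSup] at h1
    obtain ⟨i, hi⟩ := h1
    obtain ⟨f, hf, hpf⟩ := hWaff.exists_basicOpen_le (⟨p, hi⟩ : V i) hp
    exact TopologicalSpace.Opens.mem_iSup.mpr ⟨⟨f, i, hf⟩, hpf⟩
  rw [← Ideal.radical_eq_top, eq_top_iff, ← h, Ideal.span_le]
  rintro x ⟨i, hi⟩
  exact hI x i hi

lemma altDiff_exact [Finite β] {W : Y.Opens} (hWaff : IsAffineOpen W) {V : β → Y.Opens}
    (hcov : W ≤ ⨆ i, V i)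
    (hOV : ∀ q g, O q g = W ⊓ ⨅ j, V (g j)) (haff : ∀ q g, IsAffineOpen (O q g))
    (q : ℕ) (s : ∀ g : Fin (q + 1) → β, Γ(Y, O (q + 1) g)) (hs : altDiff hO (q + 1) s = 0) :
    ∃ t : ∀ g : Fin q → β, Γ(Y, O q g), altDiff hO q t = s := by
  have hW : ∀ q g, O q g ≤ W := fun q g => (hOV q g).le.trans inf_le_left
  let I : Ideal Γ(Y, W) :=
    { carrier := {x | ∃ t : ∀ g : Fin q → β, Γ(Y, O q g),
        ∀ g, altDiff hO q t g = res (hW _ _) x * s g}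
      add_mem' := by
        rintro x y ⟨t, ht⟩ ⟨t', ht'⟩
        refine ⟨t + t', fun g => ?_⟩
        rw [map_add, add_mul, ← ht, ← ht']
        simp [altDiff, Finset.sum_add_distrib]
      zero_mem' := ⟨0, fun g => by simp [altDiff]⟩
      smul_mem' := by
        rintro x y ⟨t, ht⟩
        refine ⟨fun f => res (hW q f) x * t f, fun g => ?_⟩
        rw [smul_eq_mul, map_mul, mul_assoc, ← ht]
        simp only [altDiff, map_mul, res_res, Finset.mul_sum, mul_smul_comm] }
  have hI : I = ⊤ := by
    refine ideal_eq_top_of_basicOpen hWaff hcov I fun x i hxi => ?_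
    obtain ⟨N, t, ht⟩ := exists_altDiff_eq_pow_mul hO hOV haff hW x i hxi q s hs
    exact ⟨N, t, fun g => by rw [ht, map_pow]⟩
  obtain ⟨t, ht⟩ : (1 : Γ(Y, W)) ∈ I := hI ▸ Submodule.mem_top
  exact ⟨t, funext fun g => by rw [ht, map_one, one_mul]⟩

lemma altDiff_zero_injective {W : Y.Opens} {V : β → Y.Opens}
    (hcov : W ≤ ⨆ i, V i) (hOV : ∀ q g, O q g = W ⊓ ⨅ j, V (g j))
    (s : ∀ g : Fin 0 → β, Γ(Y, O 0 g)) (hs : altDiff hO 0 s = 0) : s = 0 := by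
  funext g
  have hle : ∀ i, O 1 (fun _ => i) ≤ O 0 g := fun i => by
    have := hO 0 (fun _ => i) 0
    rwa [Subsingleton.elim ((fun _ => i) ∘ (0 : Fin 1).succAbove) g] at this
  refine Y.sheaf.eq_of_locally_eq' (fun i => O 1 (fun _ => i)) (O 0 g)
    (fun i => homOfLE (hle i)) ?_ _ _ fun i => ?_
  · rw [hOV 0]
    simp only [hOV 1]
    rw [iInf_of_empty, inf_top_eq]
    intro x hx
    obtain ⟨i, hi⟩ := TopologicalSpace.Opens.mem_iSup.mp (hcov hx)
    refine TopologicalSpace.Opens.mem_iSup.mpr ⟨i, ⟨hx, ?_⟩⟩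
    simpa using hi
  · have h := congrFun hs (fun _ => i)
    simp only [altDiff, Fin.val_eq_zero, pow_zero, one_smul, Pi.zero_apply] at h
    rw [Fin.sum_univ_one] at h
    change res (hle i) (s g) = res (hle i) 0
    rw [map_zero, ← h]
    exact res_congr_index s (Subsingleton.elim _ _) _ _

omit hO in
lemma val_succAbove {m : ℕ} (j : Fin (m + 1)) (k : Fin m) :
    (j.succAbove k : ℕ) = if (k : ℕ) < j then (k : ℕ) else k + 1 := by
  rw [Fin.succAbove]
  split_ifs <;> simp_all [Fin.lt_def]

lemma altDiff_altDiff (q : ℕ) (s : ∀ g : Fin q → β, Γ(Y, O q g)) :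
    altDiff hO (q + 1) (altDiff hO q s) = 0 := by
  funext g
  have hle : ∀ (i : Fin (q + 1)) (j : Fin (q + 2)),
      O (q + 2) g ≤ O q ((g ∘ j.succAbove) ∘ i.succAbove) := fun i j =>
    (hO _ _ _).trans (hO _ _ _)
  have h1 : altDiff hO (q + 1) (altDiff hO q s) g = ∑ j : Fin (q + 2), ∑ i : Fin (q + 1),
      ((-1 : ℤ) ^ ((j : ℕ) + i)) • res (hle i j) (s ((g ∘ j.succAbove) ∘ i.succAbove)) := by
    simp only [altDiff, map_sum, map_zsmul, res_res, Finset.smul_sum, smul_smul, pow_add]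
  rw [h1, ← Finset.sum_product', Pi.zero_apply, Finset.univ_product_univ]
  let φ : Fin (q + 2) × Fin (q + 1) → Fin (q + 2) × Fin (q + 1) := fun x =>
    if h : x.2.castSucc < x.1 then (x.2.castSucc, x.1.pred (Fin.ne_zero_of_lt h))
    else (x.2.succ, x.1.castPred (by
      intro h'
      rw [h'] at h
      exact h (Fin.castSucc_lt_last _)))
  have hφ1 : ∀ x : Fin (q + 2) × Fin (q + 1), x.2.castSucc < x.1 →
      ((φ x).1 : ℕ) = x.2 ∧ ((φ x).2 : ℕ) + 1 = x.1 := by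
    intro x hx
    simp only [φ, dif_pos hx]
    have := Fin.lt_def.mp hx
    simp only [Fin.val_castSucc] at this
    refine ⟨rfl, ?_⟩
    simp only [Fin.val_pred]
    omega
  have hφ2 : ∀ x : Fin (q + 2) × Fin (q + 1), ¬ x.2.castSucc < x.1 →
      ((φ x).1 : ℕ) = x.2 + 1 ∧ ((φ x).2 : ℕ) = x.1 := by
    intro x hx
    simp only [φ, dif_neg hx]
    exact ⟨rfl, rfl⟩
  refine Finset.sum_involution (fun x _ => φ x) ?_ ?_ (fun _ _ => Finset.mem_univ _) ?_
  · intro x _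
    have hidx : (g ∘ (φ x).1.succAbove) ∘ (φ x).2.succAbove =
        (g ∘ x.1.succAbove) ∘ x.2.succAbove := by
      funext k
      simp only [Function.comp_apply]
      congr 1
      ext
      rw [val_succAbove, val_succAbove, val_succAbove, val_succAbove]
      by_cases hx : x.2.castSucc < x.1
      · obtain ⟨h1, h2⟩ := hφ1 x hx
        simp only [Fin.lt_def, Fin.val_castSucc] at hx
        rw [h1]
        split_ifs <;> omega
      · obtain ⟨h1, h2⟩ := hφ2 x hx
        simp only [Fin.lt_def, Fin.val_castSucc] at hx
        rw [h1, h2]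
        split_ifs <;> omega
    rw [res_congr_index s hidx (hle _ _) (hle _ _), ← add_smul]
    have hsign : (-1 : ℤ) ^ ((x.1 : ℕ) + x.2) + (-1 : ℤ) ^ (((φ x).1 : ℕ) + (φ x).2) = 0 := by
      by_cases hx : x.2.castSucc < x.1
      · obtain ⟨h1, h2⟩ := hφ1 x hx
        rw [h1, ← h2]
        ring
      · obtain ⟨h1, h2⟩ := hφ2 x hx
        rw [h1, h2]
        ring
    rw [hsign, zero_smul]
  · intro x _ _ h
    by_cases hx : x.2.castSucc < x.1
    · have h1 := (hφ1 x hx).1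
      rw [h] at h1
      simp only [Fin.lt_def, Fin.val_castSucc] at hx
      omega
    · have h1 := (hφ2 x hx).1
      rw [h] at h1
      simp only [Fin.lt_def, Fin.val_castSucc] at hx
      omega
  · intro x _
    have hx2 : ∀ y : Fin (q + 2) × Fin (q + 1), (y.1 : ℕ) = x.1 → (y.2 : ℕ) = x.2 → y = x :=
      fun y h1 h2 => Prod.ext (Fin.ext h1) (Fin.ext h2)
    by_cases hx : x.2.castSucc < x.1
    · obtain ⟨h1, h2⟩ := hφ1 x hx
      have hx' : ¬ (φ x).2.castSucc < (φ x).1 := by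
        simp only [Fin.lt_def, Fin.val_castSucc] at hx ⊢
        omega
      obtain ⟨h3, h4⟩ := hφ2 _ hx'
      exact hx2 _ (by omega) (by omega)
    · obtain ⟨h1, h2⟩ := hφ2 x hx
      have hx' : (φ x).2.castSucc < (φ x).1 := by
        simp only [Fin.lt_def, Fin.val_castSucc] at hx ⊢
        omega
      obtain ⟨h3, h4⟩ := hφ1 _ hx'
      exact hx2 _ (by omega) (by omega)

/-- Exactness of the first column of an augmented double complex. -/
lemma exact_column_zero {A : ℕ → ℕ → Type} [∀ p q, AddCommGroup (A p q)]
    (d : ∀ p q, A p q →+ A (p + 1) q) (e : ∀ p q, A p q →+ A p (q + 1))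
    (hde : ∀ p q x, d p (q + 1) (e p q x) = e (p + 1) q (d p q x))
    (hdd : ∀ p q x, d (p + 1) q (d p q x) = 0)
    (hee : ∀ p q x, e p (q + 1) (e p q x) = 0)
    (hd0 : ∀ q x, d 0 (q + 1) x = 0 → x = 0)
    (hd : ∀ p q x, d (p + 1) (q + 1) x = 0 → ∃ y, d p (q + 1) y = x)
    (he0 : ∀ p x, e (p + 1) 0 x = 0 → x = 0)
    (he : ∀ p q x, e (p + 1) (q + 1) x = 0 → ∃ y, e (p + 1) q y = x)
    (he' : ∀ q x, e 0 (q + 2) x = 0 → ∃ y, e 0 (q + 1) y = x)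
    (p : ℕ) (x : A (p + 2) 0) (hx : d (p + 2) 0 x = 0) : ∃ z, d (p + 1) 0 z = x := by
  have claim : ∀ p q (y : A (p + 1) (q + 1)), d (p + 1) _ (e (p + 1) _ y) = 0 →
      ∃ z w, y = e (p + 1) q z + d p (q + 1) w := by
    intro p
    induction p with
    | zero =>
      intro q y hy
      obtain ⟨y', hy'⟩ := hd 0 (q + 1) _ hy
      obtain ⟨z', hz'⟩ := he' q y' (hd0 _ _ (by rw [hde, hy', hee]))
      obtain ⟨z, hz⟩ := he 0 q (y - d 0 (q + 1) z')
        (by rw [map_sub, ← hde, hz', hy', sub_self])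
      exact ⟨z, z', by rw [hz]; abel⟩
    | succ p ih =>
      intro q y hy
      obtain ⟨y', hy'⟩ := hd (p + 1) (q + 1) _ hy
      obtain ⟨z', w', hz'⟩ := ih (q + 1) y' (by rw [hde, hy', hee])
      obtain ⟨z, hz⟩ := he (p + 1) q (y - d (p + 1) (q + 1) z')
        (by rw [map_sub, ← hde, ← hy', hz', map_add, hdd, add_zero, sub_self])
      exact ⟨z, z', by rw [hz]; abel⟩
  obtain ⟨y, hy⟩ := hd (p + 1) 0 (e (p + 2) 0 x) (by rw [hde, hx, map_zero])
  obtain ⟨z, w, hz⟩ := claim p 0 y (by rw [hde, hy, hee])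
  refine ⟨z, (sub_eq_zero.mp (he0 (p + 1) (x - d (p + 1) 0 z) ?_)).symm⟩
  rw [map_sub, ← hy, ← hde, hz, map_add, hdd, add_zero, sub_self]

/-- The double Čech complex of two covers. -/
abbrev CechDouble (Y : Scheme.{0}) {α β : Type} (U : α → Y.Opens) (V : β → Y.Opens) (p q : ℕ) : Type :=
  ∀ (f : Fin p → α) (g : Fin q → β), Γ(Y, (⨅ j, U (f j)) ⊓ ⨅ j, V (g j))

omit hO in
lemma iInf_comp_le {α : Type} (U : α → Y.Opens) (q : ℕ) (g : Fin (q + 1) → α)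
    (j : Fin (q + 1)) : ⨅ i, U (g i) ≤ ⨅ i, U ((g ∘ j.succAbove) i) :=
  le_iInf fun _ => iInf_le (fun t => U (g t)) _

set_option maxHeartbeats 1600000 in
omit hO in
/-- Čech acyclicity can be tested on a single finite affine cover. -/
theorem acyclicStructureSheaf_of_cover [IsAffineHom (Limits.pullback.diagonal
    (Limits.terminal.from Y))] [Finite β] (V : β → Y.Opens) (hV : ∀ i, IsAffineOpen (V i))
    (hVtop : iSup V = ⊤)
    (hexact : ∀ (q : ℕ) (s : ∀ g : Fin (q + 2) → β, Γ(Y, ⨅ j, V (g j))),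
      altDiff (O := fun q (g : Fin q → β) => ⨅ j, V (g j)) (iInf_comp_le V) (q + 2) s = 0 →
      ∃ t, altDiff (O := fun q (g : Fin q → β) => ⨅ j, V (g j)) (iInf_comp_le V) (q + 1) t = s)
    {m : ℕ} (U : Fin m → Y.Opens) (hU : ∀ i, IsAffineOpen (U i)) (hUtop : iSup U = ⊤) (p : ℕ)
    (s : ∀ g : Fin (p + 2) → Fin m, Γ(Y, ⨅ j, U (g j)))
    (hs : altDiff (O := fun q (g : Fin q → Fin m) => ⨅ j, U (g j)) (iInf_comp_le U) (p + 2) s = 0) :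
    ∃ t, altDiff (O := fun q (g : Fin q → Fin m) => ⨅ j, U (g j)) (iInf_comp_le U) (p + 1) t = s := by
  have hUO : ∀ {q : ℕ} (g : Fin q → β) (p : ℕ) (f : Fin (p + 1) → Fin m) (j : Fin (p + 1)),
      (⨅ i, U (f i)) ⊓ ⨅ i, V (g i) ≤ (⨅ i, U ((f ∘ j.succAbove) i)) ⊓ ⨅ i, V (g i) :=
    fun g p f j => inf_le_inf_right _ (iInf_comp_le U p f j)
  have hVO : ∀ {p : ℕ} (f : Fin p → Fin m) (q : ℕ) (g : Fin (q + 1) → β) (j : Fin (q + 1)),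
      (⨅ i, U (f i)) ⊓ ⨅ i, V (g i) ≤ (⨅ i, U (f i)) ⊓ ⨅ i, V ((g ∘ j.succAbove) i) :=
    fun f q g j => inf_le_inf_left _ (iInf_comp_le V q g j)
  let d : ∀ p q, CechDouble Y U V p q →+ CechDouble Y U V (p + 1) q := fun p q =>
    { toFun := fun s f g => altDiff (O := fun p (f : Fin p → Fin m) =>
        (⨅ i, U (f i)) ⊓ ⨅ i, V (g i)) (hUO g) p (fun f => s f g) f
      map_zero' := by
        funext f g
        simp [altDiff]
      map_add' := by
        intro x y
        funext f g
        simp [altDiff, Finset.sum_add_distrib] }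
  let e : ∀ p q, CechDouble Y U V p q →+ CechDouble Y U V p (q + 1) := fun p q =>
    { toFun := fun s f g => altDiff (O := fun q (g : Fin q → β) =>
        (⨅ i, U (f i)) ⊓ ⨅ i, V (g i)) (hVO f) q (fun g => s f g) g
      map_zero' := by
        funext f g
        simp [altDiff]
      map_add' := by
        intro x y
        funext f g
        simp [altDiff, Finset.sum_add_distrib] }
  have hUaff : ∀ p (f : Fin (p + 1) → Fin m), IsAffineOpen (⨅ i, U (f i)) := fun p f =>
    IsAffineOpen.iInf fun i => hU _
  have hVaff : ∀ p (f : Fin (p + 1) → β), IsAffineOpen (⨅ i, V (f i)) := fun p f =>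
    IsAffineOpen.iInf fun i => hV _
  have htop : ∀ {α : Type} (V : α → Y.Opens) (f : Fin 0 → α), ⨅ i, V (f i) = ⊤ :=
    fun V f => iInf_of_empty _
  have haff : ∀ p q (f : Fin p → Fin m) (g : Fin q → β), 0 < p ∨ 0 < q →
      IsAffineOpen ((⨅ i, U (f i)) ⊓ ⨅ i, V (g i)) := by
    intro p q f g h
    rcases p with _ | p
    · rcases q with _ | q
      · simp at h
      · rw [htop U, top_inf_eq]
        exact hVaff q g
    · rcases q with _ | q
      · rw [htop V, inf_top_eq]
        exact hUaff p f
      · exact (hUaff p f).inf (hVaff q g)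
  have hmain : ∃ z : CechDouble Y U V (p + 1) 0,
      d (p + 1) 0 z = fun f g => res inf_le_left (s f) := by
    refine exact_column_zero (A := CechDouble Y U V) d e ?_ ?_ ?_ ?_ ?_ ?_ ?_ ?_ p _ ?_
    · intro p q x
      funext f g
      simp only [d, e, altDiff, AddMonoidHom.coe_mk, ZeroHom.coe_mk, map_sum, map_zsmul, res_res,
        Finset.smul_sum]
      rw [Finset.sum_comm]
      simp only [smul_smul, mul_comm]
    · intro p q x
      funext f g
      exact congrFun (altDiff_altDiff (O := fun p (f : Fin p → Fin m) =>
          (⨅ i, U (f i)) ⊓ ⨅ i, V (g i)) (hUO g) p (fun f => x f g)) f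
    · intro p q x
      funext f g
      exact congrFun (altDiff_altDiff (O := fun q (g : Fin q → β) =>
          (⨅ i, U (f i)) ⊓ ⨅ i, V (g i)) (hVO f) q (fun g => x f g)) g
    · intro q x hx
      funext f g
      refine congrFun (altDiff_zero_injective (O := fun p (f : Fin p → Fin m) =>
          (⨅ i, U (f i)) ⊓ ⨅ i, V (g i)) (hUO g) (W := ⨅ i, V (g i)) (V := U) ?_ ?_
          (fun f => x f g) ?_) f
      · rw [hUtop]; exact le_top
      · intro q g; exact inf_comm _ _
      · funext f
        exact congrFun (congrFun hx f) g
    · intro p q x hx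
      have h : ∀ g : Fin (q + 1) → β, ∃ t : ∀ f : Fin p → Fin m, Γ(Y, (⨅ i, U (f i)) ⊓ ⨅ i, V (g i)),
          altDiff (O := fun p (f : Fin p → Fin m) =>
          (⨅ i, U (f i)) ⊓ ⨅ i, V (g i)) (hUO g) p t = fun f => x f g := by
        intro g
        refine altDiff_exact (O := fun p (f : Fin p → Fin m) =>
          (⨅ i, U (f i)) ⊓ ⨅ i, V (g i)) (hUO g) (W := ⨅ i, V (g i)) (hVaff q g) (V := U) ?_ ?_ ?_
          p (fun f => x f g) ?_
        · rw [hUtop]; exact le_top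
        · intro q g; exact inf_comm _ _
        · intro p f; exact haff _ _ _ _ (Or.inr (Nat.succ_pos _))
        · funext f
          exact congrFun (congrFun hx f) g
      choose t ht using h
      exact ⟨fun f g => t g f, funext fun f => funext fun g => congrFun (ht g) f⟩
    · intro p x hx
      funext f g
      refine congrFun (altDiff_zero_injective (O := fun q (g : Fin q → β) =>
          (⨅ i, U (f i)) ⊓ ⨅ i, V (g i)) (hVO f) (W := ⨅ i, U (f i)) (V := V) ?_ ?_
          (fun g => x f g) ?_) g
      · rw [hVtop]; exact le_top
      · intro q g; rfl
      · exact congrFun hx f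
    · intro p q x hx
      have h : ∀ f : Fin (p + 1) → Fin m, ∃ t : ∀ g : Fin q → β, Γ(Y, (⨅ i, U (f i)) ⊓ ⨅ i, V (g i)),
          altDiff (O := fun q (g : Fin q → β) =>
          (⨅ i, U (f i)) ⊓ ⨅ i, V (g i)) (hVO f) q t = x f := by
        intro f
        refine altDiff_exact (O := fun q (g : Fin q → β) =>
          (⨅ i, U (f i)) ⊓ ⨅ i, V (g i)) (hVO f) (W := ⨅ i, U (f i)) (hUaff p f) (V := V) ?_ ?_ ?_
          q (x f) (congrFun hx f)
        · rw [hVtop]; exact le_top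
        · intro q g; rfl
        · intro q g; exact haff _ _ _ _ (Or.inl (Nat.succ_pos _))
      choose t ht using h
      exact ⟨t, funext ht⟩
    · intro q x hx
      have hle : ∀ {q : ℕ} (g : Fin q → β) (f : Fin 0 → Fin m),
          (⨅ i, V (g i)) ≤ (⨅ i, U (f i)) ⊓ ⨅ i, V (g i) := by
        intro q g f
        rw [htop U, top_inf_eq]
      obtain ⟨t, ht⟩ := hexact q (fun g => res (hle g Fin.elim0) (x Fin.elim0 g)) (by
        funext g
        have := congrArg (res (hle g Fin.elim0)) (congrFun (congrFun hx Fin.elim0) g)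
        simpa only [e, altDiff, AddMonoidHom.coe_mk, ZeroHom.coe_mk, map_sum, map_zsmul, res_res,
          Pi.zero_apply, map_zero] using this)
      refine ⟨fun f g => res inf_le_right (t g), ?_⟩
      funext f g
      obtain rfl : f = Fin.elim0 := Subsingleton.elim _ _
      have := congrArg (res (inf_le_right : (⨅ i, U (Fin.elim0 i)) ⊓ ⨅ i, V (g i) ≤ _)) (congrFun ht g)
      simp only [altDiff, map_sum, map_zsmul, res_res, res_self] at this
      simp only [e, altDiff, AddMonoidHom.coe_mk, ZeroHom.coe_mk, res_res]
      exact this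
    · funext f g
      have := congrArg (res (inf_le_left : (⨅ i, U (f i)) ⊓ ⨅ i, V (g i) ≤ _)) (congrFun hs f)
      simp only [altDiff, map_sum, map_zsmul, res_res, Pi.zero_apply, map_zero] at this
      simp only [d, altDiff, AddMonoidHom.coe_mk, ZeroHom.coe_mk, res_res]
      exact this
  obtain ⟨z, hz⟩ := hmain
  have hle : ∀ {p : ℕ} (f : Fin p → Fin m) (g : Fin 0 → β),
      (⨅ i, U (f i)) ≤ (⨅ i, U (f i)) ⊓ ⨅ i, V (g i) := by
    intro p f g
    rw [htop V, inf_top_eq]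
  refine ⟨fun f => res (hle f Fin.elim0) (z f Fin.elim0), ?_⟩
  funext f
  have := congrArg (res (hle f Fin.elim0)) (congrFun (congrFun hz f) Fin.elim0)
  simp only [d, altDiff, AddMonoidHom.coe_mk, ZeroHom.coe_mk, map_sum, map_zsmul, res_res,
    res_self] at this
  simp only [altDiff, res_res]
  exact this

end CechComplex

section ReesModule

variable {R 𝔽 : Type} [CommRing R] [Field 𝔽] [Algebra R 𝔽]

/-- The Rees algebra `⨁ Nⁱ Xⁱ` of a submodule `N` of an algebra. -/
def reesSubalgebra (N : Submodule R 𝔽) : Subalgebra R (Polynomial 𝔽) where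
  carrier := {p | ∀ i, p.coeff i ∈ N ^ i}
  mul_mem' := by
    intro p q hp hq i
    rw [Polynomial.coeff_mul]
    refine Submodule.sum_mem _ fun x hx => ?_
    rw [← Finset.HasAntidiagonal.mem_antidiagonal.mp hx, pow_add]
    exact Submodule.mul_mem_mul (hp _) (hq _)
  add_mem' := by
    intro p q hp hq i
    rw [Polynomial.coeff_add]
    exact Submodule.add_mem _ (hp i) (hq i)
  algebraMap_mem' := by
    intro r i
    rw [Polynomial.algebraMap_apply, Polynomial.coeff_C]
    split_ifs with h
    · rw [h, pow_zero]
      exact Submodule.algebraMap_mem r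
    · exact Submodule.zero_mem _

variable (N : Submodule R 𝔽)

lemma monomial_mem_reesSubalgebra {i : ℕ} {x : 𝔽} (hx : x ∈ N ^ i) :
    Polynomial.monomial i x ∈ reesSubalgebra N := by
  intro j
  rw [Polynomial.coeff_monomial]
  split_ifs with h
  · rwa [← h]
  · exact Submodule.zero_mem _

/-- The grading of the Rees algebra. -/
def reesGrading (i : ℕ) : Submodule R (reesSubalgebra N) where
  carrier := {p | ∀ j, j ≠ i → (p : Polynomial 𝔽).coeff j = 0}
  add_mem' := by
    intro p q hp hq j hj
    simp [hp j hj, hq j hj]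
  zero_mem' := by simp
  smul_mem' := by
    intro r p hp j hj
    simp [hp j hj]

lemma eq_monomial_of_mem_reesGrading {i : ℕ} {p : reesSubalgebra N} (hp : p ∈ reesGrading N i) :
    (p : Polynomial 𝔽) = Polynomial.monomial i ((p : Polynomial 𝔽).coeff i) := by
  ext j
  rw [Polynomial.coeff_monomial]
  split_ifs with h
  · rw [h]
  · exact hp j (Ne.symm h)

instance reesGrading_gradedMonoid : SetLike.GradedMonoid (reesGrading N) where
  one_mem := by
    intro j hj
    simp [Polynomial.coeff_one, hj]
  mul_mem := by
    intro i j p q hp hq k hk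
    rw [Subalgebra.coe_mul, eq_monomial_of_mem_reesGrading N hp,
      eq_monomial_of_mem_reesGrading N hq, Polynomial.monomial_mul_monomial,
      Polynomial.coeff_monomial, if_neg (Ne.symm hk)]

lemma coeff_coeAddMonoidHom_reesGrading (x : DirectSum ℕ fun i => reesGrading N i) (i : ℕ) :
    (DirectSum.coeAddMonoidHom (reesGrading N) x : Polynomial 𝔽).coeff i =
      ((x i : reesSubalgebra N) : Polynomial 𝔽).coeff i := by
  classical
  induction x using DirectSum.induction_on with
  | zero => simp
  | of j y =>
    rw [DirectSum.coeAddMonoidHom_of]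
    by_cases h : j = i
    · subst h
      rw [DirectSum.of_eq_same]
    · rw [DirectSum.of_eq_of_ne _ _ _ (Ne.symm h), y.2 i (Ne.symm h)]
      simp
  | add x y hx hy => simp [hx, hy]

noncomputable instance reesGrading_gradedRing : GradedRing (reesGrading N) where
  decompose' p := DirectSum.mk (fun i => reesGrading N i) (p : Polynomial 𝔽).support fun i =>
    ⟨⟨Polynomial.monomial i ((p : Polynomial 𝔽).coeff i), monomial_mem_reesSubalgebra N (p.2 i)⟩,
      fun j hj => by simp [Polynomial.coeff_monomial, Ne.symm hj]⟩
  left_inv p := by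
    ext i
    rw [coeff_coeAddMonoidHom_reesGrading]
    by_cases h : i ∈ (p : Polynomial 𝔽).support
    · rw [DirectSum.mk_apply_of_mem h]
      simp
    · rw [DirectSum.mk_apply_of_notMem h]
      simpa using (Polynomial.notMem_support_iff.mp h).symm
  right_inv x := by
    refine DFinsupp.ext fun i => Subtype.ext (Subtype.ext (Polynomial.ext fun j => ?_))
    have h : ∀ (y : DirectSum ℕ fun i => reesGrading N i), j ≠ i →
        ((y i : reesSubalgebra N) : Polynomial 𝔽).coeff j = 0 := fun y hj => (y i).2 j hj
    by_cases hj : j = i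
    · subst hj
      by_cases h : j ∈ ((DirectSum.coeAddMonoidHom (reesGrading N) x : reesSubalgebra N) :
          Polynomial 𝔽).support
      · rw [DirectSum.mk_apply_of_mem h]
        simp [coeff_coeAddMonoidHom_reesGrading]
      · rw [DirectSum.mk_apply_of_notMem h]
        rw [Polynomial.notMem_support_iff, coeff_coeAddMonoidHom_reesGrading] at h
        simpa using h.symm
    · rw [h _ hj, h _ hj]

variable {N} {ι : Type} (Δ : ι → 𝔽) (hN : N = Submodule.span R (Set.range Δ))

/-- Degree one generators of the Rees algebra. -/
noncomputable def reesGen (hN : N = Submodule.span R (Set.range Δ)) (i : ι) : reesSubalgebra N :=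
  ⟨Polynomial.monomial 1 (Δ i), monomial_mem_reesSubalgebra N (by
    rw [pow_one, hN]; exact Submodule.subset_span ⟨i, rfl⟩)⟩

lemma reesGen_mem (i : ι) : reesGen Δ hN i ∈ reesGrading N 1 := fun j hj => by
  simp [reesGen, Polynomial.coeff_monomial, Ne.symm hj]

lemma adjoin_reesGen : Algebra.adjoin R (Set.range (reesGen Δ hN)) = ⊤ := by
  have h1 : ∀ i, ∀ x ∈ N ^ i, Polynomial.monomial i x ∈
      Algebra.adjoin R (Set.range fun j => Polynomial.monomial 1 (Δ j)) := by
    intro i x hx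
    induction hx using Submodule.pow_induction_on_left' with
    | algebraMap r =>
      exact Subalgebra.algebraMap_mem _ r
    | add x y i hx hy ihx ihy =>
      rw [map_add]
      exact add_mem ihx ihy
    | mem_mul m hm i x hx ih =>
      rw [Nat.succ_eq_add_one, add_comm, ← Polynomial.monomial_mul_monomial]
      refine mul_mem ?_ ih
      rw [hN] at hm
      induction hm using Submodule.span_induction with
      | mem x hx =>
        obtain ⟨j, rfl⟩ := hx
        exact Algebra.subset_adjoin ⟨j, rfl⟩
      | zero => simp
      | add x y _ _ hx hy =>
        rw [map_add]
        exact add_mem hx hy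
      | smul r x _ hx =>
        rw [← Polynomial.smul_monomial]
        exact Subalgebra.smul_mem _ hx r
  have h2 : Subalgebra.map (reesSubalgebra N).val (Algebra.adjoin R (Set.range (reesGen Δ hN))) =
      Algebra.adjoin R (Set.range fun j => Polynomial.monomial 1 (Δ j)) := by
    rw [AlgHom.map_adjoin, ← Set.range_comp]
    rfl
  rw [eq_top_iff]
  intro p _
  have h3 : (p : Polynomial 𝔽) ∈ Subalgebra.map (reesSubalgebra N).val
      (Algebra.adjoin R (Set.range (reesGen Δ hN))) := by
    rw [h2, Polynomial.as_sum_support (p : Polynomial 𝔽)]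
    exact sum_mem fun i _ => h1 i _ (p.2 i)
  obtain ⟨q, hq, hqp⟩ := h3
  rwa [← Subtype.ext hqp]

/-- The degree zero part of the Rees algebra is the base ring. -/
noncomputable def reesZeroHom (N : Submodule R 𝔽) : R →+* reesGrading N 0 where
  toFun r := ⟨algebraMap R _ r, fun j hj => by
    simp [Polynomial.algebraMap_apply, Polynomial.coeff_C, hj]⟩
  map_one' := Subtype.ext (map_one _)
  map_mul' _ _ := Subtype.ext (map_mul _ _ _)
  map_zero' := Subtype.ext (map_zero _)
  map_add' _ _ := Subtype.ext (map_add _ _ _)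

lemma reesZeroHom_bijective (hinj : Function.Injective (algebraMap R 𝔽)) :
    Function.Bijective (reesZeroHom N) := by
  constructor
  · intro r s h
    have := congrArg (fun x : reesGrading N 0 => ((x : reesSubalgebra N) : Polynomial 𝔽).coeff 0) h
    simp only [reesZeroHom, RingHom.coe_mk, MonoidHom.coe_mk, OneHom.coe_mk,
      Subalgebra.coe_algebraMap, Polynomial.algebraMap_apply, Polynomial.coeff_C_zero] at this
    exact hinj this
  · intro x
    have h0 := x.1.2 0
    rw [pow_zero, Submodule.mem_one] at h0
    obtain ⟨r, hr⟩ := h0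
    refine ⟨r, Subtype.ext (Subtype.ext ?_)⟩
    rw [eq_monomial_of_mem_reesGrading N x.2, ← hr]
    rfl

lemma adjoin_zero_reesGen : Algebra.adjoin (reesGrading N 0) (Set.range (reesGen Δ hN)) = ⊤ := by
  rw [eq_top_iff]
  intro p _
  have hp : p ∈ Algebra.adjoin R (Set.range (reesGen Δ hN)) := by
    rw [adjoin_reesGen]; trivial
  induction hp using Algebra.adjoin_induction with
  | mem x hx => exact Algebra.subset_adjoin hx
  | algebraMap r => exact Subalgebra.algebraMap_mem _ (reesZeroHom N r)
  | add x y _ _ hx hy => exact add_mem (hx trivial) (hy trivial)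
  | mul x y _ _ hx hy => exact mul_mem (hx trivial) (hy trivial)

include Δ hN in
lemma finiteType_rees [Finite ι] : Algebra.FiniteType (reesGrading N 0) (reesSubalgebra N) := by
  have := Fintype.ofFinite ι
  classical
  refine ⟨⟨Finset.univ.image (reesGen Δ hN), ?_⟩⟩
  rw [Finset.coe_image, Finset.coe_univ, Set.image_univ]
  exact adjoin_zero_reesGen Δ hN

end ReesModule

section ReesGeneric

variable {R 𝔽 : Type} [CommRing R] [Field 𝔽] [Algebra R 𝔽]
variable {N : Submodule R 𝔽} {ι : Type} (Δ : ι → 𝔽) (hN : N = Submodule.span R (Set.range Δ))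

lemma reesGen_ne_zero {i : ι} (hi : Δ i ≠ 0) : reesGen Δ hN i ≠ 0 := by
  intro h
  have := congrArg (fun p : reesSubalgebra N => (p : Polynomial 𝔽).coeff 1) h
  simp [reesGen] at this
  exact hi this

/-- The generic point of the projective spectrum of the Rees algebra. -/
noncomputable def reesGenericPoint [Nonempty ι] (hΔ : ∀ i, Δ i ≠ 0) :
    ProjectiveSpectrum (reesGrading N) :=
  ⟨⊥, by
    rw [HomogeneousIdeal.toIdeal_bot]
    exact Ideal.isPrime_bot, by
    intro h
    have h1 : reesGen Δ hN (Classical.arbitrary ι) ∈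
        HomogeneousIdeal.irrelevant (reesGrading N) := by
      rw [HomogeneousIdeal.mem_irrelevant_iff, GradedRing.proj_apply,
        DirectSum.decompose_of_mem_ne _ (reesGen_mem Δ hN _) one_ne_zero]
    exact reesGen_ne_zero Δ hN (hΔ _) (by
      have h2 : reesGen Δ hN (Classical.arbitrary ι) ∈
          (⊥ : HomogeneousIdeal (reesGrading N)).toIdeal := h h1
      rwa [HomogeneousIdeal.toIdeal_bot, Ideal.mem_bot] at h2)⟩

variable [Nonempty ι] (hΔ : ∀ i, Δ i ≠ 0)

lemma mem_reesGenericPoint (x : reesSubalgebra N) :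
    x ∈ (reesGenericPoint Δ hN hΔ).asHomogeneousIdeal.toIdeal ↔ x = 0 := by
  change x ∈ (⊥ : HomogeneousIdeal (reesGrading N)).toIdeal ↔ x = 0
  rw [HomogeneousIdeal.toIdeal_bot, Ideal.mem_bot]

instance : (reesGenericPoint Δ hN hΔ).asHomogeneousIdeal.toIdeal.IsPrime :=
  (reesGenericPoint Δ hN hΔ).isPrime

/-- Evaluation of the localization at the generic point in the field of rational functions. -/
noncomputable def reesGenericEval :
    Localization (reesGenericPoint Δ hN hΔ).asHomogeneousIdeal.toIdeal.primeCompl →+*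
      FractionRing (Polynomial 𝔽) :=
  IsLocalization.lift (M := (reesGenericPoint Δ hN hΔ).asHomogeneousIdeal.toIdeal.primeCompl)
    (g := (algebraMap (Polynomial 𝔽) (FractionRing (Polynomial 𝔽))).comp
      (reesSubalgebra N).val.toRingHom) (by
    rintro ⟨y, hy⟩
    refine IsUnit.mk0 _ fun h => hy ?_
    refine (mem_reesGenericPoint Δ hN hΔ y).mpr ?_
    have := (map_eq_zero_iff _ (IsFractionRing.injective (Polynomial 𝔽)
      (FractionRing (Polynomial 𝔽)))).mp h
    exact Subtype.ext this)


/-- Evaluation of sections at the generic point. -/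
noncomputable def sectionEval (O : (Proj (reesGrading N)).Opens)
    (h : reesGenericPoint Δ hN hΔ ∈ O) :
    Γ(Proj (reesGrading N), O) →+* FractionRing (Polynomial 𝔽) :=
  (reesGenericEval Δ hN hΔ).comp ((algebraMap (HomogeneousLocalization.AtPrime (reesGrading N)
    (reesGenericPoint Δ hN hΔ).asHomogeneousIdeal.toIdeal) 
    (Localization (reesGenericPoint Δ hN hΔ).asHomogeneousIdeal.toIdeal.primeCompl)).comp
    (AlgebraicGeometry.openToLocalization (reesGrading N) O _ h).hom)

lemma mem_basicOpen_reesGenericPoint (f : reesSubalgebra N) :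
    reesGenericPoint Δ hN hΔ ∈ Proj.basicOpen (reesGrading N) f ↔ f ≠ 0 :=
  (Proj.mem_basicOpen (𝒜 := reesGrading N) f (reesGenericPoint Δ hN hΔ)).trans
    (not_congr (mem_reesGenericPoint Δ hN hΔ f))

lemma reesGenericEval_algebraMap (x : reesSubalgebra N) :
    reesGenericEval Δ hN hΔ (algebraMap (reesSubalgebra N) _ x) =
      algebraMap (Polynomial 𝔽) _ (x : Polynomial 𝔽) := by
  rw [reesGenericEval]
  exact IsLocalization.lift_eq _ x

lemma reesGenericEval_mk' (x : reesSubalgebra N)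
    (y : (reesGenericPoint Δ hN hΔ).asHomogeneousIdeal.toIdeal.primeCompl) :
    reesGenericEval Δ hN hΔ (IsLocalization.mk' _ x y) *
      algebraMap (Polynomial 𝔽) _ ((y : reesSubalgebra N) : Polynomial 𝔽) =
      algebraMap (Polynomial 𝔽) _ (x : Polynomial 𝔽) := by
  rw [← reesGenericEval_algebraMap Δ hN hΔ, ← reesGenericEval_algebraMap Δ hN hΔ, ← map_mul,
    IsLocalization.mk'_spec]

lemma sectionEval_awayToSection (f : reesSubalgebra N)
    (h : reesGenericPoint Δ hN hΔ ∈ Proj.basicOpen (reesGrading N) f)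
    (c : HomogeneousLocalization.NumDenSameDeg (reesGrading N) (Submonoid.powers f)) :
    sectionEval Δ hN hΔ _ h ((Proj.awayToSection (reesGrading N) f).hom
      (HomogeneousLocalization.mk c)) *
      algebraMap (Polynomial 𝔽) _ (c.den : reesSubalgebra N) =
      algebraMap (Polynomial 𝔽) _ (c.num : reesSubalgebra N) := by
  have h1 := ProjectiveSpectrum.Proj.awayToSection_apply (𝒜 := reesGrading N) f
    (HomogeneousLocalization.mk c) ⟨reesGenericPoint Δ hN hΔ, h⟩
  have h2 : sectionEval Δ hN hΔ _ h ((Proj.awayToSection (reesGrading N) f).hom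
      (HomogeneousLocalization.mk c)) = _ := congrArg (reesGenericEval Δ hN hΔ) h1
  rw [h2, HomogeneousLocalization.val_mk, Localization.mk_eq_mk', IsLocalization.map_mk']
  exact reesGenericEval_mk' Δ hN hΔ _ _

lemma awayToSection_bijective (f : reesSubalgebra N) {d : ℕ} (hd : 0 < d)
    (hf : f ∈ reesGrading N d) :
    Function.Bijective (Proj.awayToSection (reesGrading N) f).hom := by
  have h : IsIso (Proj.awayToSection (reesGrading N) f) := by
    rw [← Proj.basicOpenIsoAway_hom (reesGrading N) f hf hd]
    infer_instance
  exact ConcreteCategory.bijective_of_isIso (Proj.awayToSection (reesGrading N) f)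

/-- Constants in the field of rational functions. -/
noncomputable def constHom (𝔽 : Type) [Field 𝔽] : 𝔽 →+* FractionRing (Polynomial 𝔽) :=
  (algebraMap (Polynomial 𝔽) (FractionRing (Polynomial 𝔽))).comp Polynomial.C

lemma sectionEval_eq (f : reesSubalgebra N) {d : ℕ} (hd : 0 < d)
    (hf : f ∈ reesGrading N d) {δ : 𝔽} (hδ : (f : Polynomial 𝔽) = Polynomial.monomial d δ)
    (h : reesGenericPoint Δ hN hΔ ∈ Proj.basicOpen (reesGrading N) f)
    (s : Γ(Proj (reesGrading N), Proj.basicOpen (reesGrading N) f)) :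
    ∃ x : 𝔽, (∃ k : ℕ, x * δ ^ k ∈ N ^ (k * d)) ∧
      sectionEval Δ hN hΔ _ h s = constHom 𝔽 x ∧ (x = 0 → s = 0) := by
  obtain ⟨z, rfl⟩ := (awayToSection_bijective f hd hf).2 s
  obtain ⟨c, rfl⟩ := HomogeneousLocalization.mk_surjective z
  obtain ⟨k, hk⟩ := c.den_mem
  replace hk : f ^ k = c.den := hk
  have hf0 : f ≠ 0 := (mem_basicOpen_reesGenericPoint Δ hN hΔ f).mp h
  have hδ0 : δ ≠ 0 := by
    rintro rfl
    exact hf0 (Subtype.ext (by simpa using hδ))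
  have hfk : ((f ^ k : reesSubalgebra N) : Polynomial 𝔽) = Polynomial.monomial (k * d) (δ ^ k) := by
    rw [SubmonoidClass.coe_pow, hδ, Polynomial.monomial_pow, mul_comm]
  have hfk0 : f ^ k ≠ 0 := fun h0 => by
    rw [h0] at hfk
    exact pow_ne_zero k hδ0 ((Polynomial.monomial_eq_zero_iff _ _).mp hfk.symm)
  have hdeg : c.deg = k * d := by
    have h1 : f ^ k ∈ reesGrading N c.deg := by
      rw [hk]; exact c.den.2
    by_contra hne
    have := h1 (k * d) (Ne.symm hne)
    rw [hfk, Polynomial.coeff_monomial, if_pos rfl] at this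
    exact pow_ne_zero k hδ0 this
  have hnum : ((c.num : reesSubalgebra N) : Polynomial 𝔽) = Polynomial.monomial (k * d)
      (((c.num : reesSubalgebra N) : Polynomial 𝔽).coeff (k * d)) := by
    have hmem : (c.num : reesSubalgebra N) ∈ reesGrading N (k * d) := by
      rw [← hdeg]
      exact c.num.2
    exact eq_monomial_of_mem_reesGrading N hmem
  set y := ((c.num : reesSubalgebra N) : Polynomial 𝔽).coeff (k * d) with hy
  refine ⟨y / δ ^ k, ⟨k, ?_⟩, ?_, ?_⟩
  · rw [div_mul_cancel₀ _ (pow_ne_zero k hδ0)]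
    exact (c.num : reesSubalgebra N).2 _
  · have h1 := sectionEval_awayToSection Δ hN hΔ f h c
    rw [hnum, ← hk, hfk] at h1
    have h2 : algebraMap (Polynomial 𝔽) (FractionRing (Polynomial 𝔽))
        (Polynomial.monomial (k * d) (δ ^ k)) ≠ 0 := by
      rw [Ne, map_eq_zero_iff _ (IsFractionRing.injective (Polynomial 𝔽)
        (FractionRing (Polynomial 𝔽))), Polynomial.monomial_eq_zero_iff]
      exact pow_ne_zero k hδ0
    apply mul_right_cancel₀ h2
    rw [h1, constHom, RingHom.comp_apply, ← map_mul, Polynomial.C_mul_monomial,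
      div_mul_cancel₀ _ (pow_ne_zero k hδ0)]
  · intro h0
    have h0 : y = 0 := by simpa [hδ0] using h0
    rw [h0, Polynomial.monomial_zero_right] at hnum
    have h1 : (c.num : reesSubalgebra N) = 0 := Subtype.ext hnum
    have h2 : HomogeneousLocalization.mk c = 0 := by
      apply HomogeneousLocalization.val_injective
      rw [HomogeneousLocalization.val_mk, h1, HomogeneousLocalization.val_zero,
        Localization.mk_zero]
    rw [h2, map_zero]

lemma sectionEval_injective (f : reesSubalgebra N) {d : ℕ} (hd : 0 < d)
    (hf : f ∈ reesGrading N d)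
    (h : reesGenericPoint Δ hN hΔ ∈ Proj.basicOpen (reesGrading N) f) :
    Function.Injective (sectionEval Δ hN hΔ _ h) := by
  rw [injective_iff_map_eq_zero]
  intro s hs
  obtain ⟨x, -, hx, h0⟩ := sectionEval_eq Δ hN hΔ f hd hf
    (eq_monomial_of_mem_reesGrading N hf) h s
  refine h0 ?_
  rw [hs] at hx
  exact ((map_eq_zero_iff _ (RingHom.injective (constHom 𝔽))).mp hx.symm)

lemma exists_sectionEval_eq (f : reesSubalgebra N) {d : ℕ} {δ : 𝔽} (hδ : (f : Polynomial 𝔽) = Polynomial.monomial d δ)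
    (h : reesGenericPoint Δ hN hΔ ∈ Proj.basicOpen (reesGrading N) f) {x : 𝔽} {k : ℕ}
    (hx : x * δ ^ k ∈ N ^ (k * d)) :
    ∃ s, sectionEval Δ hN hΔ _ h s = constHom 𝔽 x := by
  have hf0 : f ≠ 0 := (mem_basicOpen_reesGenericPoint Δ hN hΔ f).mp h
  have hδ0 : δ ≠ 0 := by
    rintro rfl
    exact hf0 (Subtype.ext (by simpa using hδ))
  have hfk : ((f ^ k : reesSubalgebra N) : Polynomial 𝔽) = Polynomial.monomial (k * d) (δ ^ k) := by
    rw [SubmonoidClass.coe_pow, hδ, Polynomial.monomial_pow, mul_comm]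
  let c : HomogeneousLocalization.NumDenSameDeg (reesGrading N) (Submonoid.powers f) :=
    { deg := k * d
      num := ⟨⟨Polynomial.monomial (k * d) (x * δ ^ k), monomial_mem_reesSubalgebra N hx⟩,
        fun j hj => by simp [Polynomial.coeff_monomial, Ne.symm hj]⟩
      den := ⟨f ^ k, by
        intro j hj
        rw [hfk, Polynomial.coeff_monomial, if_neg (Ne.symm hj)]⟩
      den_mem := ⟨k, rfl⟩ }
  refine ⟨(Proj.awayToSection (reesGrading N) f).hom (HomogeneousLocalization.mk c), ?_⟩
  have h1 := sectionEval_awayToSection Δ hN hΔ f h c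
  have h2 : algebraMap (Polynomial 𝔽) (FractionRing (Polynomial 𝔽))
      (Polynomial.monomial (k * d) (δ ^ k)) ≠ 0 := by
    rw [Ne, map_eq_zero_iff _ (IsFractionRing.injective (Polynomial 𝔽)
      (FractionRing (Polynomial 𝔽))), Polynomial.monomial_eq_zero_iff]
    exact pow_ne_zero k hδ0
  apply mul_right_cancel₀ h2
  rw [constHom, RingHom.comp_apply, ← map_mul, Polynomial.C_mul_monomial, ← hfk]
  exact h1

end ReesGeneric

section ReesCech

variable {R 𝔽 : Type} [CommRing R] [Field 𝔽] [Algebra R 𝔽]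
variable {N : Submodule R 𝔽} {ι : Type} (Δ : ι → 𝔽) (hN : N = Submodule.span R (Set.range Δ))

/-- The sections, inside the field `𝔽`, over an intersection of standard charts of the
projective spectrum of the Rees algebra of `N`. -/
def IsReesSection (N : Submodule R 𝔽) (Δ : ι → 𝔽) {q : ℕ} (g : Fin q → ι) (x : 𝔽) : Prop :=
  ∃ k : ℕ, x * (∏ l, Δ (g l)) ^ k ∈ N ^ (k * q)

/-- The degree one standard charts. -/
noncomputable def reesChart (i : ι) : (Proj (reesGrading N)).Opens :=
  Proj.basicOpen (reesGrading N) (reesGen Δ hN i)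

lemma iInf_reesChart {q : ℕ} (g : Fin (q + 1) → ι) :
    ⨅ j, reesChart Δ hN (g j) =
      Proj.basicOpen (reesGrading N) (∏ j, reesGen Δ hN (g j)) := by
  induction q with
  | zero => simp [reesChart]
  | succ q ih =>
    rw [Fin.prod_univ_succ, Proj.basicOpen_mul, ← ih fun j => g j.succ]
    apply le_antisymm
    · exact le_inf (iInf_le _ 0) (le_iInf fun j => iInf_le _ j.succ)
    · refine le_iInf fun j => Fin.cases inf_le_left (fun j => ?_) j
      exact inf_le_right.trans (iInf_le (fun j : Fin (q + 1) => reesChart Δ hN (g j.succ)) j)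

lemma prod_reesGen_mem {q : ℕ} (g : Fin q → ι) :
    ∏ j, reesGen Δ hN (g j) ∈ reesGrading N q := by
  have := SetLike.prod_mem_graded (A := reesGrading N) (fun _ => 1) (fun j => reesGen Δ hN (g j))
    (F := Finset.univ) fun j _ => reesGen_mem Δ hN (g j)
  simpa using this

lemma coe_prod_reesGen {q : ℕ} (g : Fin q → ι) :
    ((∏ j, reesGen Δ hN (g j) : reesSubalgebra N) : Polynomial 𝔽) =
      Polynomial.monomial q (∏ j, Δ (g j)) := by
  induction q with
  | zero => simp
  | succ q ih =>
    rw [Fin.prod_univ_succ, Subalgebra.coe_mul, ih, Fin.prod_univ_succ, reesGen,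
      Polynomial.monomial_mul_monomial, add_comm]

variable [Nonempty ι] (hΔ : ∀ i, Δ i ≠ 0)

lemma reesGenericPoint_mem_iInf {q : ℕ} (g : Fin (q + 1) → ι) :
    reesGenericPoint Δ hN hΔ ∈ ⨅ j, reesChart Δ hN (g j) := by
  rw [iInf_reesChart]
  rw [mem_basicOpen_reesGenericPoint, Finset.prod_ne_zero_iff]
  exact fun j _ => reesGen_ne_zero Δ hN (hΔ _)

include hΔ in
lemma rees_altDiff_exact {p : ℕ}
    (hcech : ∀ c : (Fin (p + 2) → ι) → 𝔽, (∀ g, IsReesSection N Δ g (c g)) →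
      (∀ g : Fin (p + 3) → ι, ∑ j : Fin (p + 3), (-1) ^ (j : ℕ) * c (g ∘ j.succAbove) = 0) →
      ∃ y : (Fin (p + 1) → ι) → 𝔽, (∀ g, IsReesSection N Δ g (y g)) ∧
        ∀ g : Fin (p + 2) → ι, ∑ j : Fin (p + 2), (-1) ^ (j : ℕ) * y (g ∘ j.succAbove) = c g)
    (s : ∀ g : Fin (p + 2) → ι, Γ(Proj (reesGrading N), ⨅ j, reesChart Δ hN (g j)))
    (hs : altDiff (O := fun q (g : Fin q → ι) => ⨅ j, reesChart Δ hN (g j))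
      (iInf_comp_le (reesChart Δ hN)) (p + 2) s = 0) :
    ∃ t, altDiff (O := fun q (g : Fin q → ι) => ⨅ j, reesChart Δ hN (g j))
      (iInf_comp_le (reesChart Δ hN)) (p + 1) t = s := by
  have hη := fun {q : ℕ} (g : Fin (q + 1) → ι) => reesGenericPoint_mem_iInf Δ hN hΔ g
  have hmem := fun {q : ℕ} (g : Fin (q + 1) → ι) =>
    (iInf_reesChart Δ hN g) ▸ reesGenericPoint_mem_iInf Δ hN hΔ g
  have hval : ∀ {q : ℕ} (g : Fin (q + 1) → ι)
      (s : Γ(Proj (reesGrading N), ⨅ j, reesChart Δ hN (g j))),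
      ∃ x : 𝔽, IsReesSection N Δ g x ∧ sectionEval Δ hN hΔ _ (hη g) s = constHom 𝔽 x := by
    intro q g
    have key := sectionEval_eq Δ hN hΔ _ q.succ_pos (prod_reesGen_mem Δ hN g)
      (coe_prod_reesGen Δ hN g)
    revert key
    generalize hη g = h
    revert h
    rw [iInf_reesChart Δ hN g]
    intro h key s
    obtain ⟨x, hx, hx', -⟩ := key h s
    exact ⟨x, hx, hx'⟩
  have hinj : ∀ {q : ℕ} (g : Fin (q + 1) → ι),
      Function.Injective (sectionEval Δ hN hΔ _ (hη g)) := by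
    intro q g
    have key := sectionEval_injective Δ hN hΔ _ q.succ_pos (prod_reesGen_mem Δ hN g)
    revert key
    generalize hη g = h
    revert h
    rw [iInf_reesChart Δ hN g]
    exact fun h key => key h
  have hsurj : ∀ {q : ℕ} (g : Fin (q + 1) → ι) (x : 𝔽), IsReesSection N Δ g x →
      ∃ s, sectionEval Δ hN hΔ _ (hη g) s = constHom 𝔽 x := by
    rintro q g x ⟨k, hk⟩
    generalize hη g = h
    revert h
    rw [iInf_reesChart Δ hN g]
    exact fun h => exists_sectionEval_eq Δ hN hΔ _ (coe_prod_reesGen Δ hN g) h hk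
  have hd : ∀ {q : ℕ} (s : ∀ g : Fin (q + 1) → ι,
      Γ(Proj (reesGrading N), ⨅ j, reesChart Δ hN (g j))) (c : (Fin (q + 1) → ι) → 𝔽)
      (_ : ∀ g, sectionEval Δ hN hΔ _ (hη g) (s g) = constHom 𝔽 (c g)) (g : Fin (q + 2) → ι),
      sectionEval Δ hN hΔ _ (hη g) (altDiff (O := fun q (g : Fin q → ι) =>
        ⨅ j, reesChart Δ hN (g j)) (iInf_comp_le (reesChart Δ hN)) (q + 1) s g) =
      constHom 𝔽 (∑ j : Fin (q + 2), (-1) ^ (j : ℕ) * c (g ∘ j.succAbove)) := by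
    intro q s c hsc g
    rw [altDiff, map_sum, map_sum]
    refine Finset.sum_congr rfl fun j _ => ?_
    rw [map_zsmul, zsmul_eq_mul, map_mul]
    congr 1
    · simp
    · exact hsc (g ∘ j.succAbove)
  choose c hc hc' using fun g => hval g (s g)
  obtain ⟨y, hy, hyc⟩ := hcech c hc fun g => by
    apply (constHom 𝔽).injective
    rw [← hd s c hc' g, congrFun hs g, map_zero]
    exact map_zero _
  choose t ht using fun g => hsurj g (y g) (hy g)
  refine ⟨t, funext fun g => hinj g ?_⟩
  rw [hd t y ht g, hyc g, hc' g]

end ReesCech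

section ReesResolution

variable {R 𝔽 : Type} [CommRing R] [Field 𝔽] [Algebra R 𝔽]
variable {N : Submodule R 𝔽} {ι : Type} (Δ : ι → 𝔽) (hN : N = Submodule.span R (Set.range Δ))
variable [Nonempty ι] (hΔ : ∀ i, Δ i ≠ 0)

/-- The basic open subset of an affine scheme attached to a function. -/
def specBasicOpen (r : R) : (Spec (CommRingCat.of R)).Opens := PrimeSpectrum.basicOpen r

lemma reesGenericPoint_mem_reesChart (i : ι) :
    reesGenericPoint Δ hN hΔ ∈ Proj.basicOpen (reesGrading N) (reesGen Δ hN i) := by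
  rw [mem_basicOpen_reesGenericPoint]
  exact reesGen_ne_zero Δ hN (hΔ _)

/-- The coordinate ring of a standard chart, evaluated at the generic point. -/
noncomputable def awayEval (i : ι) :
    HomogeneousLocalization.Away (reesGrading N) (reesGen Δ hN i) →+*
      FractionRing (Polynomial 𝔽) :=
  (sectionEval Δ hN hΔ _ (reesGenericPoint_mem_reesChart Δ hN hΔ i)).comp
    (Proj.awayToSection (reesGrading N) (reesGen Δ hN i)).hom

lemma awayEval_mk (i : ι) (c : HomogeneousLocalization.NumDenSameDeg (reesGrading N)
      (Submonoid.powers (reesGen Δ hN i))) :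
    awayEval Δ hN hΔ i (HomogeneousLocalization.mk c) *
      algebraMap (Polynomial 𝔽) _ (c.den : reesSubalgebra N) =
      algebraMap (Polynomial 𝔽) _ (c.num : reesSubalgebra N) :=
  sectionEval_awayToSection Δ hN hΔ _ (reesGenericPoint_mem_reesChart Δ hN hΔ i) c

lemma awayEval_injective (i : ι) : Function.Injective (awayEval Δ hN hΔ i) :=
  (sectionEval_injective Δ hN hΔ _ one_pos (reesGen_mem Δ hN i)
    (reesGenericPoint_mem_reesChart Δ hN hΔ i)).comp
    (awayToSection_bijective _ one_pos (reesGen_mem Δ hN i)).1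

/-- Elements of the coordinate ring of a standard chart. -/
def IsChartElement (N : Submodule R 𝔽) (δ x : 𝔽) : Prop := ∃ k : ℕ, x * δ ^ k ∈ N ^ k

lemma exists_awayEval_eq (i : ι) {x : 𝔽} (hx : IsChartElement N (Δ i) x) :
    ∃ z, awayEval Δ hN hΔ i z = constHom 𝔽 x := by
  obtain ⟨k, hk⟩ := hx
  obtain ⟨s, hs⟩ := exists_sectionEval_eq Δ hN hΔ (reesGen Δ hN i) (d := 1) rfl
    (reesGenericPoint_mem_reesChart Δ hN hΔ i) (x := x) (k := k) (by rwa [mul_one])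
  obtain ⟨z, rfl⟩ := (awayToSection_bijective _ one_pos (reesGen_mem Δ hN i)).2 s
  exact ⟨z, hs⟩

lemma awayEval_eq (i : ι) (z : HomogeneousLocalization.Away (reesGrading N) (reesGen Δ hN i)) :
    ∃ x : 𝔽, IsChartElement N (Δ i) x ∧ awayEval Δ hN hΔ i z = constHom 𝔽 x := by
  obtain ⟨x, ⟨k, hk⟩, hx, -⟩ := sectionEval_eq Δ hN hΔ (reesGen Δ hN i) one_pos
    (reesGen_mem Δ hN i) rfl (reesGenericPoint_mem_reesChart Δ hN hΔ i)
    ((Proj.awayToSection (reesGrading N) (reesGen Δ hN i)).hom z)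
  exact ⟨x, ⟨k, by rwa [mul_one] at hk⟩, hx⟩

/-- The structure map of the coordinate ring of a standard chart. -/
noncomputable def awayBaseHom (i : ι) :
    R →+* HomogeneousLocalization.Away (reesGrading N) (reesGen Δ hN i) :=
  (HomogeneousLocalization.fromZeroRingHom (reesGrading N) _).comp (reesZeroHom N)

lemma awayEval_awayBaseHom (i : ι) (r : R) :
    awayEval Δ hN hΔ i (awayBaseHom Δ hN i r) = constHom 𝔽 (algebraMap R 𝔽 r) := by
  have h := awayEval_mk Δ hN hΔ i ⟨0, reesZeroHom N r, 1, one_mem _⟩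
  change _ * algebraMap (Polynomial 𝔽) _ ((1 : reesSubalgebra N) : Polynomial 𝔽) = _ at h
  rw [OneMemClass.coe_one, map_one, mul_one] at h
  exact h

/-- The structure morphism of the projective spectrum of the Rees algebra. -/
noncomputable def reesToSpec (N : Submodule R 𝔽) :
    Proj (reesGrading N) ⟶ Spec (CommRingCat.of R) :=
  Proj.toSpecZero (reesGrading N) ≫ Spec.map (CommRingCat.ofHom (reesZeroHom N))

omit [Nonempty ι] in
lemma awayι_reesToSpec (i : ι) :
    Proj.awayι (reesGrading N) _ (reesGen_mem Δ hN i) one_pos ≫ reesToSpec N =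
      Spec.map (CommRingCat.ofHom (awayBaseHom Δ hN i)) := by
  rw [reesToSpec, Proj.awayι_toSpecZero_assoc, ← Spec.map_comp]
  rfl

include Δ hN in
omit [Nonempty ι] in
lemma isProper_reesToSpec [Finite ι] (hinj : Function.Injective (algebraMap R 𝔽)) :
    IsProper (reesToSpec N) := by
  have := finiteType_rees Δ hN
  have : IsIso (show CommRingCat.of R ⟶ CommRingCat.of (reesGrading N 0) from
      CommRingCat.ofHom (reesZeroHom N)) := by
    rw [ConcreteCategory.isIso_iff_bijective]
    exact reesZeroHom_bijective hinj
  rw [reesToSpec]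
  infer_instance

omit [Nonempty ι] in
lemma iSup_reesChart : iSup (reesChart Δ hN) = ⊤ :=
  Proj.iSup_basicOpen_eq_top' (reesGrading N) (reesGen Δ hN)
    (fun i => ⟨1, reesGen_mem Δ hN i⟩) (adjoin_zero_reesGen Δ hN)

include hΔ in
lemma reesToSpec_preimage_le (h : 𝔽) (r : ι → R) (hr : ∀ i, algebraMap R 𝔽 (r i) = h * Δ i)
    (i : ι) : reesToSpec N ⁻¹ᵁ specBasicOpen (r i) ≤ reesChart Δ hN i := by
  intro y hy
  have hy' : y ∈ iSup (reesChart Δ hN) := by rw [iSup_reesChart]; trivial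
  rw [TopologicalSpace.Opens.mem_iSup] at hy'
  obtain ⟨k, hk⟩ := hy'
  rw [reesChart, ← Proj.opensRange_awayι _ _ (reesGen_mem Δ hN k) one_pos] at hk
  obtain ⟨p, rfl⟩ := hk
  have h1 : p ∈ Proj.awayι (reesGrading N) _ (reesGen_mem Δ hN k) one_pos ⁻¹ᵁ
      Proj.basicOpen (reesGrading N) (reesGen Δ hN i) := by
    rw [Proj.awayι_preimage_basicOpen _ _ _ (reesGen_mem Δ hN i) one_pos]
    have h2 : p ∈ Spec.map (CommRingCat.ofHom (awayBaseHom Δ hN k)) ⁻¹ᵁ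
        specBasicOpen (r i) := by
      rw [← awayι_reesToSpec]
      exact hy
    have h3 : awayBaseHom Δ hN k (r i) ∉ p.asIdeal := h2
    have h4 : awayBaseHom Δ hN k (r i) = awayBaseHom Δ hN k (r k) *
        HomogeneousLocalization.Away.isLocalizationElem (reesGen_mem Δ hN k)
          (reesGen_mem Δ hN i) := by
      apply awayEval_injective Δ hN hΔ k
      rw [map_mul, awayEval_awayBaseHom, awayEval_awayBaseHom, hr, hr]
      have h5 := awayEval_mk Δ hN hΔ k
        ⟨1 • 1, ⟨reesGen Δ hN i ^ 1, SetLike.pow_mem_graded 1 (reesGen_mem Δ hN i)⟩,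
          ⟨reesGen Δ hN k ^ 1, SetLike.pow_mem_graded 1 (reesGen_mem Δ hN k)⟩, ⟨1, rfl⟩⟩
      have h6 : ∀ j, algebraMap (Polynomial 𝔽) (FractionRing (Polynomial 𝔽))
          ((reesGen Δ hN j ^ 1 : reesSubalgebra N) : Polynomial 𝔽) =
          constHom 𝔽 (Δ j) * algebraMap (Polynomial 𝔽) _ Polynomial.X := fun j => by
        rw [constHom, RingHom.comp_apply, ← map_mul, pow_one, reesGen,
          Polynomial.C_mul_X_eq_monomial]
      have h7 : algebraMap (Polynomial 𝔽) (FractionRing (Polynomial 𝔽)) Polynomial.X ≠ 0 := by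
        rw [Ne, map_eq_zero_iff _ (IsFractionRing.injective (Polynomial 𝔽)
          (FractionRing (Polynomial 𝔽)))]
        exact Polynomial.X_ne_zero
      change _ * algebraMap (Polynomial 𝔽) (FractionRing (Polynomial 𝔽))
          ((reesGen Δ hN k ^ 1 : reesSubalgebra N) : Polynomial 𝔽) =
        algebraMap (Polynomial 𝔽) (FractionRing (Polynomial 𝔽))
          ((reesGen Δ hN i ^ 1 : reesSubalgebra N) : Polynomial 𝔽) at h5
      rw [h6, h6, ← mul_assoc] at h5
      have h8 := mul_right_cancel₀ h7 h5
      rw [map_mul, ← h8, map_mul, mul_assoc]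
      congr 1
      exact mul_comm _ _
    rw [h4] at h3
    exact fun h5 => h3 (Ideal.mul_mem_left _ _ h5)
  exact h1

include hΔ in
lemma awayBaseHom_injective (hinj : Function.Injective (algebraMap R 𝔽)) (i : ι) :
    Function.Injective (awayBaseHom Δ hN i) := by
  intro x y hxy
  have := congrArg (awayEval Δ hN hΔ i) hxy
  rw [awayEval_awayBaseHom, awayEval_awayBaseHom] at this
  exact hinj ((constHom 𝔽).injective this)

omit [Nonempty ι] in
include hN in
lemma exists_algebraMap_eq_pow_mul (h : 𝔽) (r : ι → R) (hr : ∀ i, algebraMap R 𝔽 (r i) = h * Δ i)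
    {k : ℕ} {x : 𝔽} (hx : x ∈ N ^ k) : ∃ s : R, algebraMap R 𝔽 s = h ^ k * x := by
  induction hx using Submodule.pow_induction_on_left' with
  | algebraMap r => exact ⟨r, by simp⟩
  | add x y i hx hy ihx ihy =>
    obtain ⟨s, hs⟩ := ihx
    obtain ⟨t, ht⟩ := ihy
    exact ⟨s + t, by rw [map_add, hs, ht, mul_add]⟩
  | mem_mul m hm i x hx ih =>
    obtain ⟨s, hs⟩ := ih
    have h1 : ∃ t : R, algebraMap R 𝔽 t = h * m := by
      rw [hN] at hm
      induction hm using Submodule.span_induction with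
      | mem x hx =>
        obtain ⟨j, rfl⟩ := hx
        exact ⟨r j, hr j⟩
      | zero => exact ⟨0, by simp⟩
      | add x y _ _ hx hy =>
        obtain ⟨s, hs⟩ := hx
        obtain ⟨t, ht⟩ := hy
        exact ⟨s + t, by rw [map_add, hs, ht, mul_add]⟩
      | smul r x _ hx =>
        obtain ⟨s, hs⟩ := hx
        exact ⟨r * s, by rw [map_mul, hs, Algebra.smul_def]; ring⟩
    obtain ⟨t, ht⟩ := h1
    exact ⟨t * s, by rw [map_mul, ht, hs, pow_succ]; ring⟩

include hΔ in
lemma awayMap_awayBaseHom_bijective (hinj : Function.Injective (algebraMap R 𝔽)) (h : 𝔽)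
    (r : ι → R) (hr : ∀ i, algebraMap R 𝔽 (r i) = h * Δ i) (i : ι) :
    Function.Bijective (Localization.awayMap (awayBaseHom Δ hN i) (r i)) := by
  have hφ := awayBaseHom_injective Δ hN hΔ hinj i
  constructor
  · rw [injective_iff_map_eq_zero]
    intro a ha
    obtain ⟨x, ⟨_, n, rfl⟩, rfl⟩ := IsLocalization.exists_mk'_eq (Submonoid.powers (r i)) a
    rw [Localization.awayMap, IsLocalization.Away.map, IsLocalization.map_mk',
      IsLocalization.mk'_eq_zero_iff] at ha
    obtain ⟨⟨_, m, rfl⟩, hm⟩ := ha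
    rw [IsLocalization.mk'_eq_zero_iff]
    refine ⟨⟨_, m, rfl⟩, hφ ?_⟩
    rw [map_mul, map_zero]
    simpa using hm
  · intro z
    obtain ⟨y, ⟨_, n, rfl⟩, rfl⟩ := IsLocalization.exists_mk'_eq
      (Submonoid.powers (awayBaseHom Δ hN i (r i))) z
    obtain ⟨x, ⟨k, hk⟩, hx⟩ := awayEval_eq Δ hN hΔ i y
    obtain ⟨s, hs⟩ := exists_algebraMap_eq_pow_mul Δ hN h r hr hk
    have h1 : awayBaseHom Δ hN i s = awayBaseHom Δ hN i (r i ^ k) * y := by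
      apply awayEval_injective Δ hN hΔ i
      rw [map_mul, awayEval_awayBaseHom, awayEval_awayBaseHom, hs, hx, map_pow, hr, ← map_mul,
        mul_pow]
      congr 1
      ring
    refine ⟨IsLocalization.mk' _ s (⟨r i ^ (k + n), k + n, rfl⟩ : Submonoid.powers (r i)), ?_⟩
    rw [Localization.awayMap, IsLocalization.Away.map, IsLocalization.map_mk',
      IsLocalization.mk'_eq_iff_eq]
    congr 1
    simp only [h1, map_pow]
    ring

include hN hΔ in
lemma isIso_reesToSpec_restrict (hinj : Function.Injective (algebraMap R 𝔽)) (h : 𝔽)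
    (r : ι → R) (hr : ∀ i, algebraMap R 𝔽 (r i) = h * Δ i) (i : ι) :
    IsIso (reesToSpec N ∣_ specBasicOpen (r i)) := by
  set U := reesToSpec N ⁻¹ᵁ specBasicOpen (r i) with hU
  have h1 : IsIso ((Proj.awayι (reesGrading N) _ (reesGen_mem Δ hN i) one_pos) ∣_ U) := by
    rw [isIso_iff_isOpenImmersion_and_surjective]
    refine ⟨inferInstance, ⟨?_⟩⟩
    rintro ⟨y, hy⟩
    have hy' := reesToSpec_preimage_le Δ hN hΔ h r hr i hy
    rw [reesChart, ← Proj.opensRange_awayι _ _ (reesGen_mem Δ hN i) one_pos] at hy'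
    obtain ⟨p, hp⟩ := hy'
    refine ⟨⟨p, ?_⟩, Subtype.ext ?_⟩
    · change _ ∈ U
      rw [hp]
      exact hy
    · exact (morphismRestrict_base_coe _ _ _).trans hp
  have h2 : IsIso ((Proj.awayι (reesGrading N) _ (reesGen_mem Δ hN i) one_pos ≫
      reesToSpec N) ∣_ specBasicOpen (r i)) := by
    rw [awayι_reesToSpec]
    have h3 : IsIso (Spec.map (CommRingCat.ofHom (Localization.awayMap
        (awayBaseHom Δ hN i) (r i)))) := by
      have h4 : IsIso (CommRingCat.ofHom (Localization.awayMap (awayBaseHom Δ hN i) (r i))) := by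
        rw [ConcreteCategory.isIso_iff_bijective]
        exact awayMap_awayBaseHom_bijective Δ hN hΔ hinj h r hr i
      infer_instance
    exact ((MorphismProperty.isomorphisms Scheme).arrow_mk_iso_iff
      (SpecMapRestrictBasicOpenIso (CommRingCat.ofHom (awayBaseHom Δ hN i)) (r i))).mpr h3
  rw [morphismRestrict_comp] at h2
  exact @IsIso.of_isIso_comp_left _ _ _ _ _ _ _ h1 h2

include hΔ in
lemma smooth_awayBaseHom {K σ : Type} [Field K] [Algebra K R] [Algebra K 𝔽]
    [IsScalarTower K R 𝔽] [Finite σ] (i : ι) (φ : MvPolynomial σ K →ₐ[K] 𝔽)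
    (hφ : Function.Injective φ) (hrange : ∀ x, (∃ p, φ p = x) ↔ IsChartElement N (Δ i) x) :
    ((awayBaseHom Δ hN i).comp (algebraMap K R)).Smooth := by
  have h1 : ∀ p, ∃ z, awayEval Δ hN hΔ i z = constHom 𝔽 (φ p) := fun p =>
    exists_awayEval_eq Δ hN hΔ i ((hrange _).mp ⟨p, rfl⟩)
  choose e he using h1
  let E : MvPolynomial σ K →+* HomogeneousLocalization.Away (reesGrading N) (reesGen Δ hN i) :=
    { toFun := e
      map_one' := awayEval_injective Δ hN hΔ i (by simp [he])
      map_mul' := fun p q => awayEval_injective Δ hN hΔ i (by simp [he])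
      map_zero' := awayEval_injective Δ hN hΔ i (by simp [he])
      map_add' := fun p q => awayEval_injective Δ hN hΔ i (by simp [he]) }
  have hE : Function.Bijective E := by
    constructor
    · intro p q hpq
      have := congrArg (awayEval Δ hN hΔ i) hpq
      simp only [E, RingHom.coe_mk, MonoidHom.coe_mk, OneHom.coe_mk, he] at this
      exact hφ ((constHom 𝔽).injective this)
    · intro z
      obtain ⟨x, hx, hz⟩ := awayEval_eq Δ hN hΔ i z
      obtain ⟨p, rfl⟩ := (hrange x).mpr hx
      exact ⟨p, awayEval_injective Δ hN hΔ i ((he p).trans hz.symm)⟩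
  have hcomp : (awayBaseHom Δ hN i).comp (algebraMap K R) = E.comp (algebraMap K _) := by
    refine RingHom.ext fun k => ?_
    apply awayEval_injective Δ hN hΔ i
    rw [RingHom.comp_apply, awayEval_awayBaseHom, ← IsScalarTower.algebraMap_apply]
    exact ((he _).trans (by rw [AlgHom.commutes])).symm
  rw [hcomp]
  exact RingHom.Smooth.comp (RingHom.smooth_algebraMap.mpr ⟨inferInstance, inferInstance⟩)
    (RingHom.Smooth.of_bijective hE)

end ReesResolution

section ReesResolutionMain

variable {R 𝔽 : Type} [CommRing R] [Field 𝔽] [Algebra R 𝔽]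
variable {N : Submodule R 𝔽} {ι : Type} (Δ : ι → 𝔽) (hN : N = Submodule.span R (Set.range Δ))
variable [Nonempty ι] (hΔ : ∀ i, Δ i ≠ 0)

include Δ hN hΔ in
lemma acyclicStructureSheaf_rees [Finite ι]
    (hcech : ∀ (p : ℕ) (c : (Fin (p + 2) → ι) → 𝔽), (∀ g, IsReesSection N Δ g (c g)) →
      (∀ g : Fin (p + 3) → ι, ∑ j : Fin (p + 3), (-1) ^ (j : ℕ) * c (g ∘ j.succAbove) = 0) →
      ∃ y : (Fin (p + 1) → ι) → 𝔽, (∀ g, IsReesSection N Δ g (y g)) ∧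
        ∀ g : Fin (p + 2) → ι, ∑ j : Fin (p + 2), (-1) ^ (j : ℕ) * y (g ∘ j.succAbove) = c g) :
    AcyclicStructureSheaf (Proj (reesGrading N)) := by
  intro m U hU hUtop p s hs
  exact acyclicStructureSheaf_of_cover (reesChart Δ hN)
    (fun i => Proj.isAffineOpen_basicOpen _ _ (reesGen_mem Δ hN i) one_pos)
    (iSup_reesChart Δ hN)
    (fun q s hs => rees_altDiff_exact Δ hN hΔ (hcech q) s hs) U hU hUtop p s hs

include Δ hN hΔ in
/-- A criterion for rational singularities: the projective spectrum of a Rees algebra with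
polynomial charts and exact Čech complexes is a resolution. -/
theorem hasRationalSingularities_of_rees {K : Type} [Field K] [Algebra K R] [Algebra K 𝔽]
    [IsScalarTower K R 𝔽] (hinj : Function.Injective (algebraMap R 𝔽)) [Finite ι]
    {h : 𝔽} (hh : h ≠ 0) {r : ι → R} (hr : ∀ i, algebraMap R 𝔽 (r i) = h * Δ i)
    {σ : ι → Type} [∀ i, Finite (σ i)] (φ : ∀ i, MvPolynomial (σ i) K →ₐ[K] 𝔽)
    (hφ : ∀ i, Function.Injective (φ i))
    (hrange : ∀ i x, (∃ p, φ i p = x) ↔ IsChartElement N (Δ i) x)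
    (hcech : ∀ (p : ℕ) (c : (Fin (p + 2) → ι) → 𝔽), (∀ g, IsReesSection N Δ g (c g)) →
      (∀ g : Fin (p + 3) → ι, ∑ j : Fin (p + 3), (-1) ^ (j : ℕ) * c (g ∘ j.succAbove) = 0) →
      ∃ y : (Fin (p + 1) → ι) → 𝔽, (∀ g, IsReesSection N Δ g (y g)) ∧
        ∀ g : Fin (p + 2) → ι, ∑ j : Fin (p + 2), (-1) ^ (j : ℕ) * y (g ∘ j.succAbove) = c g) :
    HasRationalSingularities K R := by
  refine ⟨Proj (reesGrading N), reesToSpec N, isProper_reesToSpec Δ hN hinj, ?_, ?_,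
    acyclicStructureSheaf_rees Δ hN hΔ hcech⟩
  · change Smooth _
    have : IsZariskiLocalAtSource @Smooth.{0} :=
      HasRingHomProperty.instIsZariskiLocalAtSource
    refine IsZariskiLocalAtSource.of_iSup_eq_top (P := @Smooth.{0}) (reesChart Δ hN)
      (iSup_reesChart Δ hN) fun i => ?_
    have h1 : (reesChart Δ hN i).ι = (Proj.basicOpenIsoSpec (reesGrading N) _
        (reesGen_mem Δ hN i) one_pos).hom ≫
        Proj.awayι (reesGrading N) _ (reesGen_mem Δ hN i) one_pos := by
      rw [Proj.awayι, Iso.hom_inv_id_assoc]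
      rfl
    have h2 : Smooth (Proj.awayι (reesGrading N) _ (reesGen_mem Δ hN i) one_pos ≫ reesToSpec N ≫
        Spec.map (CommRingCat.ofHom (algebraMap K R))) := by
      rw [← Category.assoc, awayι_reesToSpec, ← Spec.map_comp, ← CommRingCat.ofHom_comp,
        HasRingHomProperty.Spec_iff (P := @Smooth)]
      exact smooth_awayBaseHom Δ hN hΔ i (φ i) (hφ i) (hrange i)
    have h3 := smooth_comp (Proj.basicOpenIsoSpec (reesGrading N) _
        (reesGen_mem Δ hN i) one_pos).hom (g := Proj.awayι (reesGrading N) _ (reesGen_mem Δ hN i) one_pos ≫ reesToSpec N ≫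
        Spec.map (CommRingCat.ofHom (algebraMap K R)))
    rw [← Category.assoc] at h3
    rw [h1]
    exact h3
  · have : IsDomain R := hinj.isDomain (algebraMap R 𝔽)
    let i : ι := Classical.arbitrary ι
    refine ⟨specBasicOpen (r i), ?_, isIso_reesToSpec_restrict Δ hN hΔ hinj h r hr i⟩
    have h1 : r i ≠ 0 := by
      intro h0
      have := hr i
      rw [h0, map_zero] at this
      exact mul_ne_zero hh (hΔ i) this.symm
    refine (specBasicOpen (r i)).isOpen.dense ⟨⟨⊥, Ideal.isPrime_bot⟩, ?_⟩
    exact fun h0 => h1 h0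

end ReesResolutionMain

section CoeffDerivation

variable {K C : Type} [CommRing K] [CommRing C] [Algebra K C]

/-- The coefficientwise action of a derivation on polynomials, as a function. -/
noncomputable def coeffMap (σ : Type) (D : C →+ C) (p : MvPolynomial σ C) :
    MvPolynomial σ C :=
  ∑ m ∈ p.support, monomial m (D (coeff m p))

lemma coeff_coeffMap {σ : Type} (D : C →+ C) (p : MvPolynomial σ C) (m : σ →₀ ℕ) :
    coeff m (coeffMap σ D p) = D (coeff m p) := by
  classical
  simp only [coeffMap, coeff_sum, coeff_monomial, Finset.sum_ite_eq', mem_support_iff]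
  split_ifs with h
  · rfl
  · rw [not_not.mp h, map_zero]

/-- The coefficientwise action of a derivation on polynomials. -/
noncomputable def coeffDerivation (σ : Type) (D : Derivation K C C) :
    Derivation K (MvPolynomial σ C) (MvPolynomial σ C) :=
  Derivation.mk' { toFun := coeffMap σ (D : C →ₗ[K] C).toAddMonoidHom
                   map_add' := fun p q => by
                    ext m
                    simp [coeff_coeffMap]
                   map_smul' := fun r p => by
                    ext m
                    simp [coeff_coeffMap, coeff_smul] } fun p q => by
    classical
    ext m
    simp only [LinearMap.coe_mk, AddHom.coe_mk, coeff_coeffMap, coeff_mul, smul_eq_mul,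
      coeff_add, LinearMap.toAddMonoidHom_coe, Derivation.coeFn_coe, map_sum, Derivation.leibniz,
      Finset.sum_add_distrib]
    congr 1
    exact Finset.sum_equiv (Equiv.prodComm _ _) (by simp [add_comm]) (by simp)

@[simp]
lemma coeff_coeffDerivation {σ : Type} (D : Derivation K C C) (p : MvPolynomial σ C)
    (m : σ →₀ ℕ) : coeff m (coeffDerivation σ D p) = D (coeff m p) :=
  coeff_coeffMap _ _ _

@[simp]
lemma coeffDerivation_X {σ : Type} (D : Derivation K C C) (v : σ) :
    coeffDerivation σ D (X v) = 0 := by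
  classical
  ext m
  rw [coeff_coeffDerivation, MvPolynomial.coeff_X, coeff_zero]
  split_ifs <;> simp

@[simp]
lemma coeffDerivation_C {σ : Type} (D : Derivation K C C) (c : C) :
    coeffDerivation σ D (MvPolynomial.C c) = MvPolynomial.C (D c) := by
  classical
  ext m
  rw [coeff_coeffDerivation, coeff_C, coeff_C]
  split_ifs <;> simp

end CoeffDerivation

section Fischer

open Nat (factorial)

variable {σ : Type} [Fintype σ] {C : Type} [CommRing C]

/-- The Fischer pairing of polynomials, for which distinct monomials are orthogonal and a
monomial with exponent `m` has square norm `∏ i, (m i)!`. -/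
noncomputable def fischer : MvPolynomial σ C →ₗ[C] MvPolynomial σ C →ₗ[C] C :=
  (basisMonomials σ C).constr C fun m => ((∏ i, (m i).factorial : ℕ) : C) • lcoeff C m

lemma fischer_monomial (m : σ →₀ ℕ) (c : C) (F : MvPolynomial σ C) :
    fischer (monomial m c) F = c * ((∏ i, (m i).factorial : ℕ) : C) * coeff m F := by
  have h : monomial m c = c • basisMonomials σ C m := by
    rw [coe_basisMonomials, smul_monomial, smul_eq_mul, mul_one]
  rw [h, map_smul, fischer, Module.Basis.constr_basis]
  simp [lcoeff_apply, mul_assoc]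

lemma fischer_eq_sum (p F : MvPolynomial σ C) :
    fischer p F = ∑ m ∈ p.support, coeff m p * ((∏ i, (m i).factorial : ℕ) : C) * coeff m F := by
  conv_lhs => rw [p.as_sum]
  simp only [map_sum, LinearMap.sum_apply, fischer_monomial]

lemma fischer_C (c : C) (F : MvPolynomial σ C) :
    fischer (MvPolynomial.C c) F = c * coeff 0 F := by
  rw [← monomial_zero', fischer_monomial]
  simp

lemma prod_factorial_add_single (m : σ →₀ ℕ) (v : σ) :
    ∏ i, ((m + Finsupp.single v 1 : σ →₀ ℕ) i).factorial = (m v + 1) * ∏ i, (m i).factorial := by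
  classical
  rw [Fintype.prod_eq_mul_prod_compl v, Fintype.prod_eq_mul_prod_compl v, ← mul_assoc]
  congr 1
  · simp [Nat.factorial_succ]
  · refine Finset.prod_congr rfl fun i hi => ?_
    have : v ≠ i := by simpa [eq_comm] using hi
    simp [this]

lemma fischer_X_mul (v : σ) (p F : MvPolynomial σ C) :
    fischer (X v * p) F = fischer p (pderiv v F) := by
  induction p using MvPolynomial.induction_on' with
  | monomial m c =>
    rw [mul_comm, X, monomial_mul, mul_one, fischer_monomial, fischer_monomial, coeff_pderiv,
      prod_factorial_add_single]
    push_cast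
    ring
  | add p q hp hq => rw [mul_add, map_add, map_add, LinearMap.add_apply, LinearMap.add_apply, hp, hq]

/-- The linear substitution attached to a matrix. -/
noncomputable def linSubst (M : Matrix σ σ C) : MvPolynomial σ C →ₐ[C] MvPolynomial σ C :=
  aeval fun v => ∑ u, MvPolynomial.C (M v u) * X u

lemma pderiv_linSubst (M : Matrix σ σ C) (u : σ) (F : MvPolynomial σ C) :
    pderiv u (linSubst M F) = ∑ v, MvPolynomial.C (M v u) * linSubst M (pderiv v F) := by
  classical
  induction F using MvPolynomial.induction_on with
  | C c =>
    rw [linSubst, aeval_C, algebraMap_eq, pderiv_C]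
    simp
  | add p q hp hq => simp only [map_add, mul_add, Finset.sum_add_distrib, hp, hq]
  | mul_X p w hp =>
    simp only [map_mul, pderiv_mul, map_add, hp, mul_add, Finset.sum_add_distrib, Finset.sum_mul]
    congr 1
    · exact Finset.sum_congr rfl fun v _ => by ring
    · have h1 : linSubst M (X w) = ∑ u, MvPolynomial.C (M w u) * X u := aeval_X _ _
      rw [h1, map_sum]
      simp [pderiv_X, Pi.single_apply, mul_comm]

lemma coeff_zero_linSubst (M : Matrix σ σ C) (F : MvPolynomial σ C) :
    coeff 0 (linSubst M F) = coeff 0 F := by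
  simp only [← constantCoeff_eq]
  induction F using MvPolynomial.induction_on with
  | C c => rw [linSubst, aeval_C, algebraMap_eq]
  | add p q hp hq => rw [map_add, map_add, hp, hq, map_add]
  | mul_X p w hp =>
    have h1 : linSubst M (X w) = ∑ u, MvPolynomial.C (M w u) * X u := aeval_X _ _
    rw [map_mul, map_mul, h1, map_mul]
    simp

/-- Linear substitution and its transpose are adjoint for the Fischer pairing. -/
lemma fischer_linSubst (M : Matrix σ σ C) (p F : MvPolynomial σ C) :
    fischer p (linSubst M F) = fischer (linSubst M.transpose p) F := by
  induction p using MvPolynomial.induction_on generalizing F with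
  | C c => rw [fischer_C, coeff_zero_linSubst, linSubst, aeval_C, algebraMap_eq, fischer_C]
  | add p q hp hq => rw [map_add, map_add, LinearMap.add_apply, hp, hq, map_add, LinearMap.add_apply]
  | mul_X p w hp =>
    have h1 : linSubst M.transpose (X w) = ∑ u, MvPolynomial.C (M u w) * X u := aeval_X _ _
    rw [mul_comm, fischer_X_mul, pderiv_linSubst, map_mul, h1, Finset.sum_mul, map_sum, map_sum,
      LinearMap.sum_apply]
    refine Finset.sum_congr rfl fun v _ => ?_
    rw [mul_assoc, ← smul_eq_C_mul, ← smul_eq_C_mul, map_smul, map_smul, LinearMap.smul_apply,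
      hp, fischer_X_mul]

lemma fischer_map {C' : Type} [CommRing C'] (f : C →+* C') (p F : MvPolynomial σ C) :
    fischer (map f p) (map f F) = f (fischer p F) := by
  induction p using MvPolynomial.induction_on' with
  | monomial m c => simp [map_monomial, fischer_monomial, coeff_map]
  | add p q hp hq => simp only [map_add, LinearMap.add_apply, hp, hq]

lemma fischer_self_int_pos (p : MvPolynomial σ ℤ) (hp : p ≠ 0) : 0 < fischer p p := by
  rw [fischer_eq_sum]
  refine Finset.sum_pos (fun m hm => ?_) (support_nonempty.mpr hp)
  have h1 : coeff m p ≠ 0 := mem_support_iff.mp hm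
  have h2 : (0 : ℤ) < ((∏ i, (m i).factorial : ℕ) : ℤ) := by
    exact_mod_cast Finset.prod_pos fun i _ => Nat.factorial_pos _
  have h3 : 0 < coeff m p * coeff m p := mul_self_pos.mpr h1
  nlinarith [mul_pos h3 h2]

end Fischer

section DetFunctional

open scoped Kronecker

variable {n : ℕ}

/-- Variables for a family of `a j × b j` matrices. -/
abbrev MatVar (a b : Fin n → ℕ) : Type := Σ j, Fin (a j) × Fin (b j)

variable {a b : Fin n → ℕ}

/-- The `j`-th generic matrix. -/
noncomputable def genericMat (C : Type) [CommRing C] (a b : Fin n → ℕ) (j : Fin n) :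
    Matrix (Fin (a j)) (Fin (b j)) (MvPolynomial (MatVar a b) C) :=
  Matrix.of fun k i => X ⟨j, k, i⟩

@[simp]
lemma genericMat_apply (C : Type) [CommRing C] (j : Fin n) (k : Fin (a j)) (i : Fin (b j)) :
    genericMat C a b j k i = X ⟨j, k, i⟩ := rfl

/-- The product of the determinants of generic square matrices. -/
noncomputable def genericDet (C : Type) [CommRing C] (b : Fin n → ℕ) :
    MvPolynomial (MatVar b b) C :=
  ∏ j, (genericMat C b b j).det

variable {C C' : Type} [CommRing C] [CommRing C']

lemma map_genericDet (f : C →+* C') : map f (genericDet C b) = genericDet C' b := by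
  simp only [genericDet, map_prod]
  refine Finset.prod_congr rfl fun j _ => ?_
  rw [RingHom.map_det]
  congr 1
  ext k i
  simp

lemma genericDet_ne_zero [Nontrivial C] : genericDet C b ≠ 0 := by
  intro h
  have h1 := congrArg (eval fun v : MatVar b b => if v.2.1 = v.2.2 then (1 : C) else 0) h
  rw [genericDet, map_prod, map_zero] at h1
  have h2 : ∀ j : Fin n, eval (fun v : MatVar b b => if v.2.1 = v.2.2 then (1 : C) else 0)
      (genericMat C b b j).det = 1 := by
    intro j
    rw [RingHom.map_det]
    convert Matrix.det_one (n := Fin (b j)) (R := C)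
    ext k i
    simp [Matrix.one_apply]
  simp [h2] at h1

/-- Left multiplication of generic square matrices by matrices of scalars. -/
noncomputable def matSubst (s : ∀ j, Matrix (Fin (b j)) (Fin (b j)) C) :
    MvPolynomial (MatVar b b) C →ₐ[C] MvPolynomial (MatVar b b) C :=
  linSubst (Matrix.blockDiagonal' fun j => s j ⊗ₖ (1 : Matrix (Fin (b j)) (Fin (b j)) C))

lemma matSubst_X (s : ∀ j, Matrix (Fin (b j)) (Fin (b j)) C) (j : Fin n) (i k : Fin (b j)) :
    matSubst s (X ⟨j, i, k⟩) = ∑ l, MvPolynomial.C (s j i l) * X ⟨j, l, k⟩ := by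
  have h : matSubst s (X ⟨j, i, k⟩) = ∑ u, MvPolynomial.C (Matrix.blockDiagonal'
      (fun j => s j ⊗ₖ (1 : Matrix (Fin (b j)) (Fin (b j)) C)) ⟨j, i, k⟩ u) * X u := aeval_X _ _
  rw [h, Fintype.sum_sigma, Finset.sum_eq_single j]
  · rw [Fintype.sum_prod_type]
    refine Finset.sum_congr rfl fun l _ => ?_
    rw [Finset.sum_eq_single k (fun x _ hx => by simp [Matrix.blockDiagonal'_apply_eq, hx.symm])
      (by simp)]
    simp [Matrix.blockDiagonal'_apply_eq]
  · intro j' _ hj'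
    refine Finset.sum_eq_zero fun u _ => ?_
    rw [Matrix.blockDiagonal'_apply_ne _ _ _ hj'.symm]
    simp
  · simp

lemma matSubst_genericMat (s : ∀ j, Matrix (Fin (b j)) (Fin (b j)) C) (j : Fin n) :
    (genericMat C b b j).map (matSubst s) = (s j).map MvPolynomial.C * genericMat C b b j := by
  ext i k
  simp [Matrix.mul_apply, matSubst_X]

lemma matSubst_genericDet (s : ∀ j, Matrix (Fin (b j)) (Fin (b j)) C) :
    matSubst s (genericDet C b) = MvPolynomial.C (∏ j, (s j).det) * genericDet C b := by
  simp only [genericDet, map_prod, ← Finset.prod_mul_distrib]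
  refine Finset.prod_congr rfl fun j _ => ?_
  rw [AlgHom.map_det, AlgHom.mapMatrix_apply, matSubst_genericMat, Matrix.det_mul, RingHom.map_det]
  rfl

lemma fischer_matSubst (s : ∀ j, Matrix (Fin (b j)) (Fin (b j)) C)
    (p F : MvPolynomial (MatVar b b) C) :
    fischer p (matSubst s F) = fischer (matSubst (fun j => (s j).transpose) p) F := by
  rw [matSubst, fischer_linSubst, Matrix.blockDiagonal'_transpose]
  have h : ∀ j, (s j ⊗ₖ (1 : Matrix (Fin (b j)) (Fin (b j)) C)).transpose =
      (s j).transpose ⊗ₖ (1 : Matrix (Fin (b j)) (Fin (b j)) C) := fun j => by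
    rw [← Matrix.kroneckerMap_transpose, Matrix.transpose_one]
  simp only [matSubst, h]

lemma fischer_intCast_map {σ : Type} [Fintype σ] (p : MvPolynomial σ ℤ) (F : MvPolynomial σ C) :
    fischer (map (Int.castRingHom C) p) F =
      ∑ m ∈ p.support, (coeff m p * ((∏ i, (m i).factorial : ℕ) : ℤ)) • coeff m F := by
  conv_lhs => rw [p.as_sum]
  simp only [map_sum, LinearMap.sum_apply, map_monomial, fischer_monomial, zsmul_eq_mul]
  simp

variable (K : Type) [Field K] [Algebra K C] [Algebra K C']

/-- The normalised Fischer pairing with the `N`-th power of the determinant: a functional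
that is semi-invariant under left multiplication. -/
noncomputable def detFunctional (N : ℕ) (F : MvPolynomial (MatVar b b) C) : C :=
  (fischer (genericDet K b ^ N) (genericDet K b ^ N))⁻¹ • fischer (genericDet C b ^ N) F

variable {K}

lemma detFunctional_add (N : ℕ) (F G : MvPolynomial (MatVar b b) C) :
    detFunctional K N (F + G) = detFunctional K N F + detFunctional K N G := by
  simp [detFunctional]

lemma detFunctional_C_mul (N : ℕ) (c : C) (F : MvPolynomial (MatVar b b) C) :
    detFunctional K N (MvPolynomial.C c * F) = c * detFunctional K N F := by
  rw [detFunctional, ← smul_eq_C_mul, map_smul, smul_comm, smul_eq_mul, detFunctional]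

lemma detFunctional_matSubst (N : ℕ) (s : ∀ j, Matrix (Fin (b j)) (Fin (b j)) C)
    (F : MvPolynomial (MatVar b b) C) :
    detFunctional K N (matSubst s F) = (∏ j, (s j).det) ^ N * detFunctional K N F := by
  simp only [detFunctional, fischer_matSubst, map_pow, matSubst_genericDet, Matrix.det_transpose,
    mul_pow]
  rw [← map_pow, ← smul_eq_C_mul, map_smul, LinearMap.smul_apply, smul_comm, smul_eq_mul]

lemma genericDet_pow_eq_map (N : ℕ) :
    genericDet C b ^ N = map (Int.castRingHom C) (genericDet ℤ b ^ N) := by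
  rw [map_pow, map_genericDet]

lemma fischer_genericDet_ne_zero [CharZero K] (N : ℕ) :
    fischer (genericDet K b ^ N) (genericDet K b ^ N) ≠ 0 := by
  rw [genericDet_pow_eq_map, fischer_map]
  simpa using (fischer_self_int_pos _ (pow_ne_zero N (genericDet_ne_zero (C := ℤ) (b := b)))).ne'

lemma detFunctional_genericDet_pow [CharZero K] (N : ℕ) :
    detFunctional K N (genericDet C b ^ N) = 1 := by
  rw [detFunctional, ← map_genericDet (algebraMap K C), ← map_pow, fischer_map,
    Algebra.smul_def, ← map_mul, inv_mul_cancel₀ (fischer_genericDet_ne_zero N), map_one]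

lemma detFunctional_map (f : C →ₐ[K] C') (N : ℕ) (F : MvPolynomial (MatVar b b) C) :
    detFunctional K N (map (f : C →+* C') F) = f (detFunctional K N F) := by
  rw [detFunctional, ← map_genericDet (f : C →+* C'), ← map_pow, fischer_map, detFunctional,
    map_smul]
  rfl

lemma detFunctional_coeffDerivation (D : Derivation K C C) (N : ℕ)
    (F : MvPolynomial (MatVar b b) C) :
    detFunctional K N (coeffDerivation _ D F) = D (detFunctional K N F) := by
  rw [detFunctional, detFunctional, genericDet_pow_eq_map (C := C), fischer_intCast_map,
    fischer_intCast_map, Derivation.map_smul, map_sum]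
  simp only [coeff_coeffDerivation, map_zsmul]

end DetFunctional

section Contract

variable {n : ℕ} {a b c : Fin n → ℕ} {C C' : Type} [CommRing C] [CommRing C']

/-- The action of a family of matrices on a tensor. -/
def contract (x : ∀ j, Matrix (Fin (a j)) (Fin (b j)) C) (t : Ind b → C) (v : Ind a) : C :=
  ∑ w : Ind b, (∏ j, x j (v j) (w j)) * t w

lemma contract_contract (x : ∀ j, Matrix (Fin (a j)) (Fin (b j)) C)
    (y : ∀ j, Matrix (Fin (b j)) (Fin (c j)) C) (t : Ind c → C) :
    contract x (contract y t) = contract (fun j => x j * y j) t := by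
  funext v
  simp only [contract, Matrix.mul_apply, Finset.prod_univ_sum, Fintype.piFinset_univ,
    Finset.mul_sum, Finset.sum_mul, Finset.prod_mul_distrib]
  rw [Finset.sum_comm]
  refine Finset.sum_congr rfl fun w _ => Finset.sum_congr rfl fun u _ => by ring

lemma contract_smul (x : ∀ j, Matrix (Fin (a j)) (Fin (b j)) C) (r : Fin n → C) (t : Ind b → C)
    (v : Ind a) : contract (fun j => r j • x j) t v = (∏ j, r j) * contract x t v := by
  simp only [contract, Matrix.smul_apply, smul_eq_mul, Finset.prod_mul_distrib, Finset.mul_sum]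
  exact Finset.sum_congr rfl fun w _ => by ring

lemma contract_one (t : Ind b → C) : contract (fun _ => 1) t = t := by
  funext v
  rw [contract, Finset.sum_eq_single v]
  · simp
  · intro w _ hw
    obtain ⟨j, hj⟩ := Function.ne_iff.mp hw
    have h : (1 : Matrix (Fin (b j)) (Fin (b j)) C) (v j) (w j) = 0 :=
      Matrix.one_apply_ne (Ne.symm hj)
    rw [Finset.prod_eq_zero (Finset.mem_univ j) h, zero_mul]
  · simp

lemma map_contract {F : Type} [FunLike F C C'] [RingHomClass F C C'] (f : F)
    (x : ∀ j, Matrix (Fin (a j)) (Fin (b j)) C) (t : Ind b → C) (v : Ind a) :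
    f (contract x t v) = contract (fun j => (x j).map f) (fun w => f (t w)) v := by
  simp [contract]

/-- A product of maximal minors, one of each matrix. -/
def rowMinor (x : ∀ j, Matrix (Fin (a j)) (Fin (b j)) C) (J : ∀ j, Fin (b j) → Fin (a j)) : C :=
  ∏ j, ((x j).submatrix (J j) id).det

lemma map_rowMinor {F : Type} [FunLike F C C'] [RingHomClass F C C'] (f : F)
    (x : ∀ j, Matrix (Fin (a j)) (Fin (b j)) C) (J : ∀ j, Fin (b j) → Fin (a j)) :
    f (rowMinor x J) = rowMinor (fun j => (x j).map f) J := by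
  simp only [rowMinor, map_prod]
  refine Finset.prod_congr rfl fun j _ => ?_
  exact RingHom.map_det (f : C →+* C') _

lemma rowMinor_mul (x : ∀ j, Matrix (Fin (a j)) (Fin (b j)) C)
    (g : ∀ j, Matrix (Fin (b j)) (Fin (b j)) C) (J : ∀ j, Fin (b j) → Fin (a j)) :
    rowMinor (fun j => x j * g j) J = rowMinor x J * ∏ j, (g j).det := by
  rw [rowMinor, rowMinor, ← Finset.prod_mul_distrib]
  refine Finset.prod_congr rfl fun j _ => ?_
  rw [← Matrix.det_mul]
  congr 1

lemma rowMinor_of_not_injective (x : ∀ j, Matrix (Fin (a j)) (Fin (b j)) C)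
    (J : ∀ j, Fin (b j) → Fin (a j)) (j : Fin n) (hj : ¬ Function.Injective (J j)) :
    rowMinor x J = 0 := by
  obtain ⟨i, i', h, hne⟩ : ∃ i i', J j i = J j i' ∧ i ≠ i' := by
    simpa [Function.Injective] using hj
  refine Finset.prod_eq_zero (Finset.mem_univ j) (Matrix.det_zero_of_row_eq hne ?_)
  funext u
  simp [h]

lemma Matrix.det_mul_eq_sum_minors {p q : ℕ} (z : Matrix (Fin p) (Fin q) C)
    (x : Matrix (Fin q) (Fin p) C) :
    (z * x).det = ∑ k : Fin p → Fin q, (∏ i, z i (k i)) * (x.submatrix k id).det := by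
  have h : (z * x) = fun i => ∑ k, z i k • x k := by
    funext i l
    simp [Matrix.mul_apply]
  change (Matrix.detRowAlternating (R := C) (n := Fin p)).toMultilinearMap (z * x) = _
  rw [h, MultilinearMap.map_sum]
  refine Finset.sum_congr rfl fun k _ => ?_
  rw [MultilinearMap.map_smul_univ, smul_eq_mul]
  rfl

lemma prod_det_mul_eq_sum (z : ∀ j, Matrix (Fin (b j)) (Fin (a j)) C)
    (x : ∀ j, Matrix (Fin (a j)) (Fin (b j)) C) :
    ∏ j, (z j * x j).det =
      ∑ k : ∀ j, Fin (b j) → Fin (a j), (∏ j, ∏ i, z j i (k j i)) * rowMinor x k := by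
  simp only [Matrix.det_mul_eq_sum_minors, Finset.prod_univ_sum, Fintype.piFinset_univ, rowMinor,
    Finset.prod_mul_distrib]

end Contract

section CoeffSubmodule

variable {R P : Type} [CommRing R] [CommRing P] [Algebra R P] (σ : Type)

/-- Polynomials all of whose coefficients lie in a given submodule. -/
def coeffSubmodule (M : Submodule R P) : Submodule R (MvPolynomial σ P) where
  carrier := {F | ∀ m, coeff m F ∈ M}
  add_mem' hF hG m := by
    rw [coeff_add]
    exact M.add_mem (hF m) (hG m)
  zero_mem' m := by simp
  smul_mem' r F hF m := by
    rw [coeff_smul]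
    exact M.smul_mem r (hF m)

variable {σ}

lemma mul_mem_coeffSubmodule {M N : Submodule R P} {F G : MvPolynomial σ P}
    (hF : F ∈ coeffSubmodule σ M) (hG : G ∈ coeffSubmodule σ N) :
    F * G ∈ coeffSubmodule σ (M * N) := by
  classical
  intro m
  rw [coeff_mul]
  exact sum_mem fun x _ => Submodule.mul_mem_mul (hF _) (hG _)

lemma C_mem_coeffSubmodule {M : Submodule R P} {x : P} (hx : x ∈ M) :
    (MvPolynomial.C x : MvPolynomial σ P) ∈ coeffSubmodule σ M := by
  classical
  intro m
  rw [coeff_C]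
  split_ifs
  exacts [hx, M.zero_mem]

lemma X_mem_coeffSubmodule (v : σ) :
    (X v : MvPolynomial σ P) ∈ coeffSubmodule σ (1 : Submodule R P) := by
  classical
  intro m
  rw [MvPolynomial.coeff_X]
  split_ifs
  exacts [Submodule.one_le.mp le_rfl, Submodule.zero_mem _]

lemma one_mem_coeffSubmodule :
    (1 : MvPolynomial σ P) ∈ coeffSubmodule σ (1 : Submodule R P) :=
  C_mem_coeffSubmodule (Submodule.one_le.mp le_rfl)

lemma pow_mem_coeffSubmodule {M : Submodule R P} {F : MvPolynomial σ P}
    (hF : F ∈ coeffSubmodule σ M) (k : ℕ) : F ^ k ∈ coeffSubmodule σ (M ^ k) := by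
  induction k with
  | zero => simpa using one_mem_coeffSubmodule
  | succ k ih =>
    rw [pow_succ, pow_succ]
    exact mul_mem_coeffSubmodule ih hF

lemma pderiv_mem_coeffSubmodule {M : Submodule R P} {F : MvPolynomial σ P}
    (hF : F ∈ coeffSubmodule σ M) (v : σ) : pderiv v F ∈ coeffSubmodule σ M := by
  intro m
  rw [coeff_pderiv]
  have := M.smul_of_tower_mem (m v + 1) (hF (m + Finsupp.single v 1))
  rwa [nsmul_eq_mul, mul_comm, Nat.cast_add, Nat.cast_one] at this

/-- Polynomials with coefficients in the image of `R`. -/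
def coeffSubalgebra (R : Type) [CommRing R] [Algebra R P] (K : Type) [CommRing K] [Algebra K R]
    [Algebra K P] [IsScalarTower K R P] (σ : Type) : Subalgebra K (MvPolynomial σ P) where
  carrier := coeffSubmodule σ (1 : Submodule R P)
  mul_mem' hF hG := by simpa using mul_mem_coeffSubmodule hF hG
  add_mem' hF hG := Submodule.add_mem _ hF hG
  algebraMap_mem' r := by
    rw [IsScalarTower.algebraMap_apply K P, algebraMap_eq]
    refine C_mem_coeffSubmodule (Submodule.mem_one.mpr ⟨algebraMap K R r, ?_⟩)
    rw [← IsScalarTower.algebraMap_apply]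

end CoeffSubmodule

section Reynolds

variable {n : ℕ} {a b : Fin n → ℕ} {C C' : Type} [CommRing C] [CommRing C']

/-- The action of the adjugates of the generic matrices on a tensor. -/
noncomputable def adjTensor (t : Ind b → C) : Ind b → MvPolynomial (MatVar b b) C :=
  contract (fun j => (genericMat C b b j).adjugate) fun w => MvPolynomial.C (t w)

/-- A monomial in the entries of a tensor, acted on by the inverses of the generic matrices,
with denominators cleared by the `D`-th power of the determinant. -/
noncomputable def adjMonomial (t : Ind b → C) (D : ℕ) (β : Ind b →₀ ℕ) :
    MvPolynomial (MatVar b b) C :=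
  genericDet C b ^ (D - β.degree) * ∏ w, adjTensor t w ^ β w

lemma map_adjTensor (f : C →+* C') (t : Ind b → C) (w : Ind b) :
    map f (adjTensor t w) = adjTensor (fun w => f (t w)) w := by
  rw [adjTensor, map_contract, adjTensor]
  congr 1
  · funext j
    rw [← RingHom.mapMatrix_apply, RingHom.map_adjugate]
    congr 1
    ext k i
    simp
  · funext w
    simp

lemma map_adjMonomial (f : C →+* C') (t : Ind b → C) (D : ℕ) (β : Ind b →₀ ℕ) :
    map f (adjMonomial t D β) = adjMonomial (fun w => f (t w)) D β := by
  simp only [adjMonomial, map_mul, map_pow, map_prod, map_adjTensor, map_genericDet]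

lemma matSubst_adjTensor (s : ∀ j, Matrix (Fin (b j)) (Fin (b j)) C) (t : Ind b → C)
    (w : Ind b) :
    matSubst s (adjTensor (contract s t) w) =
      MvPolynomial.C (∏ j, (s j).det) * adjTensor t w := by
  have h1 : ∀ j, ((genericMat C b b j).adjugate).map (matSubst s) =
      (genericMat C b b j).adjugate * ((s j).map MvPolynomial.C).adjugate := fun j => by
    rw [← AlgHom.mapMatrix_apply, AlgHom.map_adjugate, AlgHom.mapMatrix_apply,
      matSubst_genericMat, Matrix.adjugate_mul_distrib]
  have h2 : (fun w => matSubst s (MvPolynomial.C (contract s t w))) =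
      contract (fun j => (s j).map MvPolynomial.C) fun w => MvPolynomial.C (t w) := by
    funext w
    rw [← algebraMap_eq, AlgHom.commutes, algebraMap_eq, map_contract]
  rw [adjTensor, map_contract, h2, contract_contract]
  have h3 : ∀ j, ((genericMat C b b j).adjugate).map (matSubst s) * (s j).map MvPolynomial.C =
      (MvPolynomial.C (s j).det : MvPolynomial (MatVar b b) C) •
        (genericMat C b b j).adjugate := fun j => by
    rw [h1, Matrix.mul_assoc, Matrix.adjugate_mul, Matrix.mul_smul, Matrix.mul_one,
      RingHom.map_det]
    rfl
  simp only [h3]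
  rw [contract_smul, map_prod]
  rfl

lemma matSubst_adjMonomial (s : ∀ j, Matrix (Fin (b j)) (Fin (b j)) C) (t : Ind b → C)
    {D : ℕ} {β : Ind b →₀ ℕ} (h : β.degree ≤ D) :
    matSubst s (adjMonomial (contract s t) D β) =
      MvPolynomial.C (∏ j, (s j).det) ^ D * adjMonomial t D β := by
  have h1 : D = (D - β.degree) + ∑ w, β w := by
    rw [← Finsupp.degree_eq_sum]
    omega
  simp only [adjMonomial, map_mul, map_pow, map_prod, matSubst_adjTensor, matSubst_genericDet,
    mul_pow, Finset.prod_mul_distrib, Finset.prod_pow_eq_pow_sum]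
  generalize genericDet C b ^ (D - β.degree) = e
  conv_rhs => rw [h1, pow_add]
  ring

lemma exists_pderiv_eq {K σ : Type} [Field K] [CharZero K] (u : σ) (p : MvPolynomial σ K) :
    ∃ q, pderiv u q = p := by
  classical
  induction p using MvPolynomial.induction_on' with
  | monomial m r =>
    refine ⟨monomial (m + Finsupp.single u 1) (r / (m u + 1)), ?_⟩
    have : (m u + 1 : K) ≠ 0 := by exact_mod_cast Nat.succ_ne_zero (m u)
    rw [pderiv_monomial]
    simp [this]
  | add p q hp hq =>
    obtain ⟨p', rfl⟩ := hp
    obtain ⟨q', rfl⟩ := hq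
    exact ⟨p' + q', map_add _ _ _⟩

lemma derivation_aeval {K σ : Type} [Field K] {B : Type} [CommRing B] [Algebra K B]
    (D : Derivation K B B) (q : σ → B) (u : σ) (c : B) (hu : D (q u) = c)
    (hne : ∀ v, v ≠ u → D (q v) = 0) (p : MvPolynomial σ K) :
    D (aeval q p) = c * aeval q (pderiv u p) := by
  classical
  induction p using MvPolynomial.induction_on with
  | C r => simp
  | add p p' hp hp' => simp only [map_add, hp, hp', mul_add]
  | mul_X p v hp =>
    rw [map_mul, Derivation.leibniz, hp, aeval_X, Derivation.leibniz, pderiv_X]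
    by_cases h : v = u
    · subst h
      simp [hu]
      ring
    · simp [hne v h, h]
      ring

lemma coeffDerivation_map_C {K P σ τ : Type} [Field K] [CommRing P] [Algebra K P]
    (z : τ) (F : MvPolynomial σ P) :
    coeffDerivation σ ((pderiv z : Derivation P (MvPolynomial τ P) _).restrictScalars K)
      (map MvPolynomial.C F) = 0 := by
  ext m : 1
  rw [coeff_coeffDerivation, coeff_map]
  simp

variable {K P R : Type} [Field K] [CommRing P] [Algebra K P] [CommRing R] [Algebra R P]

/-- Right multiplication of a family of matrices by generic square matrices. -/
noncomputable def mulGeneric (K : Type) [Field K] [Algebra K C]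
    (x : ∀ j, Matrix (Fin (a j)) (Fin (b j)) C) :
    MvPolynomial (MatVar a b) K →ₐ[K] MvPolynomial (MatVar b b) C :=
  aeval fun z => ((x z.1).map (MvPolynomial.C : C →+* MvPolynomial (MatVar b b) C) *
    genericMat C b b z.1) z.2.1 z.2.2

variable (x : ∀ j, Matrix (Fin (a j)) (Fin (b j)) P) (t : Ind b → P) (N : Submodule R P)

/-- The products of left generic square matrices with a given family. -/
noncomputable def genericMul (j : Fin n) :
    Matrix (Fin (b j)) (Fin (b j)) (MvPolynomial (MatVar b a) P) :=
  genericMat P b a j * (x j).map (MvPolynomial.C : P →+* MvPolynomial (MatVar b a) P)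

lemma prod_det_genericMul_mem (hN : ∀ J, rowMinor x J ∈ N) :
    ∏ j, (genericMul x j).det ∈ coeffSubmodule (MatVar b a) N := by
  simp only [genericMul]
  rw [prod_det_mul_eq_sum]
  refine sum_mem fun k _ => ?_
  rw [← one_mul N]
  refine mul_mem_coeffSubmodule ?_ ?_
  · refine Subalgebra.prod_mem (coeffSubalgebra R R (MatVar b a)) fun j _ =>
      Subalgebra.prod_mem _ fun i _ => ?_
    exact X_mem_coeffSubmodule _
  · rw [← map_rowMinor]
    exact C_mem_coeffSubmodule (hN k)

lemma prod_det_genericMul_ne_zero (hx : ∃ J, rowMinor x J ≠ 0) :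
    ∏ j, (genericMul x j).det ≠ 0 := by
  obtain ⟨J, hJ⟩ := hx
  intro h
  apply hJ
  have h1 := congrArg (eval fun v : MatVar b a => if v.2.2 = J v.1 v.2.1 then (1 : P) else 0) h
  rw [map_prod, map_zero] at h1
  rw [← h1, rowMinor]
  refine Finset.prod_congr rfl fun j _ => ?_
  rw [RingHom.map_det]
  congr 1
  ext i l
  simp [genericMul, Matrix.mul_apply]


variable [Algebra K R] [IsScalarTower K R P]

/-- The entries of the generic multiple of a tensor in the image of a family of matrices. -/
lemma contract_genericMul_mem (hR : ∀ v, contract x t v ∈ (1 : Submodule R P)) (w : Ind b) :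
    contract (genericMul x) (fun w => MvPolynomial.C (t w)) w ∈
      coeffSubalgebra R K (MatVar b a) := by
  have h : contract (genericMul x) (fun w => MvPolynomial.C (t w)) =
      contract (genericMat P b a) fun v => MvPolynomial.C (contract x t v) := by
    have h1 : (fun v => (MvPolynomial.C (contract x t v) : MvPolynomial (MatVar b a) P)) =
        contract (fun j => (x j).map (MvPolynomial.C : P →+* MvPolynomial (MatVar b a) P))
          fun w => MvPolynomial.C (t w) := by
      funext v
      rw [map_contract]
    rw [h1, contract_contract]
    rfl
  rw [h]
  refine Subalgebra.sum_mem _ fun v _ => Subalgebra.mul_mem _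
    (Subalgebra.prod_mem _ fun j _ => X_mem_coeffSubmodule _) (C_mem_coeffSubmodule (hR v))

variable [IsDomain P]

theorem detFunctional_genericMul_mem (hx : ∃ J, rowMinor x J ≠ 0) (hN : ∀ J, rowMinor x J ∈ N)
    (hR : ∀ v, contract x t v ∈ (1 : Submodule R P)) {D : ℕ} {β : Ind b →₀ ℕ}
    (hD : β.degree ≤ D) (w : ℕ) (p : MvPolynomial (Σ j, Fin (b j)) K) :
    detFunctional K (D + w) (aeval (fun u => ∑ l, MvPolynomial.C (genericMul x u.1 u.2 l) *
        X (⟨u.1, l, u.2⟩ : MatVar b b)) p *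
      adjMonomial (fun w => MvPolynomial.C (t w)) D β) ∈ coeffSubmodule (MatVar b a) (N ^ w) := by
  let S := coeffSubalgebra R K (MatVar b a) (P := P)
  let τ : Ind b → S := fun w =>
    ⟨contract (genericMul x) (fun w => MvPolynomial.C (t w)) w, contract_genericMul_mem x t hR w⟩
  let F : MvPolynomial (MatVar b b) S :=
    aeval (fun u => X (⟨u.1, u.2, u.2⟩ : MatVar b b)) p * adjMonomial τ D β
  have h1 : map (S.val : S →+* MvPolynomial (MatVar b a) P) F =
      aeval (fun u => X (⟨u.1, u.2, u.2⟩ : MatVar b b)) p *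
        adjMonomial (contract (genericMul x) (fun w => MvPolynomial.C (t w))) D β := by
    rw [map_mul, map_adjMonomial]
    congr 1
    have := congrArg (fun f => f p) (comp_aeval (R := K) 
      (fun u : Σ j, Fin (b j) => (X (⟨u.1, u.2, u.2⟩ : MatVar b b) : MvPolynomial _ S))
      (mapAlgHom (σ := MatVar b b) S.val))
    simpa using this
  have h2 := detFunctional_matSubst (K := K) (D + w) (genericMul x)
    (map (S.val : S →+* MvPolynomial (MatVar b a) P) F)
  rw [detFunctional_map, h1, map_mul, matSubst_adjMonomial _ _ hD] at h2
  set δ := ∏ j, (genericMul x j).det with hδ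
  have h3 : matSubst (genericMul x) (aeval (fun u => X (⟨u.1, u.2, u.2⟩ : MatVar b b)) p) =
      aeval (fun u => ∑ l, MvPolynomial.C (genericMul x u.1 u.2 l) *
        X (⟨u.1, l, u.2⟩ : MatVar b b)) p := by
    have := congrArg (fun f => f p) (comp_aeval (R := K)
      (fun u : Σ j, Fin (b j) => (X (⟨u.1, u.2, u.2⟩ : MatVar b b) :
        MvPolynomial _ (MvPolynomial (MatVar b a) P)))
      ((matSubst (genericMul x)).restrictScalars K))
    simpa [matSubst_X] using this
  rw [h3, mul_left_comm, ← map_pow, detFunctional_C_mul, pow_add, mul_assoc] at h2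
  rw [mul_left_cancel₀ (pow_ne_zero D (prod_det_genericMul_ne_zero x hx)) h2, ← mul_one (N ^ w)]
  exact mul_mem_coeffSubmodule (pow_mem_coeffSubmodule (prod_det_genericMul_mem x N hN) w)
    (detFunctional K (D + w) F).2

theorem detFunctional_mulGeneric_mem [CharZero K] (hx : ∃ J, rowMinor x J ≠ 0) (hN : ∀ J, rowMinor x J ∈ N)
    (hR : ∀ v, contract x t v ∈ (1 : Submodule R P)) {D : ℕ} {β : Ind b →₀ ℕ}
    (hD : β.degree ≤ D) (w : ℕ) (f : MvPolynomial (MatVar a b) K) :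
    detFunctional K (D + w) (mulGeneric K x f * adjMonomial t D β) ∈ N ^ w := by
  suffices h : ∀ p : MvPolynomial (Σ j, Fin (b j)) K, detFunctional K (D + w)
      (map MvPolynomial.C (mulGeneric K x f) *
        (aeval (fun u => ∑ l, MvPolynomial.C (genericMul x u.1 u.2 l) *
          X (⟨u.1, l, u.2⟩ : MatVar b b)) p *
        adjMonomial (fun w => MvPolynomial.C (t w)) D β)) ∈ coeffSubmodule (MatVar b a) (N ^ w) by
    have h1 := h 1 0
    rw [map_one, one_mul, ← map_adjMonomial, ← map_mul] at h1
    have h2 := detFunctional_map (K := K) (IsScalarTower.toAlgHom K P (MvPolynomial (MatVar b a) P))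
      (D + w) (mulGeneric K x f * adjMonomial t D β)
    simp only [IsScalarTower.coe_toAlgHom, algebraMap_eq] at h2
    rw [h2] at h1
    simpa using h1
  induction f using MvPolynomial.induction_on with
  | C r =>
    intro p
    have := detFunctional_genericMul_mem x t N hx hN hR hD w (MvPolynomial.C r * p)
    rw [map_mul, mul_assoc] at this
    convert this using 3
    rw [mulGeneric, aeval_C, aeval_C, IsScalarTower.algebraMap_apply K P, algebraMap_eq, map_C]
    rfl
  | add f g hf hg =>
    intro p
    rw [map_add, map_add, add_mul, detFunctional_add]
    exact Submodule.add_mem _ (hf p) (hg p)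
  | mul_X f z hf =>
    intro p
    obtain ⟨j, k, i⟩ := z
    obtain ⟨p, rfl⟩ := exists_pderiv_eq (⟨j, i⟩ : Σ j, Fin (b j)) p
    let δ : Derivation K (MvPolynomial (MatVar b a) P) (MvPolynomial (MatVar b a) P) :=
      (pderiv (⟨j, i, k⟩ : MatVar b a)).restrictScalars K
    have h1 := pderiv_mem_coeffSubmodule (hf p) (⟨j, i, k⟩ : MatVar b a)
    have h2 := detFunctional_coeffDerivation δ (D + w) (map MvPolynomial.C (mulGeneric K x f) *
        (aeval (fun u => ∑ l, MvPolynomial.C (genericMul x u.1 u.2 l) *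
          X (⟨u.1, l, u.2⟩ : MatVar b b)) p *
        adjMonomial (fun w => MvPolynomial.C (t w)) D β))
    rw [← show δ _ = pderiv _ _ from rfl, ← h2] at h1
    convert h1 using 2
    rw [Derivation.leibniz, Derivation.leibniz, coeffDerivation_map_C, ← map_adjMonomial,
      coeffDerivation_map_C, derivation_aeval (coeffDerivation _ δ) _ ⟨j, i⟩
        (map MvPolynomial.C (mulGeneric K x (X ⟨j, k, i⟩)))]
    · simp only [map_mul, smul_eq_mul]
      ring
    · simp only [map_sum, Derivation.leibniz, coeffDerivation_X, coeffDerivation_C, smul_zero,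
        zero_add, δ, genericMul, Matrix.mul_apply]
      simp only [map_sum, genericMat_apply, Matrix.map_apply, Derivation.restrictScalars_apply,
        pderiv_C, pderiv_X, smul_eq_mul, mulGeneric,
        aeval_X, Matrix.mul_apply, map_mul, map_C, map_X, mul_comm]
      refine Finset.sum_congr rfl fun l _ => ?_
      rw [Finset.sum_eq_single k]
      · simp
      · intro k' _ hk'
        simp [hk']
      · simp
    · rintro ⟨j', i'⟩ h
      simp only [map_sum, Derivation.leibniz, coeffDerivation_X, coeffDerivation_C, smul_zero,
        zero_add, δ, genericMul, Matrix.mul_apply]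
      refine Finset.sum_eq_zero fun l _ => ?_
      rw [Finset.sum_eq_zero, smul_zero]
      intro k' _
      have h' : (⟨j', i', k'⟩ : MatVar b a) ≠ ⟨j, i, k⟩ := by
        rintro h'
        cases h'
        exact h rfl
      simp [h']

end Reynolds

section TensorRing

variable {n : ℕ} (K : Type) [Field K] (a b : Fin n → ℕ)

/-- Polynomials in the entries of a tensor of format `b` over the polynomials in the entries of
matrices of formats `a j × b j`. -/
abbrev TensorRing : Type := MvPolynomial (Ind b) (MvPolynomial (MatVar a b) K)

/-- The generic matrices, over the ring of polynomials in matrices and a tensor. -/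
noncomputable def xMat (j : Fin n) : Matrix (Fin (a j)) (Fin (b j)) (TensorRing K a b) :=
  (genericMat K a b j).map (MvPolynomial.C : _ →+* TensorRing K a b)

@[simp]
lemma xMat_apply (j : Fin n) (k : Fin (a j)) (i : Fin (b j)) :
    xMat K a b j k i = MvPolynomial.C (X ⟨j, k, i⟩) := rfl

/-- The generic element of the subspace variety. -/
noncomputable def genericTensor : Ind a → TensorRing K a b := contract (xMat K a b) X

/-- The comorphism of the parametrisation of the subspace variety. -/
noncomputable def paramHom : MvPolynomial (Ind a) K →ₐ[K] TensorRing K a b :=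
  aeval (genericTensor K a b)

/-- The index set for products of maximal minors. -/
abbrev RowSets {n : ℕ} (a b : Fin n → ℕ) : Type := ∀ j, Fin (b j) ↪ Fin (a j)

variable {a b}

/-- Products of maximal minors of the generic matrices. -/
noncomputable def genMinor (J : RowSets a b) : TensorRing K a b :=
  rowMinor (xMat K a b) fun j => J j

/-- A point where a given product of minors takes the value one. -/
lemma eval_rowMinor_genericMat (J : RowSets a b) :
    eval (fun v : MatVar a b => if v.2.1 = J v.1 v.2.2 then (1 : K) else 0)
      (rowMinor (genericMat K a b) fun j => J j) = 1 := by
  rw [map_rowMinor, rowMinor]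
  refine Finset.prod_eq_one fun j _ => ?_
  convert Matrix.det_one (n := Fin (b j)) (R := K)
  ext k i
  simp [Matrix.one_apply]

lemma genMinor_eq_C (J : RowSets a b) :
    genMinor K J = MvPolynomial.C (rowMinor (genericMat K a b) fun j => J j) := by
  rw [map_rowMinor]
  rfl

lemma genMinor_ne_zero (J : RowSets a b) : genMinor K J ≠ 0 := by
  intro h
  rw [genMinor_eq_C, map_eq_zero_iff _ (C_injective _ _)] at h
  have h1 := eval_rowMinor_genericMat K J
  rw [h, map_zero] at h1
  exact zero_ne_one h1

variable (a b)

/-- The span of the products of maximal minors, over a subring. -/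
noncomputable def minorSpan (R : Type) [CommRing R] [Algebra R (TensorRing K a b)] :
    Submodule R (TensorRing K a b) :=
  Submodule.span R (Set.range fun J : RowSets a b => genMinor K J)

variable {a b}

lemma rowMinor_mem_minorSpan (R : Type) [CommRing R] [Algebra R (TensorRing K a b)]
    (J : ∀ j, Fin (b j) → Fin (a j)) : rowMinor (xMat K a b) J ∈ minorSpan K a b R := by
  by_cases h : ∀ j, Function.Injective (J j)
  · exact Submodule.subset_span ⟨fun j => ⟨J j, h j⟩, rfl⟩
  · push Not at h
    obtain ⟨j, hj⟩ := h
    rw [rowMinor_of_not_injective _ _ j hj]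
    exact Submodule.zero_mem _

variable (a b)

/-- Polynomials in the entries of generic square matrices over the tensor ring. -/
abbrev TwistRing : Type := MvPolynomial (MatVar b b) (TensorRing K a b)

variable {a b}

variable {W : Type} [Field W] {ι : TwistRing K a b →+* W}

variable {K} in
/-- The generic point of the action of the product of general linear groups, with values in
a field containing the ring of polynomials in square matrices. -/
noncomputable def twist (ι : TwistRing K a b →+* W) : TensorRing K a b →+* W :=
  eval₂Hom (ι.comp (mulGeneric K (xMat K a b) : _ →+* TwistRing K a b))
    fun w => ι (adjTensor X w) / ι (genericDet (TensorRing K a b) b)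

variable {K}

lemma twistDet_ne_zero (hι : Function.Injective ι) : ι (genericDet (TensorRing K a b) b) ≠ 0 :=
  (map_ne_zero_iff _ hι).mpr genericDet_ne_zero

lemma twist_monomial (hι : Function.Injective ι) {D : ℕ} {β : Ind b →₀ ℕ} (h : β.degree ≤ D)
    (f : MvPolynomial (MatVar a b) K) :
    ι (mulGeneric K (xMat K a b) f * adjMonomial X D β) =
      ι (genericDet (TensorRing K a b) b) ^ D * twist ι (monomial β f) := by
  have h1 : D = (D - β.degree) + ∑ w, β w := by
    rw [← Finsupp.degree_eq_sum]
    omega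
  have h2 : twist ι (monomial β f) = ι (mulGeneric K (xMat K a b) f) *
      ∏ w, (ι (adjTensor X w) / ι (genericDet (TensorRing K a b) b)) ^ β w := by
    rw [twist, coe_eval₂Hom, eval₂_monomial, Finsupp.prod_fintype _ _ (by simp)]
    rfl
  rw [h2, adjMonomial]
  simp only [div_pow, Finset.prod_div_distrib, Finset.prod_pow_eq_pow_sum, map_mul, map_pow,
    map_prod]
  have h3 := twistDet_ne_zero hι
  have h4 : ι (genericDet (TensorRing K a b) b) ^ D =
      ι (genericDet (TensorRing K a b) b) ^ (D - β.degree) *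
        ι (genericDet (TensorRing K a b) b) ^ ∑ w, β w := by
    rw [← pow_add, ← h1]
  rw [h4]
  field_simp

lemma twist_xMat (j : Fin n) :
    (xMat K a b j).map (twist ι) = ((xMat K a b j).map (ι.comp MvPolynomial.C)) *
        (genericMat (TensorRing K a b) b b j).map ι := by
  ext k i
  rw [Matrix.map_apply, twist, xMat_apply, eval₂Hom_C, RingHom.comp_apply]
  have h : mulGeneric K (xMat K a b) (X ⟨j, k, i⟩) =
      ((xMat K a b j).map (MvPolynomial.C : _ →+* TwistRing K a b) *
        genericMat (TensorRing K a b) b b j) k i := aeval_X _ _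
  rw [RingHom.coe_coe, h, Matrix.mul_apply, map_sum, Matrix.mul_apply]
  simp

lemma twist_genericTensor (hι : Function.Injective ι) (v : Ind a) :
    twist ι (genericTensor K a b v) = ι (MvPolynomial.C (genericTensor K a b v)) := by
  have h0 := twistDet_ne_zero hι
  have h1 : (fun w => twist ι (X w)) = contract (fun j => ((genericMat (TensorRing K a b) b b
      j).adjugate).map ι) fun w => (ι (genericDet (TensorRing K a b) b))⁻¹ *
        ι (MvPolynomial.C (X w)) := by
    funext w
    have h2 : twist ι (X w) = ι (adjTensor X w) / ι (genericDet (TensorRing K a b) b) :=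
      eval₂Hom_X' _ _ _
    rw [h2, adjTensor, map_contract, contract, contract, Finset.sum_div]
    refine Finset.sum_congr rfl fun u _ => ?_
    field_simp
  have h3 : ∀ j, (xMat K a b j).map (twist ι) *
      ((genericMat (TensorRing K a b) b b j).adjugate).map ι =
        ι (genericMat (TensorRing K a b) b b j).det •
          (xMat K a b j).map (ι.comp MvPolynomial.C) := fun j => by
    rw [twist_xMat, Matrix.mul_assoc, ← Matrix.map_mul, Matrix.mul_adjugate]
    ext k i
    simp [Matrix.mul_apply, Matrix.one_apply, apply_ite, mul_comm]
  rw [genericTensor, map_contract, h1, contract_contract]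
  simp only [h3]
  have h4 : ∏ j, ι (genericMat (TensorRing K a b) b b j).det =
      ι (genericDet (TensorRing K a b) b) := by
    rw [genericDet, map_prod]
  rw [contract_smul, h4, ← RingHom.comp_apply, map_contract, contract, contract, Finset.mul_sum]
  refine Finset.sum_congr rfl fun u _ => ?_
  rw [RingHom.comp_apply]
  field_simp

lemma twist_genMinor (J : RowSets a b) :
    twist ι (genMinor K J) = ι (genericDet _ b * MvPolynomial.C (genMinor K J)) := by
  rw [genMinor, map_rowMinor]
  simp only [twist_xMat]
  rw [rowMinor_mul, ← map_rowMinor, mul_comm, map_mul, genericDet, map_prod]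
  congr 1
  exact Finset.prod_congr rfl fun j _ => by
    have h := RingHom.map_det (R := TwistRing K a b) (S := W) ι
      (genericMat (TensorRing K a b) b b j)
    exact h.symm

variable {R : Type} [CommRing R] [Algebra R (TensorRing K a b)]

lemma twist_algebraMap (hι : Function.Injective ι)
    (hR : ∀ r : R, ∃ p, paramHom K a b p = algebraMap R (TensorRing K a b) r) (r : R) :
    twist ι (algebraMap R (TensorRing K a b) r) =
      ι (MvPolynomial.C (algebraMap R (TensorRing K a b) r)) := by
  obtain ⟨p, hp⟩ := hR r
  rw [← hp]
  clear hp
  induction p using MvPolynomial.induction_on with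
  | C r =>
    have h1 : paramHom K a b (MvPolynomial.C r) =
        (MvPolynomial.C (MvPolynomial.C r) : TensorRing K a b) := aeval_C _ _
    rw [h1, twist, eval₂Hom_C, RingHom.comp_apply, RingHom.coe_coe, mulGeneric, aeval_C]
    rfl
  | add p q hp hq => simp only [map_add, hp, hq]
  | mul_X p v hp =>
    have h1 : paramHom K a b (X v) = genericTensor K a b v := aeval_X _ _
    rw [map_mul, map_mul, hp, h1, twist_genericTensor hι, ← map_mul, ← map_mul]

lemma twist_of_mem (hι : Function.Injective ι)
    (hR : ∀ r : R, ∃ p, paramHom K a b p = algebraMap R (TensorRing K a b) r)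
    {w : ℕ} {u : TensorRing K a b} (hu : u ∈ minorSpan K a b R ^ w) :
    twist ι u = ι (genericDet _ b ^ w * MvPolynomial.C u) := by
  have h0 : ∀ m ∈ minorSpan K a b R, twist ι m = ι (genericDet _ b * MvPolynomial.C m) := by
    intro m hm
    induction hm using Submodule.span_induction with
    | mem x hx =>
      obtain ⟨J, rfl⟩ := hx
      exact twist_genMinor J
    | zero => rw [map_zero, map_zero, mul_zero, map_zero]
    | add x y hx hy h1 h2 => rw [map_add, h1, h2, map_add, mul_add, map_add]
    | smul r x hx h =>
      rw [Algebra.smul_def, map_mul, h, twist_algebraMap hι hR, ← map_mul,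
        map_mul MvPolynomial.C, mul_left_comm]
  induction hu using Submodule.pow_induction_on_left' with
  | algebraMap r => rw [twist_algebraMap hι hR, pow_zero, one_mul]
  | add x y i hx hy h1 h2 => rw [map_add, h1, h2, map_add, mul_add, map_add]
  | mem_mul m hm i x hx h =>
    rw [map_mul, h, h0 m hm]
    simp only [map_mul, map_pow, Nat.succ_eq_add_one]
    ring

variable [CharZero K] [Algebra K R] [IsScalarTower K R (TensorRing K a b)]

theorem exists_twist_lift [Nonempty (RowSets a b)] (hι : Function.Injective ι)
    (hT : ∀ v, genericTensor K a b v ∈ (1 : Submodule R (TensorRing K a b)))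
    (y : TensorRing K a b) : ∃ D₀, ∀ D, D₀ ≤ D → ∃ F : TwistRing K a b,
        ι F = ι (genericDet _ b) ^ D * twist ι y ∧
        ∀ w, detFunctional K (D + w) F ∈ minorSpan K a b R ^ w := by
  induction y using MvPolynomial.induction_on' with
  | monomial β f =>
    refine ⟨β.degree, fun D hD => ⟨mulGeneric K (xMat K a b) f * adjMonomial X D β,
      twist_monomial hι hD f, fun w => ?_⟩⟩
    exact detFunctional_mulGeneric_mem (xMat K a b) X _
      ⟨fun j => (Classical.arbitrary (RowSets a b) j), genMinor_ne_zero K _⟩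
      (rowMinor_mem_minorSpan K R) hT hD w f
  | add y y' h h' =>
    obtain ⟨D, hD⟩ := h
    obtain ⟨D', hD'⟩ := h'
    refine ⟨max D D', fun E hE => ?_⟩
    obtain ⟨F, h1, h2⟩ := hD E (le_trans (le_max_left _ _) hE)
    obtain ⟨F', h1', h2'⟩ := hD' E (le_trans (le_max_right _ _) hE)
    refine ⟨F + F', by rw [map_add, h1, h1', map_add, mul_add], fun w => ?_⟩
    rw [detFunctional_add]
    exact Submodule.add_mem _ (h2 w) (h2' w)

theorem isIntegrallyClosed_of_paramHom [Nonempty (RowSets a b)]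
    (hinj : Function.Injective (algebraMap R (TensorRing K a b)))
    (hR : ∀ r : R, ∃ p, paramHom K a b p = algebraMap R (TensorRing K a b) r)
    (hT : ∀ v, genericTensor K a b v ∈ (1 : Submodule R (TensorRing K a b))) :
    IsIntegrallyClosed R := by
  have : IsDomain R := hinj.isDomain _
  rw [isIntegrallyClosed_iff (FractionRing R)]
  intro x hx
  obtain ⟨u, v, hv, rfl⟩ := IsFractionRing.div_surjective (A := R) x
  have hv0 : v ≠ 0 := nonZeroDivisors.ne_zero hv
  have hv1 := (map_ne_zero_iff _ hinj).mpr hv0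
  let φ : FractionRing R →+* FractionRing (TensorRing K a b) := IsFractionRing.map hinj
  have hφ : ∀ r, φ (algebraMap R _ r) = algebraMap (TensorRing K a b) _ (algebraMap R _ r) :=
    fun r => IsLocalization.map_eq _ r
  have h1 : IsIntegral (TensorRing K a b) (φ (algebraMap R _ u / algebraMap R _ v)) :=
    hx.map_of_comp_eq (algebraMap R (TensorRing K a b)) φ (RingHom.ext fun r => (hφ r).symm)
  obtain ⟨f, hf⟩ := IsIntegrallyClosed.isIntegral_iff.mp h1
  rw [map_div₀, hφ, hφ, eq_div_iff ((map_ne_zero_iff _ (IsFractionRing.injective _ _)).mpr hv1),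
    ← map_mul] at hf
  have hf' := IsFractionRing.injective (TensorRing K a b) (FractionRing (TensorRing K a b)) hf
  let ι : TwistRing K a b →+* FractionRing (TwistRing K a b) := algebraMap _ _
  have hι : Function.Injective ι :=
    IsFractionRing.injective (TwistRing K a b) (FractionRing (TwistRing K a b))
  have h2 : twist ι f = ι (MvPolynomial.C f) := by
    have h3 := congrArg (twist ι) hf'
    rw [map_mul, twist_algebraMap hι hR, twist_algebraMap hι hR, ← hf', map_mul MvPolynomial.C,
      map_mul] at h3
    refine mul_right_cancel₀ ?_ h3
    exact (map_ne_zero_iff _ hι).mpr ((map_ne_zero_iff _ (C_injective _ _)).mpr hv1)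
  obtain ⟨D, hD⟩ := exists_twist_lift hι hT f
  obtain ⟨F, hF, hw⟩ := hD D le_rfl
  rw [h2, ← map_pow, ← map_mul] at hF
  have hF' := hι hF
  have h4 := hw 0
  rw [hF', mul_comm, detFunctional_C_mul, add_zero, detFunctional_genericDet_pow, mul_one,
    pow_zero] at h4
  obtain ⟨r, hr⟩ := Submodule.mem_one.mp h4
  refine ⟨r, ?_⟩
  rw [eq_div_iff ((map_ne_zero_iff _ (IsFractionRing.injective _ _)).mpr hv0), ← map_mul]
  congr 1
  apply hinj
  rw [map_mul, hr, hf']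

end TensorRing

section ReynoldsCech

variable {n : ℕ} {K : Type} [Field K] {a b : Fin n → ℕ}
  {R : Type} [CommRing R] [Algebra R (TensorRing K a b)]

lemma detFunctional_sum {C : Type} [CommRing C] [Algebra K C] (N : ℕ) {κ : Type} (s : Finset κ)
    (F : κ → MvPolynomial (MatVar b b) C) :
    detFunctional K N (∑ i ∈ s, F i) = ∑ i ∈ s, detFunctional K N (F i) := by
  simp [detFunctional, Finset.smul_sum]

lemma genMinor_mem_minorSpan (J : RowSets a b) : genMinor K J ∈ minorSpan K a b R :=
  Submodule.subset_span ⟨J, rfl⟩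

variable [CharZero K] [Algebra K R] [IsScalarTower K R (TensorRing K a b)]

/-- Averaging a Čech primitive over the product of general linear groups. -/
theorem exists_primitive_mem_minorSpan [Nonempty (RowSets a b)]
    (hR : ∀ r : R, ∃ p, paramHom K a b p = algebraMap R (TensorRing K a b) r)
    (hT : ∀ v, genericTensor K a b v ∈ (1 : Submodule R (TensorRing K a b)))
    {p k : ℕ} {u : (Fin (p + 2) → RowSets a b) → TensorRing K a b}
    (hu : ∀ g, u g ∈ minorSpan K a b R ^ (k * (p + 2)))
    (y : (Fin (p + 1) → RowSets a b) → TensorRing K a b)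
    (hy : ∀ g, ∑ j : Fin (p + 2), (-1) ^ (j : ℕ) * (genMinor K (g j) ^ k * y (g ∘ j.succAbove)) =
      u g) :
    ∃ z : (Fin (p + 1) → RowSets a b) → TensorRing K a b,
      (∀ f, z f ∈ minorSpan K a b R ^ (k * (p + 1))) ∧
      ∀ g, ∑ j : Fin (p + 2), (-1) ^ (j : ℕ) * (genMinor K (g j) ^ k * z (g ∘ j.succAbove)) =
        u g := by
  let ι : TwistRing K a b →+* FractionRing (TwistRing K a b) := algebraMap _ _
  have hι : Function.Injective ι :=
    IsFractionRing.injective (TwistRing K a b) (FractionRing (TwistRing K a b))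
  choose D₀ hD₀ using fun f => exists_twist_lift hι hT (y f)
  let D : ℕ := ∑ f, D₀ f
  choose F hF hFmem using fun f => hD₀ f D
    (Finset.single_le_sum (f := D₀) (fun _ _ => Nat.zero_le _) (Finset.mem_univ f))
  refine ⟨fun f => detFunctional K (D + k * (p + 1)) (F f), fun f => hFmem f _, fun g => ?_⟩
  have h1 : ∑ j : Fin (p + 2), MvPolynomial.C ((-1) ^ (j : ℕ) * genMinor K (g j) ^ k) *
      F (g ∘ j.succAbove) = MvPolynomial.C (u g) * genericDet _ b ^ (D + k * (p + 1)) := by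
    apply hι
    refine mul_left_cancel₀ (pow_ne_zero k (twistDet_ne_zero hι)) ?_
    have h2 := twist_of_mem hι hR (hu g)
    have h3 : ι (genericDet _ b ^ (k * (p + 2)) * MvPolynomial.C (u g)) =
        ι (genericDet _ b) ^ (k * (p + 2)) * ι (MvPolynomial.C (u g)) := by
      rw [map_mul, map_pow]
    rw [h3, ← hy g, map_sum] at h2
    have h4 : ι (genericDet (TensorRing K a b) b) ^ k *
        ι (MvPolynomial.C (u g) * genericDet _ b ^ (D + k * (p + 1))) =
        ι (genericDet _ b) ^ D *
          (ι (genericDet _ b) ^ (k * (p + 2)) * ι (MvPolynomial.C (u g))) := by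
      rw [map_mul, map_pow]
      ring
    rw [h4, ← hy g, ← h2, Finset.mul_sum, map_sum, Finset.mul_sum]
    refine Finset.sum_congr rfl fun j _ => ?_
    rw [map_mul ι, hF]
    simp only [map_mul, map_pow, map_neg, map_one, twist_genMinor]
    ring
  have h5 := congrArg (detFunctional K (D + k * (p + 1))) h1
  rw [detFunctional_sum, detFunctional_C_mul, detFunctional_genericDet_pow, mul_one] at h5
  rw [← h5]
  refine Finset.sum_congr rfl fun j _ => ?_
  rw [detFunctional_C_mul, mul_assoc]

end ReynoldsCech

section HighestWeight

variable {n : ℕ} (K : Type) [Field K] {a b : Fin n → ℕ}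

/-- The vector field on families of matrices given by a column operation. -/
noncomputable def colDerivation (j : Fin n) (i i' : Fin (b j)) :
    Derivation K (MvPolynomial (MatVar a b) K) (MvPolynomial (MatVar a b) K) :=
  ∑ k : Fin (a j), (X ⟨j, k, i⟩ : MvPolynomial (MatVar a b) K) • pderiv ⟨j, k, i'⟩

lemma colDerivation_apply (j : Fin n) (i i' : Fin (b j)) (f : MvPolynomial (MatVar a b) K) :
    colDerivation K j i i' f = ∑ k : Fin (a j), X ⟨j, k, i⟩ * pderiv ⟨j, k, i'⟩ f := by
  rw [colDerivation, ← Derivation.coeFnAddMonoidHom_apply, map_sum, Finset.sum_apply]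
  rfl

lemma colDerivation_X_self (j : Fin n) (i i' : Fin (b j)) (k : Fin (a j)) :
    colDerivation K j i i' (X ⟨j, k, i'⟩) = X ⟨j, k, i⟩ := by
  rw [colDerivation_apply, Finset.sum_eq_single k]
  · simp
  · intro k' _ hk'
    rw [pderiv_X_of_ne, mul_zero]
    intro h
    cases h
    exact hk' rfl
  · simp

lemma colDerivation_X_of_ne (j : Fin n) (i i' : Fin (b j)) {z : MatVar a b}
    (hz : ∀ k, z ≠ ⟨j, k, i'⟩) : colDerivation K j i i' (X z) = 0 := by
  rw [colDerivation_apply]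
  exact Finset.sum_eq_zero fun k _ => by rw [pderiv_X_of_ne (hz k), mul_zero]

variable {K}

lemma Derivation.leibniz_prod_of_eq {B κ : Type} [CommRing B] [Algebra K B]
    (D : Derivation K B B) (f : κ → B) (s : Finset κ) (c : κ) (hc : c ∈ s)
    (hf : ∀ d ∈ s, d ≠ c → D (f d) = 0) [DecidableEq κ] :
    D (∏ d ∈ s, f d) = D (f c) * ∏ d ∈ s.erase c, f d := by
  have h1 : ∀ t : Finset κ, (∀ d ∈ t, D (f d) = 0) → D (∏ d ∈ t, f d) = 0 := by
    intro t
    induction t using Finset.induction_on with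
    | empty => simp
    | insert x t hx ih =>
      intro h
      rw [Finset.prod_insert hx, Derivation.leibniz, h x (Finset.mem_insert_self x t),
        ih fun d hd => h d (Finset.mem_insert_of_mem hd)]
      simp
  rw [← Finset.mul_prod_erase s f hc, Derivation.leibniz,
    h1 _ fun d hd => hf d (Finset.mem_of_mem_erase hd) (Finset.ne_of_mem_erase hd)]
  simp [mul_comm]

lemma Derivation.prod_eq_zero {B κ : Type} [CommRing B] [Algebra K B]
    (D : Derivation K B B) (f : κ → B) (s : Finset κ) (hf : ∀ d ∈ s, D (f d) = 0) :
    D (∏ d ∈ s, f d) = 0 := by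
  classical
  induction s using Finset.induction_on with
  | empty => simp
  | insert x t hx ih =>
    rw [Finset.prod_insert hx, Derivation.leibniz, hf x (Finset.mem_insert_self x t),
      ih fun d hd => hf d (Finset.mem_insert_of_mem hd)]
    simp

lemma Derivation.det_eq_zero {B κ : Type} [CommRing B] [Algebra K B] [Fintype κ] [DecidableEq κ]
    (D : Derivation K B B) (M : Matrix κ κ B) (h : ∀ i c, D (M i c) = 0) : D M.det = 0 := by
  rw [Matrix.det_apply, map_sum]
  refine Finset.sum_eq_zero fun s _ => ?_
  rw [Units.smul_def, map_zsmul, Derivation.prod_eq_zero D _ _ fun d _ => h _ _, smul_zero]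

lemma Derivation.det_eq_ite {B κ : Type} [CommRing B] [Algebra K B] [Fintype κ] [DecidableEq κ]
    (D : Derivation K B B) (M : Matrix κ κ B) (c₀ c₁ : κ) (h : ∀ i, D (M i c₁) = M i c₀)
    (h' : ∀ i c, c ≠ c₁ → D (M i c) = 0) : D M.det = if c₀ = c₁ then M.det else 0 := by
  have h1 : D M.det = (M.updateCol c₁ fun i => M i c₀).det := by
    rw [Matrix.det_apply, Matrix.det_apply, map_sum]
    refine Finset.sum_congr rfl fun s _ => ?_
    rw [Units.smul_def, map_zsmul, Derivation.leibniz_prod_of_eq D _ _ c₁ (Finset.mem_univ _)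
      fun d _ hd => h' _ _ hd, h, ← Finset.mul_prod_erase _ _ (Finset.mem_univ c₁)]
    congr 1
    simp only [Matrix.updateCol_self]
    congr 1
    refine Finset.prod_congr rfl fun d hd => ?_
    rw [Matrix.updateCol_ne (Finset.ne_of_mem_erase hd)]
  rw [h1]
  split_ifs with hc
  · subst hc
    congr 1
    exact Matrix.updateCol_eq_self M c₀
  · refine Matrix.det_zero_of_column_eq hc fun i => ?_
    rw [Matrix.updateCol_self, Matrix.updateCol_ne hc]

lemma colDerivation_det (j j' : Fin n) (i i' : Fin (b j)) (κ : Fin (b j') → Fin (a j')) :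
    colDerivation K j i i' ((genericMat K a b j').submatrix κ id).det =
      if j = j' ∧ i = i' then ((genericMat K a b j').submatrix κ id).det else 0 := by
  by_cases hj : j = j'
  · subst hj
    simp only [true_and]
    refine Derivation.det_eq_ite _ _ i i' (fun k => colDerivation_X_self K _ _ _ _)
      fun k c hc => colDerivation_X_of_ne K _ _ _ fun l h => ?_
    cases h
    exact hc rfl
  · rw [if_neg (fun h => hj h.1)]
    refine Derivation.det_eq_zero _ _ fun k c => colDerivation_X_of_ne K _ _ _ fun l h => ?_
    exact hj (congrArg Sigma.fst h).symm

/-- A minor on the first `r` columns of a generic matrix. -/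
noncomputable def leadMinor (K : Type) [Field K] (j : Fin n) {r : ℕ} (hr : r ≤ b j)
    (κ : Fin r → Fin (a j)) : MvPolynomial (MatVar a b) K :=
  (Matrix.of fun i c : Fin r => (X ⟨j, κ i, Fin.castLE hr c⟩ : MvPolynomial (MatVar a b) K)).det

/-- The minors in the last row expansion of `leadMinor`. -/
noncomputable def coMinor (K : Type) [Field K] (j : Fin n) {r : ℕ} (hr : r + 1 ≤ b j)
    (κ : Fin r → Fin (a j)) (c : Fin (r + 1)) : MvPolynomial (MatVar a b) K :=
  (Matrix.of fun i d : Fin r =>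
    (X ⟨j, κ i, Fin.castLE hr (c.succAbove d)⟩ : MvPolynomial (MatVar a b) K)).det

lemma coMinor_last (j : Fin n) {r : ℕ} (hr : r + 1 ≤ b j) (κ : Fin r → Fin (a j)) :
    coMinor K j hr κ (Fin.last r) = leadMinor K j (Nat.le_of_succ_le hr) κ := by
  rw [coMinor, leadMinor]
  simp only [Fin.succAbove_last, Fin.castLE_castSucc]

lemma leadMinor_snoc (j : Fin n) {r : ℕ} (hr : r + 1 ≤ b j) (κ : Fin r → Fin (a j))
    (k : Fin (a j)) :
    leadMinor K j hr (Fin.snoc (α := fun _ => Fin (a j)) κ k) = ∑ c : Fin (r + 1),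
      (-1) ^ (r + (c : ℕ)) * X ⟨j, k, Fin.castLE hr c⟩ * coMinor K j hr κ c := by
  rw [leadMinor, Matrix.det_succ_row _ (Fin.last r)]
  refine Finset.sum_congr rfl fun c _ => ?_
  rw [Matrix.of_apply, Fin.snoc_last, Fin.val_last, coMinor]
  congr 2
  ext i d
  simp

lemma leadMinor_of_not_injective (j : Fin n) {r : ℕ} (hr : r ≤ b j) (κ : Fin r → Fin (a j))
    (h : ¬ Function.Injective κ) : leadMinor K j hr κ = 0 := by
  obtain ⟨i, i', h1, hne⟩ : ∃ i i', κ i = κ i' ∧ i ≠ i' := by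
    simpa [Function.Injective] using h
  refine Matrix.det_zero_of_row_eq hne ?_
  funext c
  simp [h1]

lemma pderiv_leadMinor_snoc (j : Fin n) {r : ℕ} (hr : r + 1 ≤ b j) (κ : Fin r → Fin (a j))
    (k : Fin (a j)) [Decidable (k ∈ Set.range κ)] :
    pderiv ⟨j, k, Fin.castLE hr (Fin.last r)⟩
      (leadMinor K j hr (Fin.snoc (α := fun _ => Fin (a j)) κ k)) =
      if k ∈ Set.range κ then 0 else leadMinor K j (Nat.le_of_succ_le hr) κ := by
  split_ifs with hk
  · obtain ⟨i, rfl⟩ := hk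
    rw [leadMinor_of_not_injective, map_zero]
    intro h
    have := @h i.castSucc (Fin.last r) (by simp)
    exact (Fin.castSucc_lt_last i).ne this
  · have h1 : ∀ c, pderiv ⟨j, k, Fin.castLE hr (Fin.last r)⟩ (coMinor K j hr κ c) = 0 := by
      intro c
      refine Derivation.det_eq_zero _ _ fun i d => pderiv_X_of_ne fun h => ?_
      injection h with _ h
      exact hk ⟨i, (Prod.mk.inj h).1⟩
    rw [leadMinor_snoc, map_sum, Finset.sum_eq_single (Fin.last r)]
    · rw [Derivation.leibniz, h1, Derivation.leibniz, pderiv_X_self, Fin.val_last,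
        Even.neg_one_pow ⟨r, rfl⟩, coMinor_last]
      simp
    · intro c _ hc
      rw [Derivation.leibniz, h1, Derivation.leibniz, pderiv_X_of_ne]
      · have : pderiv (⟨j, k, Fin.castLE hr (Fin.last r)⟩ : MatVar a b)
            ((-1 : MvPolynomial (MatVar a b) K) ^ (r + (c : ℕ))) = 0 := by
          rw [Derivation.leibniz_pow, map_neg, Derivation.map_one_eq_zero]
          simp
        rw [this]
        simp
      · intro h
        have h2 : Fin.castLE hr c = Fin.castLE hr (Fin.last r) := by
          injection h with _ h
          exact (Prod.mk.inj h).2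
        exact hc (Fin.castLE_injective hr h2)
    · simp

variable {M : Type} [AddCommGroup M] [Module (MvPolynomial (MatVar a b) K) M]

/-- The action of column operations on a module with derivations. -/
noncomputable def colOp (D : MatVar a b → M →+ M) (j : Fin n) (i i' : Fin (b j)) (m : M) : M :=
  ∑ k : Fin (a j), (X ⟨j, k, i⟩ : MvPolynomial (MatVar a b) K) • D ⟨j, k, i'⟩ m

/-- Highest weight vectors for the action of column operations. -/
def IsHighestWeight (D : MatVar a b → M →+ M) (m : M) : Prop :=
  ∃ l : ∀ j, Fin (b j) → ℕ, ∀ j (i i' : Fin (b j)), i ≤ i' →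
    colOp (K := K) D j i i' m = if i = i' then (l j i : MvPolynomial (MatVar a b) K) • m else 0

variable {D : MatVar a b → M →+ M}

lemma colOp_smul (hD : ∀ z (f : MvPolynomial (MatVar a b) K) m,
      D z (f • m) = f • D z m + pderiv z f • m) (j : Fin n)
    (i i' : Fin (b j)) (f : MvPolynomial (MatVar a b) K) (m : M) :
    colOp (K := K) D j i i' (f • m) = f • colOp (K := K) D j i i' m + colDerivation K j i i' f • m := by
  simp only [colOp, hD, smul_add, Finset.sum_add_distrib, Finset.smul_sum, colDerivation_apply,
    Finset.sum_smul, smul_smul]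
  simp only [mul_comm]

lemma natCast_smul_eq_zero [CharZero K] {c : ℕ} (hc : c ≠ 0) {m : M}
    (h : (c : MvPolynomial (MatVar a b) K) • m = 0) : m = 0 := by
  have h1 : (MvPolynomial.C ((c : K)⁻¹) : MvPolynomial (MatVar a b) K) * (c : _) = 1 := by
    rw [← map_natCast (MvPolynomial.C : K →+* MvPolynomial (MatVar a b) K), ← map_mul,
      inv_mul_cancel₀ (Nat.cast_ne_zero.mpr hc), map_one]
  rw [← one_smul (MvPolynomial (MatVar a b) K) m, ← h1, mul_smul, h, smul_zero]

lemma exists_leadMinor_snoc_smul_ne_zero [CharZero K]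
    (hD : ∀ z (f : MvPolynomial (MatVar a b) K) m, D z (f • m) = f • D z m + pderiv z f • m)
    {m : M} (hm : IsHighestWeight (K := K) D m) (j : Fin n) (hab : b j ≤ a j)
    {r : ℕ} (hr : r + 1 ≤ b j) (κ : Fin r → Fin (a j))
    (hκ : leadMinor K j (Nat.le_of_succ_le hr) κ • m ≠ 0) :
    ∃ κ' : Fin (r + 1) → Fin (a j), leadMinor K j hr κ' • m ≠ 0 := by
  classical
  obtain ⟨l, hl⟩ := hm
  by_contra! H
  have h1 : ∑ k, D ⟨j, k, Fin.castLE hr (Fin.last r)⟩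
      (leadMinor K j hr (Fin.snoc (α := fun _ => Fin (a j)) κ k) • m) = 0 :=
    Finset.sum_eq_zero fun k _ => by rw [H, map_zero]
  simp only [hD, Finset.sum_add_distrib, pderiv_leadMinor_snoc] at h1
  have h2 : ∑ k, leadMinor K j hr (Fin.snoc (α := fun _ => Fin (a j)) κ k) •
      D ⟨j, k, Fin.castLE hr (Fin.last r)⟩ m =
      (l j (Fin.castLE hr (Fin.last r)) : MvPolynomial (MatVar a b) K) •
        leadMinor K j (Nat.le_of_succ_le hr) κ • m := by
    have h3 : ∀ c : Fin (r + 1), ∑ k, ((-1) ^ (r + (c : ℕ)) * X ⟨j, k, Fin.castLE hr c⟩ *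
        coMinor K j hr κ c) • D ⟨j, k, Fin.castLE hr (Fin.last r)⟩ m =
        ((-1) ^ (r + (c : ℕ)) * coMinor K j hr κ c) •
          colOp (K := K) D j (Fin.castLE hr c) (Fin.castLE hr (Fin.last r)) m := fun c => by
      rw [colOp, Finset.smul_sum]
      refine Finset.sum_congr rfl fun k _ => ?_
      rw [smul_smul]
      congr 1
      ring
    simp only [leadMinor_snoc, Finset.sum_smul]
    rw [Finset.sum_comm]
    simp only [h3]
    rw [Finset.sum_eq_single (Fin.last r)]
    · rw [hl _ _ _ le_rfl, if_pos rfl, coMinor_last, Fin.val_last, Even.neg_one_pow ⟨r, rfl⟩,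
        one_mul, smul_comm]
    · intro c _ hc
      rw [hl _ _ _ (Fin.le_last c), if_neg (fun h => hc (Fin.castLE_injective hr h)), smul_zero]
    · simp
  have h4 : ∑ k, (if k ∈ Set.range κ then 0 else leadMinor K j (Nat.le_of_succ_le hr) κ) • m =
      ((Finset.univ.filter fun k => k ∉ Set.range κ).card : MvPolynomial (MatVar a b) K) •
        leadMinor K j (Nat.le_of_succ_le hr) κ • m := by
    have h5 : ∀ k, (if k ∈ Set.range κ then 0 else leadMinor K j (Nat.le_of_succ_le hr) κ) • m =
        if k ∉ Set.range κ then leadMinor K j (Nat.le_of_succ_le hr) κ • m else 0 := fun k => by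
      split_ifs <;> simp_all
    simp only [h5]
    rw [← Finset.sum_filter, Finset.sum_const, Nat.cast_smul_eq_nsmul]
  rw [h2, h4, ← add_smul, ← Nat.cast_add] at h1
  refine hκ (natCast_smul_eq_zero ?_ h1)
  have h6 : (Finset.univ.filter fun k => k ∉ Set.range κ).Nonempty := by
    by_contra h7
    rw [Finset.not_nonempty_iff_eq_empty, Finset.filter_eq_empty_iff] at h7
    have h8 : Function.Surjective κ := fun k => by simpa using h7 (Finset.mem_univ k)
    have h9 := Fintype.card_le_of_surjective κ h8
    simp only [Fintype.card_fin] at h9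
    omega
  have := h6.card_pos
  omega

lemma exists_minor_smul_ne_zero [CharZero K]
    (hD : ∀ z (f : MvPolynomial (MatVar a b) K) m, D z (f • m) = f • D z m + pderiv z f • m)
    {m : M} (hm : IsHighestWeight (K := K) D m) (hm0 : m ≠ 0) (j : Fin n) (hab : b j ≤ a j) :
    ∃ κ : Fin (b j) → Fin (a j), ((genericMat K a b j).submatrix κ id).det • m ≠ 0 := by
  suffices h : ∀ r (hr : r ≤ b j), ∃ κ : Fin r → Fin (a j), leadMinor K j hr κ • m ≠ 0 from
    h (b j) le_rfl
  intro r
  induction r with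
  | zero => exact fun hr => ⟨Fin.elim0, by simpa [leadMinor] using hm0⟩
  | succ r ih =>
    intro hr
    obtain ⟨κ, hκ⟩ := ih (Nat.le_of_succ_le hr)
    exact exists_leadMinor_snoc_smul_ne_zero hD hm j hab hr κ hκ

lemma IsHighestWeight.minor_smul
    (hD : ∀ z (f : MvPolynomial (MatVar a b) K) m, D z (f • m) = f • D z m + pderiv z f • m)
    {m : M} (hm : IsHighestWeight (K := K) D m) (j : Fin n) (κ : Fin (b j) → Fin (a j)) :
    IsHighestWeight (K := K) D (((genericMat K a b j).submatrix κ id).det • m) := by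
  obtain ⟨l, hl⟩ := hm
  refine ⟨fun j' i => l j' i + if j' = j then 1 else 0, fun j' i i' hi => ?_⟩
  rw [colOp_smul hD, hl j' i i' hi, colDerivation_det]
  by_cases h : i = i' <;> by_cases hj : j' = j
  · simp only [h, hj, and_self, if_true, Nat.cast_add, Nat.cast_one, add_smul, one_smul]
    rw [smul_comm]
  · simp only [h, hj, if_true, if_false, and_true, zero_smul, add_zero]
    rw [smul_comm]
  · simp [h]
  · simp [h]

lemma exists_rowMinor_smul_ne_zero [CharZero K]
    (hD : ∀ z (f : MvPolynomial (MatVar a b) K) m, D z (f • m) = f • D z m + pderiv z f • m)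
    (hab : ∀ j, b j ≤ a j) {m : M} (hm : IsHighestWeight (K := K) D m) (hm0 : m ≠ 0) :
    ∃ J : ∀ j, Fin (b j) → Fin (a j), rowMinor (genericMat K a b) J • m ≠ 0 ∧
      IsHighestWeight (K := K) D (rowMinor (genericMat K a b) J • m) := by
  classical
  suffices h : ∀ s : Finset (Fin n), ∃ J : ∀ j, Fin (b j) → Fin (a j),
      (∏ j ∈ s, ((genericMat K a b j).submatrix (J j) id).det) • m ≠ 0 ∧
      IsHighestWeight (K := K) D
        ((∏ j ∈ s, ((genericMat K a b j).submatrix (J j) id).det) • m) from h Finset.univ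
  intro s
  induction s using Finset.induction_on with
  | empty => exact ⟨fun j i => Fin.castLE (hab j) i, by simpa using hm0, by simpa using hm⟩
  | insert j s hj ih =>
    obtain ⟨J, h1, h2⟩ := ih
    obtain ⟨κ, hκ⟩ := exists_minor_smul_ne_zero hD h2 h1 j (hab j)
    have h3 : (∏ l ∈ insert j s,
        ((genericMat K a b l).submatrix (Function.update J j κ l) id).det) • m =
        ((genericMat K a b j).submatrix κ id).det •
          (∏ l ∈ s, ((genericMat K a b l).submatrix (J l) id).det) • m := by
      rw [Finset.prod_insert hj, mul_smul, Function.update_self]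
      congr 2
      refine Finset.prod_congr rfl fun l hl => ?_
      rw [Function.update_of_ne (ne_of_mem_of_not_mem hl hj)]
    exact ⟨Function.update J j κ, by rwa [h3], by
      rw [h3]
      exact h2.minor_smul hD j κ⟩

/-- A highest weight vector that is torsion for every product of maximal minors vanishes. -/
theorem IsHighestWeight.eq_zero [CharZero K]
    (hD : ∀ z (f : MvPolynomial (MatVar a b) K) m, D z (f • m) = f • D z m + pderiv z f • m)
    (hab : ∀ j, b j ≤ a j) {m : M} (hm : IsHighestWeight (K := K) D m)
    (htors : ∀ J : RowSets a b, ∃ N : ℕ,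
      rowMinor (genericMat K a b) (fun j => J j) ^ N • m = 0) : m = 0 := by
  by_contra hm0
  let δ : (∀ j, Fin (b j) → Fin (a j)) → MvPolynomial (MatVar a b) K :=
    rowMinor (genericMat K a b)
  let I : Ideal (MvPolynomial (MatVar a b) K) := Ideal.span (Set.range δ)
  let T : Ideal (MvPolynomial (MatVar a b) K) :=
    LinearMap.ker (LinearMap.toSpanSingleton (MvPolynomial (MatVar a b) K) M m)
  have hT : ∀ f, f ∈ T ↔ f • m = 0 := fun f => by
    simp [T, LinearMap.mem_ker, LinearMap.toSpanSingleton_apply]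
  have hIT : I ≤ T.radical := by
    refine Ideal.span_le.mpr ?_
    rintro _ ⟨J, rfl⟩
    by_cases hJ : ∀ j, Function.Injective (J j)
    · obtain ⟨N, hN⟩ := htors fun j => ⟨J j, hJ j⟩
      exact ⟨N, (hT _).mpr hN⟩
    · push Not at hJ
      obtain ⟨j, hj⟩ := hJ
      have : δ J = 0 := rowMinor_of_not_injective _ _ j hj
      rw [this]
      exact Ideal.zero_mem _
  obtain ⟨N, hN⟩ := Ideal.exists_pow_le_of_le_radical_of_fg hIT (IsNoetherian.noetherian I)
  have key : ∀ N : ℕ, ∃ f ∈ I ^ N, f • m ≠ 0 ∧ IsHighestWeight (K := K) D (f • m) := by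
    intro N
    induction N with
    | zero => exact ⟨1, by simp, by simpa using hm0, by simpa using hm⟩
    | succ N ih =>
      obtain ⟨f, hf, h1, h2⟩ := ih
      obtain ⟨J, h3, h4⟩ := exists_rowMinor_smul_ne_zero hD hab h2 h1
      refine ⟨δ J * f, ?_, by rwa [mul_smul], by rwa [mul_smul]⟩
      rw [pow_succ']
      exact Ideal.mul_mem_mul (Ideal.subset_span ⟨J, rfl⟩) hf
  obtain ⟨f, hf, h1, -⟩ := key N
  exact h1 ((hT f).mp (hN hf))

end HighestWeight

lemma MvPolynomial.mkDerivation_eq_sum_pderiv {σ C : Type} [Fintype σ] [CommRing C]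
    (f : σ → MvPolynomial σ C) (p : MvPolynomial σ C) :
    mkDerivation C f p = ∑ w, f w * pderiv w p := by
  classical
  induction p using MvPolynomial.induction_on with
  | C r => simp
  | add p q hp hq => simp only [map_add, hp, hq, mul_add, Finset.sum_add_distrib]
  | mul_X p v hp =>
    rw [Derivation.leibniz, hp, mkDerivation_X]
    simp only [Derivation.leibniz, smul_eq_mul, mul_add, Finset.sum_add_distrib, Finset.mul_sum]
    congr 1
    · rw [Finset.sum_eq_single v]
      · rw [pderiv_X_self]
        ring
      · intro w _ hw
        rw [pderiv_X_of_ne hw.symm]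
        simp
      · simp
    · exact Finset.sum_congr rfl fun w _ => by ring

section EquivariantDerivation

variable {n : ℕ} (K : Type) [Field K] {a b : Fin n → ℕ}

/-- The vector field on tensors given by an elementary matrix. -/
noncomputable def tensorDerivation (j : Fin n) (i i' : Fin (b j)) :
    Derivation K (TensorRing K a b) (TensorRing K a b) :=
  (mkDerivation (MvPolynomial (MatVar a b) K) fun w : Ind b =>
    if w j = i then X (Function.update w j i') else 0).restrictScalars K

lemma tensorDerivation_X (j : Fin n) (i i' : Fin (b j)) (u : Ind b) :
    tensorDerivation K (a := a) j i i' (X u) =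
      if u j = i then X (Function.update u j i') else 0 :=
  mkDerivation_X _ _ _

lemma tensorDerivation_apply (j : Fin n) (i i' : Fin (b j)) (f : TensorRing K a b) :
    tensorDerivation K j i i' f =
      ∑ w : Ind b with w j = i, X (Function.update w j i') * pderiv w f := by
  rw [Finset.sum_filter]
  refine (mkDerivation_eq_sum_pderiv _ f).trans (Finset.sum_congr rfl fun w _ => ?_)
  split_ifs <;> simp

lemma tensorDerivation_C (j : Fin n) (i i' : Fin (b j)) (c : MvPolynomial (MatVar a b) K) :
    tensorDerivation K j i i' (MvPolynomial.C c) = 0 := by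
  rw [tensorDerivation_apply]
  exact Finset.sum_eq_zero fun w _ => by rw [pderiv_C, mul_zero]

/-- The infinitesimal action of an elementary matrix on a generic matrix and a generic tensor. -/
noncomputable def elemDerivation (j : Fin n) (i i' : Fin (b j)) :
    Derivation K (TensorRing K a b) (TensorRing K a b) :=
  coeffDerivation (Ind b) (colDerivation K j i i') - tensorDerivation K j i i'

lemma elemDerivation_apply (j : Fin n) (i i' : Fin (b j)) (f : TensorRing K a b) :
    elemDerivation K j i i' f = coeffDerivation (Ind b) (colDerivation K j i i') f -
      tensorDerivation K j i i' f := rfl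

lemma elemDerivation_C (j : Fin n) (i i' : Fin (b j)) (c : MvPolynomial (MatVar a b) K) :
    elemDerivation K j i i' (MvPolynomial.C c) = MvPolynomial.C (colDerivation K j i i' c) := by
  rw [elemDerivation_apply, tensorDerivation_C, sub_zero, coeffDerivation_C]

lemma colDerivation_prod_X (j : Fin n) (i i' : Fin (b j)) (v : Ind a) (u : Ind b) :
    colDerivation K j i i' (∏ l, X ⟨l, v l, u l⟩) =
      if u j = i' then ∏ l, X ⟨l, v l, Function.update u j i l⟩ else 0 := by
  classical
  have h0 : ∀ l, l ≠ j → colDerivation K j i i' (X ⟨l, v l, u l⟩) = 0 := fun l hl =>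
    colDerivation_X_of_ne K _ _ _ fun k h => hl (congrArg Sigma.fst h)
  rw [Derivation.leibniz_prod_of_eq _ _ _ j (Finset.mem_univ j) fun l _ => h0 l]
  split_ifs with h
  · subst h
    rw [colDerivation_X_self, ← Finset.mul_prod_erase _ _ (Finset.mem_univ j)]
    rw [Function.update_self]
    congr 1
    refine Finset.prod_congr rfl fun l hl => ?_
    rw [Function.update_of_ne (Finset.ne_of_mem_erase hl)]
  · rw [colDerivation_X_of_ne, zero_mul]
    intro k hk
    injection hk with _ hk
    exact h (Prod.mk.inj hk).2

lemma elemDerivation_genericTensor (j : Fin n) (i i' : Fin (b j)) (v : Ind a) :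
    elemDerivation K j i i' (genericTensor K a b v) = 0 := by
  classical
  have h1 : genericTensor K a b v =
      ∑ u : Ind b, MvPolynomial.C (∏ l, X ⟨l, v l, u l⟩) * X u := by
    simp only [genericTensor, contract, xMat_apply, map_prod]
  have h2 : ∀ (D : Derivation K (TensorRing K a b) (TensorRing K a b)) (f g : TensorRing K a b),
      D (f * g) = f * D g + g * D f := fun D f g => D.leibniz f g
  rw [elemDerivation_apply, h1, map_sum, map_sum, sub_eq_zero]
  simp only [h2, coeffDerivation_X, coeffDerivation_C, tensorDerivation_C, tensorDerivation_X,
    mul_zero, zero_add, add_zero, colDerivation_prod_X]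
  have h3 : ∀ u : Ind b, (X u * MvPolynomial.C (if u j = i' then
      ∏ l, X ⟨l, v l, Function.update u j i l⟩ else 0) : TensorRing K a b) =
      if u j = i' then X u * MvPolynomial.C (∏ l, X ⟨l, v l, Function.update u j i l⟩) else 0 := by
    intro u
    split_ifs <;> simp
  simp only [h3, mul_ite, mul_zero]
  rw [← Finset.sum_filter, ← Finset.sum_filter]
  refine Finset.sum_bij' (fun u _ => Function.update u j i) (fun u _ => Function.update u j i')
    ?_ ?_ ?_ ?_ ?_
  · intro u _
    simp
  · intro u _
    simp
  · intro u hu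
    rw [Finset.mem_filter] at hu
    simp [← hu.2]
  · intro u hu
    rw [Finset.mem_filter] at hu
    simp [← hu.2]
  · intro u hu
    rw [Finset.mem_filter] at hu
    simp [← hu.2, mul_comm]

lemma elemDerivation_paramHom (j : Fin n) (i i' : Fin (b j)) (p : MvPolynomial (Ind a) K) :
    elemDerivation K j i i' (paramHom K a b p) = 0 := by
  induction p using MvPolynomial.induction_on with
  | C r =>
    rw [← MvPolynomial.algebraMap_eq, AlgHom.commutes, Derivation.map_algebraMap]
  | add p q hp hq => rw [map_add, map_add, hp, hq, add_zero]
  | mul_X p v hp =>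
    rw [map_mul, Derivation.leibniz, hp, paramHom, aeval_X, elemDerivation_genericTensor]
    simp

lemma colDerivation_rowMinor (j : Fin n) (i i' : Fin (b j)) (J : ∀ j, Fin (b j) → Fin (a j)) :
    colDerivation K j i i' (rowMinor (genericMat K a b) J) =
      if i = i' then rowMinor (genericMat K a b) J else 0 := by
  classical
  rw [rowMinor, Derivation.leibniz_prod_of_eq _ _ _ j (Finset.mem_univ j), colDerivation_det]
  · split_ifs with h1 h2 h2
    · exact Finset.mul_prod_erase _ (fun l => ((genericMat K a b l).submatrix (J l) id).det)
        (Finset.mem_univ j)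
    · exact absurd h1.2 h2
    · exact absurd ⟨rfl, h2⟩ h1
    · exact zero_mul _
  · intro l _ hl
    rw [colDerivation_det, if_neg fun h => hl h.1.symm]

variable {K} {R : Type} [CommRing R] [Algebra R (TensorRing K a b)]

lemma elemDerivation_of_mem
    (hR : ∀ r : R, ∃ p, paramHom K a b p = algebraMap R (TensorRing K a b) r)
    (j : Fin n) (i i' : Fin (b j)) {w : ℕ} {u : TensorRing K a b}
    (hu : u ∈ minorSpan K a b R ^ w) :
    elemDerivation K j i i' u = if i = i' then (w : TensorRing K a b) * u else 0 := by
  have hr : ∀ r : R, elemDerivation K j i i' (algebraMap R (TensorRing K a b) r) = 0 := by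
    intro r
    obtain ⟨p, hp⟩ := hR r
    rw [← hp, elemDerivation_paramHom]
  have h1 : ∀ m ∈ minorSpan K a b R, elemDerivation K j i i' m = if i = i' then m else 0 := by
    intro m hm
    induction hm using Submodule.span_induction with
    | mem x hx =>
      obtain ⟨J, rfl⟩ := hx
      change elemDerivation K j i i' (genMinor K J) = if i = i' then genMinor K J else 0
      rw [genMinor_eq_C, elemDerivation_C, colDerivation_rowMinor]
      split_ifs <;> simp
    | zero => simp
    | add x y _ _ hx hy =>
      rw [map_add, hx, hy]
      split_ifs <;> simp
    | smul r x _ hx =>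
      rw [Algebra.smul_def, Derivation.leibniz, hr, hx]
      split_ifs <;> simp
  induction hu using Submodule.pow_induction_on_left' with
  | algebraMap r =>
    rw [hr]
    simp
  | add x y w _ _ hx hy =>
    rw [map_add, hx, hy]
    split_ifs
    · ring
    · simp
  | mem_mul m hm w x _ hx =>
    rw [Derivation.leibniz, h1 m hm, hx]
    split_ifs
    · simp only [smul_eq_mul]
      push_cast
      ring
    · simp

open Classical in
lemma colDerivation_coeff_of_mem
    (hR : ∀ r : R, ∃ p, paramHom K a b p = algebraMap R (TensorRing K a b) r)
    (j : Fin n) (i i' : Fin (b j)) {k : ℕ} {u : TensorRing K a b}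
    (hu : u ∈ minorSpan K a b R ^ k) (μ : Ind b →₀ ℕ) :
    colDerivation K j i i' (coeff μ u) =
      (∑ w : Ind b with w j = i, if Function.update w j i' ∈ μ.support then
        coeff (μ - Finsupp.single (Function.update w j i') 1 + Finsupp.single w 1) u *
          ((((μ - Finsupp.single (Function.update w j i') 1 : Ind b →₀ ℕ) w : ℕ) :
            MvPolynomial (MatVar a b) K) + 1) else 0) +
      if i = i' then (k : MvPolynomial (MatVar a b) K) * coeff μ u else 0 := by
  have h := congrArg (coeff μ) (elemDerivation_of_mem hR j i i' hu)
  rw [elemDerivation_apply, coeff_sub, coeff_coeffDerivation, sub_eq_iff_eq_add,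
    tensorDerivation_apply, coeff_sum] at h
  rw [h, add_comm]
  congr 1
  · refine Finset.sum_congr rfl fun w _ => ?_
    rw [coeff_X_mul']
    split_ifs
    · rw [coeff_pderiv]
    · rfl
  · split_ifs
    · rw [← map_natCast (MvPolynomial.C : _ →+* TensorRing K a b), coeff_C_mul]
    · simp

lemma colDerivation_coeff_of_mem_of_eq
    (hR : ∀ r : R, ∃ p, paramHom K a b p = algebraMap R (TensorRing K a b) r)
    (j : Fin n) (i : Fin (b j)) {k : ℕ} {u : TensorRing K a b}
    (hu : u ∈ minorSpan K a b R ^ k) (μ : Ind b →₀ ℕ) :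
    colDerivation K j i i (coeff μ u) =
      (((∑ w : Ind b with w j = i, μ w) + k : ℕ) : MvPolynomial (MatVar a b) K) * coeff μ u := by
  classical
  rw [colDerivation_coeff_of_mem hR j i i hu, if_pos rfl]
  push_cast
  rw [add_mul, Finset.sum_mul]
  congr 1
  refine Finset.sum_congr rfl fun w hw => ?_
  rw [Finset.mem_filter] at hw
  have h1 : Function.update w j i = w := by rw [← hw.2, Function.update_eq_self]
  rw [h1]
  split_ifs with h
  · have h2 : 1 ≤ μ w := Nat.one_le_iff_ne_zero.mpr (Finsupp.mem_support_iff.mp h)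
    rw [tsub_add_cancel_of_le (Finsupp.single_le_iff.mpr h2), mul_comm]
    congr 1
    have h3 : (μ - Finsupp.single w 1 : Ind b →₀ ℕ) w + 1 = μ w := by
      rw [Finsupp.tsub_apply, Finsupp.single_eq_same]
      exact Nat.sub_add_cancel h2
    rw [← h3, Nat.cast_add, Nat.cast_one]
    rfl
  · rw [Finsupp.notMem_support_iff.mp h]
    simp

end EquivariantDerivation

section LocalCech

variable {A L : Type} [CommRing A] [Field L] [Algebra A L]

/-- Derivations of a domain extend to its field of fractions. -/
lemma Derivation.exists_extension_fractionRing [IsDomain A] [IsFractionRing A L]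
    {K : Type} [CommRing K] [Algebra K A] (D : Derivation K A A) :
    ∃ D' : Derivation ℤ L L, ∀ c : A, D' (algebraMap A L c) = algebraMap A L (D c) := by
  let F : A →+* TrivSqZeroExt L L :=
    { toFun := fun c => (algebraMap A L c, algebraMap A L (D c))
      map_one' := by
        refine Prod.ext ?_ ?_
        · exact map_one _
        · change algebraMap A L (D 1) = 0
          rw [D.map_one_eq_zero, map_zero]
      map_zero' := by
        refine Prod.ext ?_ ?_
        · exact map_zero _
        · change algebraMap A L (D 0) = 0
          rw [map_zero, map_zero]
      map_add' := fun c d => by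
        refine Prod.ext ?_ ?_
        · exact map_add _ _ _
        · change algebraMap A L (D (c + d)) = algebraMap A L (D c) + algebraMap A L (D d)
          rw [map_add, map_add]
      map_mul' := fun c d => by
        refine Prod.ext ?_ ?_
        · exact map_mul _ _ _
        · change algebraMap A L (D (c * d)) = algebraMap A L c • algebraMap A L (D d) +
            MulOpposite.op (algebraMap A L d) • algebraMap A L (D c)
          rw [Derivation.leibniz, smul_eq_mul, smul_eq_mul, map_add, map_mul, map_mul,
            smul_eq_mul, MulOpposite.smul_eq_mul_unop, MulOpposite.unop_op]
          ring }
  have hF : ∀ c : nonZeroDivisors A, IsUnit (F c) := fun c => by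
    rw [TrivSqZeroExt.isUnit_iff_isUnit_fst]
    exact IsLocalization.map_units L c
  let G : L →+* TrivSqZeroExt L L := IsLocalization.lift hF
  have hG : ∀ c, G (algebraMap A L c) = F c := fun c => IsLocalization.lift_eq hF c
  have hfst : ∀ x, (G x).fst = x := by
    have : ((TrivSqZeroExt.fstHom ℤ L L : TrivSqZeroExt L L →+* L).comp G) = RingHom.id L := by
      refine IsLocalization.ringHom_ext (nonZeroDivisors A) ?_
      ext c
      change (G (algebraMap A L c)).fst = algebraMap A L c
      rw [hG]
      rfl
    exact fun x => congrArg (fun f : L →+* L => f x) this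
  refine ⟨Derivation.mk' ({ toFun := fun x => (G x).snd
                            map_zero' := by rw [map_zero]; rfl
                            map_add' := fun x y => by rw [map_add]; rfl } :
            L →+ L).toIntLinearMap fun x y => ?_, fun c => ?_⟩
  · change (G (x * y)).snd = x • (G y).snd + y • (G x).snd
    rw [map_mul, TrivSqZeroExt.snd_mul, hfst, hfst, MulOpposite.smul_eq_mul_unop,
      MulOpposite.unop_op, smul_eq_mul, smul_eq_mul, mul_comm (G x).snd]
  · change (G (algebraMap A L c)).snd = _
    rw [hG]
    rfl

variable {ι : Type} (δ : ι → A)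

/-- Fractions with denominator a power of the product of the members of a family. -/
def fractionsAt {q : ℕ} (f : Fin q → ι) : Submodule A L where
  carrier := { x | ∃ k : ℕ, ∃ c : A, x * algebraMap A L (∏ l, δ (f l)) ^ k = algebraMap A L c }
  zero_mem' := ⟨0, 0, by simp⟩
  add_mem' := by
    rintro x y ⟨k, c, hx⟩ ⟨k', c', hy⟩
    refine ⟨k + k', c * (∏ l, δ (f l)) ^ k' + c' * (∏ l, δ (f l)) ^ k, ?_⟩
    rw [map_add, map_mul, map_mul, map_pow, map_pow, ← hx, ← hy]
    ring
  smul_mem' := by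
    rintro r x ⟨k, c, hx⟩
    refine ⟨k, r * c, ?_⟩
    rw [Algebra.smul_def, map_mul, mul_assoc, hx]

lemma mem_fractionsAt {q : ℕ} {f : Fin q → ι} {x : L} :
    x ∈ fractionsAt δ f ↔
      ∃ k : ℕ, ∃ c : A, x * algebraMap A L (∏ l, δ (f l)) ^ k = algebraMap A L c := Iff.rfl

lemma derivation_mem_fractionsAt {D : A → A} {D' : Derivation ℤ L L}
    (hD : ∀ c, D' (algebraMap A L c) = algebraMap A L (D c)) {q : ℕ} {f : Fin q → ι} {x : L}
    (hx : x ∈ fractionsAt δ f) : D' x ∈ fractionsAt δ f := by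
  obtain ⟨k, c, hx⟩ := hx
  have h := congrArg D' hx
  rw [Derivation.leibniz, Derivation.leibniz_pow, hD, hD] at h
  refine ⟨k + 1, D c * (∏ l, δ (f l)) - k * c * D (∏ l, δ (f l)), ?_⟩
  rw [map_sub, map_mul, map_mul, map_mul, ← h, ← hx, map_natCast]
  rcases k with _ | k
  · simp
  · simp only [nsmul_eq_mul, smul_eq_mul, Nat.add_sub_cancel]
    ring

/-- The Čech differential on cochains with values in a field. -/
def cechDiff (p : ℕ) : ((Fin (p + 1) → ι) → L) →ₗ[A] ((Fin (p + 2) → ι) → L) where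
  toFun y g := ∑ j : Fin (p + 2), (-1) ^ (j : ℕ) * y (g ∘ j.succAbove)
  map_add' y z := by
    funext g
    simp [mul_add, Finset.sum_add_distrib]
  map_smul' r y := by
    funext g
    simp [Finset.smul_sum]

/-- Čech cochains with the expected denominators. -/
def localCochains (p : ℕ) : Submodule A ((Fin (p + 1) → ι) → L) where
  carrier := { y | ∀ f, y f ∈ fractionsAt δ f }
  zero_mem' _ := Submodule.zero_mem _
  add_mem' hx hy f := Submodule.add_mem _ (hx f) (hy f)
  smul_mem' r _ hx f := Submodule.smul_mem _ r (hx f)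

/-- Čech coboundaries of cochains with the expected denominators. -/
def localCoboundaries (L : Type) [Field L] [Algebra A L] (p : ℕ) :
    Submodule A ((Fin (p + 2) → ι) → L) :=
  (localCochains δ p).map (cechDiff p)

/-- Pointwise action of a derivation on cochains. -/
def cochainMap (q : ℕ) (D' : Derivation ℤ L L) :
    ((Fin q → ι) → L) →+ ((Fin q → ι) → L) where
  toFun y g := D' (y g)
  map_zero' := by
    funext g
    simp
  map_add' y z := by
    funext g
    simp

lemma cochainMap_mem {D : A → A} {D' : Derivation ℤ L L}
    (hD : ∀ c, D' (algebraMap A L c) = algebraMap A L (D c)) {p : ℕ}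
    {y : (Fin (p + 2) → ι) → L} (hy : y ∈ localCoboundaries δ L p) :
    cochainMap (p + 2) D' y ∈ localCoboundaries δ L p := by
  obtain ⟨z, hz, rfl⟩ := hy
  refine ⟨cochainMap (p + 1) D' z, fun f => derivation_mem_fractionsAt δ hD (hz f), ?_⟩
  funext g
  change ∑ j : Fin (p + 2), (-1) ^ (j : ℕ) * D' (z (g ∘ j.succAbove)) =
    D' (∑ j : Fin (p + 2), (-1) ^ (j : ℕ) * z (g ∘ j.succAbove))
  rw [map_sum]
  refine Finset.sum_congr rfl fun j _ => ?_
  rcases neg_one_pow_eq_or L (j : ℕ) with h | h <;> simp [h]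

/-- The action of a derivation on cochains modulo coboundaries. -/
def cechDerivation {D : A → A} {D' : Derivation ℤ L L}
    (hD : ∀ c, D' (algebraMap A L c) = algebraMap A L (D c)) (p : ℕ) :
    ((Fin (p + 2) → ι) → L) ⧸ localCoboundaries δ L p →+
      ((Fin (p + 2) → ι) → L) ⧸ localCoboundaries δ L p :=
  QuotientAddGroup.map (localCoboundaries δ L p).toAddSubgroup
    (localCoboundaries δ L p).toAddSubgroup (cochainMap (p + 2) D')
    fun _ hy => cochainMap_mem δ hD hy

lemma cechDerivation_mk {D : A → A} {D' : Derivation ℤ L L}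
    (hD : ∀ c, D' (algebraMap A L c) = algebraMap A L (D c)) (p : ℕ)
    (y : (Fin (p + 2) → ι) → L) :
    cechDerivation δ hD p (Submodule.Quotient.mk y) =
      Submodule.Quotient.mk (cochainMap (p + 2) D' y) := rfl

/-- Multiples of a cocycle by a suitable power of a member of the family are coboundaries. -/
lemma pow_smul_mem_localCoboundaries {p : ℕ} {k : ℕ} {c : (Fin (p + 2) → ι) → L}
    {e : (Fin (p + 2) → ι) → A}
    (hc : ∀ g, c g * algebraMap A L (∏ l, δ (g l)) ^ k = algebraMap A L (e g))
    (hcoc : ∀ g : Fin (p + 3) → ι, ∑ j : Fin (p + 3), (-1) ^ (j : ℕ) * c (g ∘ j.succAbove) = 0)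
    (J : ι) : δ J ^ k • c ∈ localCoboundaries δ L p := by
  refine ⟨fun f => δ J ^ k • c (Fin.cons J f), fun f => ?_, ?_⟩
  · refine ⟨k, e (Fin.cons J f), ?_⟩
    have h := hc (Fin.cons J f)
    rw [Fin.prod_univ_succ] at h
    simp only [Fin.cons_zero, Fin.cons_succ] at h
    change δ J ^ k • c (Fin.cons J f) * _ = _
    rw [← h, Algebra.smul_def, map_mul, map_pow]
    ring
  · funext g
    have h := hcoc (Fin.cons J g)
    rw [Fin.sum_univ_succ] at h
    have h0 : (Fin.cons J g : Fin (p + 3) → ι) ∘ (0 : Fin (p + 3)).succAbove = g := by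
      funext l
      simp
    have h1 : ∀ j : Fin (p + 2), (Fin.cons J g : Fin (p + 3) → ι) ∘ j.succ.succAbove =
        Fin.cons J (g ∘ j.succAbove) := by
      intro j
      funext l
      refine Fin.cases ?_ (fun l => ?_) l
      · simp
      · simp
    simp only [h0, h1, Fin.val_zero, pow_zero, one_mul, Fin.val_succ, pow_succ] at h
    change ∑ j : Fin (p + 2), (-1) ^ (j : ℕ) * (δ J ^ k • c (Fin.cons J (g ∘ j.succAbove))) =
      δ J ^ k • c g
    rw [add_eq_zero_iff_eq_neg.mp h, ← Finset.sum_neg_distrib, Finset.smul_sum]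
    refine Finset.sum_congr rfl fun j _ => ?_
    rw [Algebra.smul_def, Algebra.smul_def]
    ring

end LocalCech

section GenericCech

variable {n : ℕ} {K : Type} [Field K] {a b : Fin n → ℕ}
  {R : Type} [CommRing R] [Algebra R (TensorRing K a b)]

/-- The sum of all the entries of the indices occurring in a monomial. -/
noncomputable def indexWeight : (Ind b →₀ ℕ) →+ ℕ :=
  Finsupp.weight fun w => ∑ j, (w j : ℕ)

lemma indexWeight_lt {μ : Ind b →₀ ℕ} {j : Fin n} {i i' : Fin (b j)} (hi : i < i') {w : Ind b}
    (hw : w j = i) (hμ : Function.update w j i' ∈ μ.support) :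
    indexWeight (μ - Finsupp.single (Function.update w j i') 1 + Finsupp.single w 1) <
      indexWeight μ := by
  have h1 : μ - Finsupp.single (Function.update w j i') 1 +
      Finsupp.single (Function.update w j i') 1 = μ :=
    tsub_add_cancel_of_le (Finsupp.single_le_iff.mpr
      (Nat.one_le_iff_ne_zero.mpr (Finsupp.mem_support_iff.mp hμ)))
  conv_rhs => rw [← h1]
  rw [map_add, map_add, add_lt_add_iff_left, indexWeight, Finsupp.weight_single,
    Finsupp.weight_single, one_smul, one_smul]
  refine Finset.sum_lt_sum (fun l _ => ?_) ⟨j, Finset.mem_univ j, ?_⟩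
  · by_cases h : l = j
    · subst h
      rw [Function.update_self, hw]
      exact le_of_lt hi
    · rw [Function.update_of_ne h]
  · rw [Function.update_self, hw]
    exact hi

lemma genMinor_pow_mul_coeff (J : RowSets a b) (k : ℕ) (f : TensorRing K a b)
    (μ : Ind b →₀ ℕ) : coeff μ (genMinor K J ^ k * f) =
      rowMinor (genericMat K a b) (fun j => J j) ^ k * coeff μ f := by
  rw [genMinor_eq_C, ← map_pow, coeff_C_mul]

variable (L : Type) [Field L] [Algebra (MvPolynomial (MatVar a b) K) L]
  [IsFractionRing (MvPolynomial (MatVar a b) K) L]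

lemma algebraMap_rowMinor_ne_zero (J : RowSets a b) :
    algebraMap (MvPolynomial (MatVar a b) K) L
      (rowMinor (genericMat K a b) fun j => J j) ≠ 0 := by
  rw [map_ne_zero_iff _ (IsFractionRing.injective (MvPolynomial (MatVar a b) K) L)]
  intro h
  refine genMinor_ne_zero K J ?_
  rw [genMinor_eq_C, h, map_zero]

lemma algebraMap_prod_rowMinor_ne_zero {q : ℕ} (g : Fin q → RowSets a b) :
    algebraMap (MvPolynomial (MatVar a b) K) L
      (∏ l, rowMinor (genericMat K a b) fun j => g l j) ≠ 0 := by
  rw [map_prod]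
  exact Finset.prod_ne_zero_iff.mpr fun l _ => algebraMap_rowMinor_ne_zero L (g l)

/-- The coefficients of a Čech cocycle, as fractions. -/
noncomputable def coeffCochain {p : ℕ} (k : ℕ)
    (u : (Fin (p + 2) → RowSets a b) → TensorRing K a b) (μ : Ind b →₀ ℕ) :
    (Fin (p + 2) → RowSets a b) → L :=
  fun g => algebraMap (MvPolynomial (MatVar a b) K) L (coeff μ (u g)) /
    algebraMap (MvPolynomial (MatVar a b) K) L
      (∏ l, rowMinor (genericMat K a b) fun j => g l j) ^ k

variable {L}

lemma coeffCochain_mul {p : ℕ} (k : ℕ) (u : (Fin (p + 2) → RowSets a b) → TensorRing K a b)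
    (μ : Ind b →₀ ℕ) (g : Fin (p + 2) → RowSets a b) :
    coeffCochain L k u μ g * algebraMap (MvPolynomial (MatVar a b) K) L
      (∏ l, rowMinor (genericMat K a b) fun j => g l j) ^ k =
      algebraMap (MvPolynomial (MatVar a b) K) L (coeff μ (u g)) :=
  div_mul_cancel₀ _ (pow_ne_zero k (algebraMap_prod_rowMinor_ne_zero L g))

lemma coeffCochain_cocycle {p k : ℕ} {u : (Fin (p + 2) → RowSets a b) → TensorRing K a b}
    (hcoc : ∀ g : Fin (p + 3) → RowSets a b, ∑ j : Fin (p + 3),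
      (-1) ^ (j : ℕ) * (genMinor K (g j) ^ k * u (g ∘ j.succAbove)) = 0) (μ : Ind b →₀ ℕ)
    (g : Fin (p + 3) → RowSets a b) :
    ∑ j : Fin (p + 3), (-1) ^ (j : ℕ) * coeffCochain L k u μ (g ∘ j.succAbove) = 0 := by
  have h := congrArg (algebraMap (MvPolynomial (MatVar a b) K) L)
    (congrArg (coeff μ) (hcoc g))
  refine (mul_eq_zero.mp ?_).resolve_right
    (pow_ne_zero k (algebraMap_prod_rowMinor_ne_zero (K := K) L g))
  rw [coeff_sum, map_sum, coeff_zero, map_zero] at h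
  rw [Finset.sum_mul, ← h]
  refine Finset.sum_congr rfl fun j _ => ?_
  have h1 : ((-1) ^ (j : ℕ) : TensorRing K a b) = MvPolynomial.C ((-1) ^ (j : ℕ)) := by
    simp
  rw [h1, coeff_C_mul, genMinor_pow_mul_coeff, Fin.prod_univ_succAbove _ j, map_mul, map_mul,
    map_mul, ← coeffCochain_mul k u μ]
  simp only [map_pow, map_neg, map_one, Function.comp_apply]
  ring

variable [CharZero K]

/-- The coefficients of a Čech cocycle with values in powers of the span of minors are
coboundaries. -/
theorem coeffCochain_mem (hab : ∀ j, b j ≤ a j)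
    (hR : ∀ r : R, ∃ p, paramHom K a b p = algebraMap R (TensorRing K a b) r)
    {p k : ℕ} {u : (Fin (p + 2) → RowSets a b) → TensorRing K a b}
    (hu : ∀ g, u g ∈ minorSpan K a b R ^ (k * (p + 2)))
    (hcoc : ∀ g : Fin (p + 3) → RowSets a b, ∑ j : Fin (p + 3),
      (-1) ^ (j : ℕ) * (genMinor K (g j) ^ k * u (g ∘ j.succAbove)) = 0) (μ : Ind b →₀ ℕ) :
    coeffCochain L k u μ ∈ localCoboundaries
      (fun J : RowSets a b => rowMinor (genericMat K a b) fun j => J j) L p := by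
  classical
  choose D' hD' using fun z : MatVar a b => Derivation.exists_extension_fractionRing (L := L)
    (pderiv z : Derivation K (MvPolynomial (MatVar a b) K) _)
  let δ : RowSets a b → MvPolynomial (MatVar a b) K :=
    fun J => rowMinor (genericMat K a b) fun j => J j
  let D : MatVar a b → ((Fin (p + 2) → RowSets a b) → L) ⧸ localCoboundaries δ L p →+
      ((Fin (p + 2) → RowSets a b) → L) ⧸ localCoboundaries δ L p :=
    fun z => cechDerivation δ (hD' z) p
  have hD : ∀ z (f : MvPolynomial (MatVar a b) K)
      (m : ((Fin (p + 2) → RowSets a b) → L) ⧸ localCoboundaries δ L p),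
      D z (f • m) = f • D z m + pderiv z f • m := by
    intro z f m
    induction m using Submodule.Quotient.induction_on with
    | H y =>
      rw [← Submodule.Quotient.mk_smul, cechDerivation_mk, cechDerivation_mk,
        ← Submodule.Quotient.mk_smul, ← Submodule.Quotient.mk_smul, ← Submodule.Quotient.mk_add]
      congr 1
      funext g
      change D' z (f • y g) = f • D' z (y g) + pderiv z f • y g
      rw [Algebra.smul_def, Algebra.smul_def, Algebra.smul_def, Derivation.leibniz, hD',
        smul_eq_mul, smul_eq_mul, mul_comm (y g)]
  let E : ∀ j, Fin (b j) → Fin (b j) → L → L := fun j i i' x =>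
    ∑ κ : Fin (a j), (X ⟨j, κ, i⟩ : MvPolynomial (MatVar a b) K) • D' ⟨j, κ, i'⟩ x
  have hE : ∀ j i i' (x : L) (c q : MvPolynomial (MatVar a b) K) (s : ℕ) (r : ℕ),
      x * algebraMap _ L q ^ s = algebraMap _ L c →
      colDerivation K j i i' q = (r : MvPolynomial (MatVar a b) K) * q →
      E j i i' x * algebraMap _ L q ^ s =
        algebraMap _ L (colDerivation K j i i' c - ((s * r : ℕ) : _) * c) := by
    intro j i i' x c q s r h1 h2
    have h3 : algebraMap (MvPolynomial (MatVar a b) K) L (colDerivation K j i i' (q ^ s)) =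
        ((s * r : ℕ) : L) * algebraMap _ L q ^ s := by
      rw [Derivation.leibniz_pow, h2]
      rcases s with _ | s
      · simp
      · simp only [Nat.add_sub_cancel, smul_eq_mul, nsmul_eq_mul, map_mul, map_natCast, map_pow]
        push_cast
        ring
    rw [map_sub, map_mul, map_natCast, ← h1]
    have h4 : ∀ f, algebraMap (MvPolynomial (MatVar a b) K) L (colDerivation K j i i' f) =
        E j i i' (algebraMap _ L f) := by
      intro f
      simp only [E, colDerivation_apply, map_sum, map_mul, Algebra.smul_def, hD']
    have h5 : ∀ x y, E j i i' (x * y) = x * E j i i' y + y * E j i i' x := by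
      intro x y
      simp only [E, Finset.mul_sum, ← Finset.sum_add_distrib, Derivation.leibniz, smul_eq_mul]
      simp only [Algebra.smul_def]
      exact Finset.sum_congr rfl fun _ _ => by ring
    have h6 : E j i i' (algebraMap _ L q ^ s) = ((s * r : ℕ) : L) * algebraMap _ L q ^ s := by
      rw [← map_pow, ← h4, h3, map_pow]
    rw [h4, ← h1, h5, h6]
    ring
  have hq : ∀ (g : Fin (p + 2) → RowSets a b) j (i i' : Fin (b j)),
      colDerivation K j i i' (∏ l, δ (g l)) =
        ((if i = i' then p + 2 else 0 : ℕ) : MvPolynomial (MatVar a b) K) * ∏ l, δ (g l) := by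
    intro g j i i'
    have h : ∀ s : Finset (Fin (p + 2)), colDerivation K j i i' (∏ l ∈ s, δ (g l)) =
        ((if i = i' then s.card else 0 : ℕ) : MvPolynomial (MatVar a b) K) *
          ∏ l ∈ s, δ (g l) := by
      intro s
      induction s using Finset.induction_on with
      | empty => simp
      | insert l s hl ih =>
        rw [Finset.prod_insert hl, Derivation.leibniz, ih, colDerivation_rowMinor,
          Finset.card_insert_of_notMem hl]
        split_ifs
        · push_cast
          simp only [smul_eq_mul]
          ring
        · simp
    simpa using h Finset.univ
  let m : (Ind b →₀ ℕ) → ((Fin (p + 2) → RowSets a b) → L) ⧸ localCoboundaries δ L p :=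
    fun μ => Submodule.Quotient.mk (coeffCochain L k u μ)
  have hcol : ∀ j (i i' : Fin (b j)) μ, colOp (K := K) D j i i' (m μ) =
      Submodule.Quotient.mk fun g => E j i i' (coeffCochain L k u μ g) := by
    intro j i i' μ
    have : (fun g => E j i i' (coeffCochain L k u μ g)) =
        ∑ κ : Fin (a j), (X ⟨j, κ, i⟩ : MvPolynomial (MatVar a b) K) •
          cochainMap (p + 2) (D' ⟨j, κ, i'⟩) (coeffCochain L k u μ) := by
      funext g
      rw [Finset.sum_apply]
      rfl
    rw [this, ← Submodule.mkQ_apply, map_sum]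
    rfl
  have hdiag : ∀ j (i : Fin (b j)) μ, colOp (K := K) D j i i (m μ) =
      ((∑ w : Ind b with w j = i, μ w : ℕ) : MvPolynomial (MatVar a b) K) • m μ := by
    intro j i μ
    rw [hcol, ← Submodule.Quotient.mk_smul]
    congr 1
    funext g
    refine mul_right_cancel₀
        (pow_ne_zero k (algebraMap_prod_rowMinor_ne_zero (K := K) L g)) ?_
    rw [hE j i i _ _ _ _ _ (coeffCochain_mul k u μ g) (hq g j i i),
      colDerivation_coeff_of_mem_of_eq hR j i (hu g), Pi.smul_apply, Algebra.smul_def, mul_assoc,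
      coeffCochain_mul, if_pos rfl, ← map_mul]
    congr 1
    push_cast
    ring
  have hoff : ∀ j (i i' : Fin (b j)) μ, i < i' → colOp (K := K) D j i i' (m μ) =
      ∑ w : Ind b with w j = i, if Function.update w j i' ∈ μ.support then
        ((((μ - Finsupp.single (Function.update w j i') 1 : Ind b →₀ ℕ) w : ℕ) :
            MvPolynomial (MatVar a b) K) + 1) •
          m (μ - Finsupp.single (Function.update w j i') 1 + Finsupp.single w 1) else 0 := by
    intro j i i' μ hi
    have h1 : (fun g => E j i i' (coeffCochain L k u μ g)) =
        ∑ w : Ind b with w j = i, if Function.update w j i' ∈ μ.support then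
        ((((μ - Finsupp.single (Function.update w j i') 1 : Ind b →₀ ℕ) w : ℕ) :
            MvPolynomial (MatVar a b) K) + 1) • coeffCochain L k u
          (μ - Finsupp.single (Function.update w j i') 1 + Finsupp.single w 1) else 0 := by
      funext g
      refine mul_right_cancel₀
        (pow_ne_zero k (algebraMap_prod_rowMinor_ne_zero (K := K) L g)) ?_
      rw [hE j i i' _ _ _ _ _ (coeffCochain_mul k u μ g) (hq g j i i'),
        colDerivation_coeff_of_mem hR j i i' (hu g), if_neg hi.ne, if_neg hi.ne, Finset.sum_apply,
        Finset.sum_mul]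
      simp only [mul_zero, Nat.cast_zero, zero_mul, sub_zero, add_zero, map_sum]
      refine Finset.sum_congr rfl fun w _ => ?_
      split_ifs
      · rw [Pi.smul_apply, Algebra.smul_def, mul_assoc, coeffCochain_mul, ← map_mul, mul_comm]
      · rw [Pi.zero_apply, zero_mul, map_zero]
    rw [hcol, h1, ← Submodule.mkQ_apply, map_sum]
    refine Finset.sum_congr rfl fun w _ => ?_
    split_ifs
    · rfl
    · exact map_zero _
  have key : ∀ (N : ℕ) μ, indexWeight μ = N → m μ = 0 := by
    intro N
    induction N using Nat.strong_induction_on with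
    | _ N ih =>
      intro μ hμ
      refine IsHighestWeight.eq_zero (K := K) (D := D) hD hab
        ⟨fun j i => ∑ w : Ind b with w j = i, μ w, fun j i i' hi => ?_⟩ fun J => ⟨k, ?_⟩
      · split_ifs with h
        · subst h
          exact hdiag j i μ
        · rw [hoff j i i' μ (lt_of_le_of_ne hi h)]
          refine Finset.sum_eq_zero fun w hw => ?_
          split_ifs with h1
          · rw [ih _ (hμ ▸ indexWeight_lt (lt_of_le_of_ne hi h) (Finset.mem_filter.mp hw).2 h1) _
              rfl, smul_zero]
          · rfl
      · rw [← Submodule.Quotient.mk_smul, Submodule.Quotient.mk_eq_zero]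
        exact pow_smul_mem_localCoboundaries δ (coeffCochain_mul k u μ)
          (coeffCochain_cocycle hcoc μ) J
  exact (Submodule.Quotient.mk_eq_zero _).mp (key _ μ rfl)

end GenericCech

section FractionCech

variable {n : ℕ} {K : Type} [Field K] [CharZero K] {a b : Fin n → ℕ}
  {R : Type} [CommRing R] [Algebra R (TensorRing K a b)]

/-- Čech cocycles with values in powers of the span of minors are coboundaries of cochains of
polynomials, up to a power of the minors. -/
theorem exists_polynomial_primitive (hab : ∀ j, b j ≤ a j)
    (hR : ∀ r : R, ∃ p, paramHom K a b p = algebraMap R (TensorRing K a b) r)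
    {p k : ℕ} {u : (Fin (p + 2) → RowSets a b) → TensorRing K a b}
    (hu : ∀ g, u g ∈ minorSpan K a b R ^ (k * (p + 2)))
    (hcoc : ∀ g : Fin (p + 3) → RowSets a b, ∑ j : Fin (p + 3),
      (-1) ^ (j : ℕ) * (genMinor K (g j) ^ k * u (g ∘ j.succAbove)) = 0) :
    ∃ (s : ℕ) (y : (Fin (p + 1) → RowSets a b) → TensorRing K a b), ∀ g,
      ∑ j : Fin (p + 2), (-1) ^ (j : ℕ) * (genMinor K (g j) ^ (k + s) * y (g ∘ j.succAbove)) =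
        (∏ l, genMinor K (g l)) ^ s * u g := by
  classical
  let L := FractionRing (MvPolynomial (MatVar a b) K)
  let α : MvPolynomial (MatVar a b) K →+* L := algebraMap _ _
  have hα : Function.Injective α := IsFractionRing.injective (MvPolynomial (MatVar a b) K) L
  let δ : RowSets a b → MvPolynomial (MatVar a b) K :=
    fun J => rowMinor (genericMat K a b) fun j => J j
  choose z hz hzu using fun μ => coeffCochain_mem (L := L) hab hR hu hcoc μ
  choose t e₀ he₀ using fun μ f => (mem_fractionsAt δ).mp (hz μ f)
  let S : Finset (Ind b →₀ ℕ) := Finset.univ.biUnion fun g => (u g).support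
  let s : ℕ := ∑ μ ∈ S, ∑ f, t μ f
  have hts : ∀ μ ∈ S, ∀ f, t μ f ≤ k + s := fun μ hμ f =>
    ((Finset.single_le_sum (f := t μ) (fun _ _ => Nat.zero_le _) (Finset.mem_univ f)).trans
      (Finset.single_le_sum (f := fun μ => ∑ f, t μ f) (fun _ _ => Nat.zero_le _) hμ)).trans
      (Nat.le_add_left s k)
  have he : ∀ μ f, ∃ e, μ ∈ S → z μ f * α (∏ l, δ (f l)) ^ (k + s) = α e := by
    intro μ f
    by_cases hμ : μ ∈ S
    · refine ⟨e₀ μ f * (∏ l, δ (f l)) ^ (k + s - t μ f), fun _ => ?_⟩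
      rw [map_mul, map_pow, ← he₀, mul_assoc, ← pow_add, Nat.add_sub_cancel' (hts μ hμ f)]
    · exact ⟨0, fun h => absurd h hμ⟩
  choose e he using he
  refine ⟨s, fun f => ∑ μ ∈ S, monomial μ (e μ f), fun g => ?_⟩
  ext1 μ
  have h1 : ∀ j : ℕ, ((-1) ^ j : TensorRing K a b) = MvPolynomial.C ((-1) ^ j) := by
    simp
  have h2 : (∏ l, genMinor K (g l)) ^ s = (MvPolynomial.C ((∏ l, δ (g l)) ^ s) :
      TensorRing K a b) := by
    rw [map_pow, map_prod]
    simp only [genMinor_eq_C, δ]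
  rw [h2, coeff_C_mul, coeff_sum]
  simp only [h1, coeff_C_mul, genMinor_pow_mul_coeff, coeff_sum, coeff_monomial,
    Finset.sum_ite_eq']
  by_cases hμ : μ ∈ S
  · simp only [if_pos hμ]
    apply hα
    have h3 : α (coeff μ (u g)) = coeffCochain L k u μ g * α (∏ l, δ (g l)) ^ k :=
      (coeffCochain_mul k u μ g).symm
    have h4 : ∑ j : Fin (p + 2), (-1) ^ (j : ℕ) * z μ (g ∘ j.succAbove) =
        coeffCochain L k u μ g := congrFun (hzu μ) g
    rw [map_mul, h3, ← h4, map_sum, Finset.sum_mul, Finset.mul_sum]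
    refine Finset.sum_congr rfl fun j _ => ?_
    have h5 : α (∏ l, δ (g l)) = α (δ (g j)) * α (∏ l, δ ((g ∘ j.succAbove) l)) := by
      rw [Fin.prod_univ_succAbove _ j, map_mul]
      rfl
    rw [map_mul, map_mul, ← he μ _ hμ, map_pow α (∏ l, δ (g l)), h5]
    simp only [map_pow, map_neg, map_one, δ]
    ring
  · simp only [if_neg hμ, mul_zero, Finset.sum_const_zero]
    have h3 : coeff μ (u g) = 0 := by
      rw [← notMem_support_iff]
      exact fun h => hμ (Finset.mem_biUnion.mpr ⟨g, Finset.mem_univ g, h⟩)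
    rw [h3, mul_zero]

variable {𝔽 : Type} [Field 𝔽] [Algebra (TensorRing K a b) 𝔽]
  [IsFractionRing (TensorRing K a b) 𝔽] [Algebra R 𝔽] [IsScalarTower R (TensorRing K a b) 𝔽]

omit [CharZero K] [IsFractionRing (TensorRing K a b) 𝔽] in
lemma mem_map_minorSpan_pow {k : ℕ} {x : 𝔽} :
    x ∈ ((minorSpan K a b R).map
      (IsScalarTower.toAlgHom R (TensorRing K a b) 𝔽).toLinearMap) ^ k ↔
      ∃ u ∈ minorSpan K a b R ^ k, algebraMap (TensorRing K a b) 𝔽 u = x := by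
  rw [← Submodule.map_pow]
  rfl

omit [CharZero K] [Algebra R 𝔽] [IsScalarTower R (TensorRing K a b) 𝔽] in
lemma algebraMap_genMinor_ne_zero (J : RowSets a b) :
    algebraMap (TensorRing K a b) 𝔽 (genMinor K J) ≠ 0 := by
  rw [map_ne_zero_iff _ (IsFractionRing.injective (TensorRing K a b) 𝔽)]
  exact genMinor_ne_zero K J

omit [CharZero K] in
lemma prod_genMinor_pow_mul_mem {q k s : ℕ} (g : Fin q → RowSets a b) {u : TensorRing K a b}
    (hu : u ∈ minorSpan K a b R ^ (k * q)) :
    (∏ l, genMinor K (g l)) ^ s * u ∈ minorSpan K a b R ^ ((k + s) * q) := by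
  have h1 : ∏ l, genMinor K (g l) ∈ minorSpan K a b R ^ q := by
    clear hu
    induction q with
    | zero =>
      rw [Finset.univ_eq_empty, Finset.prod_empty, pow_zero]
      exact (Submodule.one_le (P := (1 : Submodule R (TensorRing K a b)))).mp le_rfl
    | succ q ih =>
      rw [Fin.prod_univ_succ, pow_succ']
      exact Submodule.mul_mem_mul (genMinor_mem_minorSpan (g 0)) (ih fun l => g l.succ)
  have h2 := Submodule.mul_mem_mul (Submodule.pow_mem_pow _ h1 s) hu
  rwa [← pow_mul, ← pow_add, show q * s + k * q = (k + s) * q by ring] at h2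

/-- Exactness of the Čech complexes of the Rees algebra of the span of minors. -/
theorem rees_cech_exact [Algebra K R] [IsScalarTower K R (TensorRing K a b)]
    (hab : ∀ j, b j ≤ a j)
    (hR : ∀ r : R, ∃ p, paramHom K a b p = algebraMap R (TensorRing K a b) r)
    (hT : ∀ v, genericTensor K a b v ∈ (1 : Submodule R (TensorRing K a b)))
    (p : ℕ) (c : (Fin (p + 2) → RowSets a b) → 𝔽)
    (hc : ∀ g, IsReesSection ((minorSpan K a b R).map
      (IsScalarTower.toAlgHom R (TensorRing K a b) 𝔽).toLinearMap)
      (fun J => algebraMap (TensorRing K a b) 𝔽 (genMinor K J)) g (c g))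
    (hcoc : ∀ g : Fin (p + 3) → RowSets a b,
      ∑ j : Fin (p + 3), (-1) ^ (j : ℕ) * c (g ∘ j.succAbove) = 0) :
    ∃ y : (Fin (p + 1) → RowSets a b) → 𝔽, (∀ g, IsReesSection ((minorSpan K a b R).map
      (IsScalarTower.toAlgHom R (TensorRing K a b) 𝔽).toLinearMap)
      (fun J => algebraMap (TensorRing K a b) 𝔽 (genMinor K J)) g (y g)) ∧
      ∀ g : Fin (p + 2) → RowSets a b,
        ∑ j : Fin (p + 2), (-1) ^ (j : ℕ) * y (g ∘ j.succAbove) = c g := by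
  classical
  have : Nonempty (RowSets a b) := ⟨fun j => Fin.castLEEmb (hab j)⟩
  let α : TensorRing K a b →+* 𝔽 := algebraMap _ _
  have hα : Function.Injective α := IsFractionRing.injective (TensorRing K a b) 𝔽
  have hne : ∀ {q : ℕ} (g : Fin q → RowSets a b), ∏ l, α (genMinor K (g l)) ≠ 0 := fun g =>
    Finset.prod_ne_zero_iff.mpr fun l _ => algebraMap_genMinor_ne_zero (g l)
  choose t ht using hc
  choose u₀ hu₀ hu₀c using fun g => mem_map_minorSpan_pow.mp (ht g)
  let k : ℕ := ∑ g, t g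
  have hk : ∀ g, t g ≤ k := fun g =>
    Finset.single_le_sum (f := t) (fun _ _ => Nat.zero_le _) (Finset.mem_univ g)
  let u : (Fin (p + 2) → RowSets a b) → TensorRing K a b :=
    fun g => (∏ l, genMinor K (g l)) ^ (k - t g) * u₀ g
  have hu : ∀ g, u g ∈ minorSpan K a b R ^ (k * (p + 2)) := by
    intro g
    have h := prod_genMinor_pow_mul_mem (s := k - t g) g (hu₀ g)
    rwa [Nat.add_sub_cancel' (hk g)] at h
  have huc : ∀ g, α (u g) = c g * (∏ l, α (genMinor K (g l))) ^ k := by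
    intro g
    have h : α (u₀ g) = c g * (∏ l, α (genMinor K (g l))) ^ t g := hu₀c g
    rw [map_mul, map_pow, map_prod, h, mul_left_comm, ← pow_add, Nat.sub_add_cancel (hk g)]
  have hprod : ∀ {q : ℕ} (g : Fin (q + 1) → RowSets a b) (j : Fin (q + 1)),
      ∏ l, α (genMinor K (g l)) =
        α (genMinor K (g j)) * ∏ l, α (genMinor K ((g ∘ j.succAbove) l)) := fun g j =>
    Fin.prod_univ_succAbove _ j
  have hucoc : ∀ g : Fin (p + 3) → RowSets a b, ∑ j : Fin (p + 3),
      (-1) ^ (j : ℕ) * (genMinor K (g j) ^ k * u (g ∘ j.succAbove)) = 0 := by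
    intro g
    apply hα
    rw [map_zero, map_sum, ← zero_mul ((∏ l, α (genMinor K (g l))) ^ k), ← hcoc g,
      Finset.sum_mul]
    refine Finset.sum_congr rfl fun j _ => ?_
    rw [map_mul, map_mul, huc, hprod g j]
    simp only [map_pow, map_neg, map_one]
    ring
  obtain ⟨s, y₀, hy₀⟩ := exists_polynomial_primitive hab hR hu hucoc
  obtain ⟨y, hy, hyu⟩ := exists_primitive_mem_minorSpan hR hT
    (fun g => prod_genMinor_pow_mul_mem (s := s) g (hu g)) y₀ hy₀
  refine ⟨fun f => α (y f) / (∏ l, α (genMinor K (f l))) ^ (k + s), fun f => ?_, fun g => ?_⟩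
  · refine ⟨k + s, mem_map_minorSpan_pow.mpr ⟨y f, hy f, ?_⟩⟩
    exact (div_mul_cancel₀ _ (pow_ne_zero _ (hne f))).symm
  · refine mul_right_cancel₀ (pow_ne_zero (k + s) (hne g)) ?_
    have h := congrArg α (hyu g)
    rw [map_mul, map_pow, map_prod, map_sum, huc, mul_left_comm, ← pow_add, add_comm s k] at h
    rw [← h, Finset.sum_mul]
    refine Finset.sum_congr rfl fun j _ => ?_
    rw [hprod g j, mul_pow, map_mul, map_mul, mul_assoc, mul_left_comm _ (_ ^ _) (_ ^ _),
      div_mul_cancel₀ _ (pow_ne_zero _ (hne _))]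
    simp only [map_pow, map_neg, map_one]

end FractionCech

section Normalized

variable {n : ℕ} {a b : Fin n → ℕ} {C : Type} [CommRing C]

/-- Replace one row in a family of row sets. -/
def replaceRow (J : ∀ j, Fin (b j) → Fin (a j)) (v : MatVar a b) :
    ∀ j, Fin (b j) → Fin (a j) :=
  Function.update J v.1 (Function.update (J v.1) v.2.2 v.2.1)

lemma rowMinor_replaceRow {M : ∀ j, Matrix (Fin (a j)) (Fin (b j)) C}
    {J : ∀ j, Fin (b j) → Fin (a j)} (hM : ∀ j, (M j).submatrix (J j) id = 1) (v : MatVar a b) :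
    rowMinor M (replaceRow J v) = M v.1 v.2.1 v.2.2 := by
  obtain ⟨j, k, i⟩ := v
  rw [rowMinor, Finset.prod_eq_single j]
  · have h : (M j).submatrix (Function.update (J j) i k) id =
        (1 : Matrix (Fin (b j)) (Fin (b j)) C).updateRow i
          (∑ l, M j k l • (1 : Matrix (Fin (b j)) (Fin (b j)) C) l) := by
      ext i' l
      by_cases hi : i' = i
      · subst hi
        simp [Matrix.one_apply]
      · rw [Matrix.updateRow_ne hi, ← hM j]
        simp [hi]
    simp only [replaceRow, Function.update_self]
    rw [h, Matrix.det_updateRow_sum, Matrix.det_one, smul_eq_mul, mul_one]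
  · intro j' _ hj
    simp only [replaceRow]
    rw [Function.update_of_ne hj, hM, Matrix.det_one]
  · simp

lemma rowMinor_eq_one {M : ∀ j, Matrix (Fin (a j)) (Fin (b j)) C}
    {J : ∀ j, Fin (b j) → Fin (a j)} (hM : ∀ j, (M j).submatrix (J j) id = 1) :
    rowMinor M J = 1 :=
  Finset.prod_eq_one fun j _ => by rw [hM, Matrix.det_one]

lemma contract_comp_rows (M : ∀ j, Matrix (Fin (a j)) (Fin (b j)) C)
    (J : ∀ j, Fin (b j) → Fin (a j)) (t : Ind b → C) (w : Ind b) :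
    contract M t (fun j => J j (w j)) = contract (fun j => (M j).submatrix (J j) id) t w := rfl

lemma contract_normalized {M : ∀ j, Matrix (Fin (a j)) (Fin (b j)) C}
    {J : ∀ j, Fin (b j) → Fin (a j)} (hM : ∀ j, (M j).submatrix (J j) id = 1)
    (t : Ind b → C) (w : Ind b) : contract M t (fun j => J j (w j)) = t w := by
  rw [contract_comp_rows]
  simp only [hM, contract_one]

end Normalized

section Chart

variable {n : ℕ} {K : Type} [Field K] {a b : Fin n → ℕ} (J : RowSets a b)

/-- The coordinates of the chart given by families of matrices with identity blocks in the
given rows. -/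
abbrev ChartVar : Type := {v : MatVar a b // v.2.1 ∉ Set.range (J v.1)} ⊕ Ind b

open Classical in
/-- The generic matrices with identity blocks in given rows. -/
noncomputable def chartMat (j : Fin n) :
    Matrix (Fin (a j)) (Fin (b j)) (MvPolynomial (ChartVar J) K) :=
  Matrix.of fun k i => if h : k ∈ Set.range (J j) then if k = J j i then 1 else 0
    else X (Sum.inl ⟨⟨j, k, i⟩, h⟩)

lemma chartMat_submatrix (j : Fin n) : (chartMat (K := K) J j).submatrix (J j) id = 1 := by
  ext i' i
  simp [chartMat, Matrix.one_apply]

/-- Restriction of polynomials to the families of matrices with identity blocks. -/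
noncomputable def chartSpec : TensorRing K a b →ₐ[K] MvPolynomial (ChartVar J) K where
  toRingHom := eval₂Hom (aeval fun v : MatVar a b => chartMat (K := K) J v.1 v.2.1 v.2.2 :
    MvPolynomial (MatVar a b) K →ₐ[K] _).toRingHom fun w => X (Sum.inr w)
  commutes' r := by
    change eval₂Hom _ _ (MvPolynomial.C (MvPolynomial.C r)) = _
    rw [eval₂Hom_C]
    exact aeval_C (R := K) _ _

lemma chartSpec_X (w : Ind b) : chartSpec (K := K) J (X w) = X (Sum.inr w) := eval₂Hom_X' _ _ _

lemma xMat_map_chartSpec (j : Fin n) : (xMat K a b j).map (chartSpec J) = chartMat J j := by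
  refine Matrix.ext fun k i => ?_
  rw [Matrix.map_apply, xMat_apply]
  exact (eval₂Hom_C _ _ _).trans
    (aeval_X (R := K) (fun v : MatVar a b => chartMat (K := K) J v.1 v.2.1 v.2.2) _)

lemma chartSpec_rowMinor (I : ∀ j, Fin (b j) → Fin (a j)) :
    chartSpec J (rowMinor (xMat K a b) I) = rowMinor (chartMat J) I := by
  rw [map_rowMinor]
  simp only [xMat_map_chartSpec]

lemma chartSpec_genericTensor (v : Ind a) : chartSpec J (genericTensor K a b v) =
    contract (chartMat (K := K) J) (fun w => X (Sum.inr w)) v := by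
  rw [genericTensor, map_contract]
  simp only [xMat_map_chartSpec, chartSpec_X]

variable (𝔽 : Type) [Field 𝔽] [Algebra (TensorRing K a b) 𝔽]
  [IsFractionRing (TensorRing K a b) 𝔽]

variable (K a b) in
/-- The generic matrices, over the fraction field. -/
noncomputable def fracMat (j : Fin n) : Matrix (Fin (a j)) (Fin (b j)) 𝔽 :=
  (xMat K a b j).map (algebraMap (TensorRing K a b) 𝔽)

/-- The generic matrices, normalized to have identity blocks in given rows. -/
noncomputable def normMat (j : Fin n) : Matrix (Fin (a j)) (Fin (b j)) 𝔽 :=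
  fracMat K a b 𝔽 j * ((fracMat K a b 𝔽 j).submatrix (J j) id)⁻¹

omit [IsFractionRing (TensorRing K a b) 𝔽] in
lemma rowMinor_fracMat (I : ∀ j, Fin (b j) → Fin (a j)) : rowMinor (fracMat K a b 𝔽) I =
    algebraMap (TensorRing K a b) 𝔽 (rowMinor (xMat K a b) I) :=
  (map_rowMinor _ _ _).symm

lemma isUnit_det_fracMat (j : Fin n) :
    IsUnit ((fracMat K a b 𝔽 j).submatrix (J j) id).det := by
  have h : rowMinor (fracMat K a b 𝔽) (fun j => J j) ≠ 0 := by
    rw [rowMinor_fracMat]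
    exact algebraMap_genMinor_ne_zero (K := K) J
  exact (Finset.prod_ne_zero_iff.mp h j (Finset.mem_univ j)).isUnit

lemma normMat_submatrix (j : Fin n) : (normMat (K := K) J 𝔽 j).submatrix (J j) id = 1 := by
  have h := Matrix.mul_nonsing_inv _ (isUnit_det_fracMat (K := K) J 𝔽 j)
  rw [← h]
  rfl

lemma normMat_mul (j : Fin n) : normMat (K := K) J 𝔽 j * (fracMat K a b 𝔽 j).submatrix (J j) id =
    fracMat K a b 𝔽 j := by
  rw [normMat, Matrix.mul_assoc, Matrix.nonsing_inv_mul _ (isUnit_det_fracMat (K := K) J 𝔽 j),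
    Matrix.mul_one]

lemma rowMinor_normMat_mul (I : ∀ j, Fin (b j) → Fin (a j)) :
    rowMinor (normMat (K := K) J 𝔽) I * algebraMap (TensorRing K a b) 𝔽 (genMinor K J) =
      algebraMap (TensorRing K a b) 𝔽 (rowMinor (xMat K a b) I) := by
  rw [genMinor, ← rowMinor_fracMat, ← rowMinor_fracMat]
  conv_rhs => rw [← funext (normMat_mul (K := K) J 𝔽)]
  rw [rowMinor_mul]
  rfl

/-- The coefficients of the generic tensor in the normalized basis. -/
noncomputable def normTensor (w : Ind b) : 𝔽 :=
  algebraMap (TensorRing K a b) 𝔽 (genericTensor K a b fun j => J j (w j))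

lemma contract_normTensor (v : Ind a) : contract (normMat (K := K) J 𝔽) (normTensor (K := K) J 𝔽) v =
    algebraMap (TensorRing K a b) 𝔽 (genericTensor K a b v) := by
  have h : ∀ v, algebraMap (TensorRing K a b) 𝔽 (genericTensor K a b v) =
      contract (fracMat K a b 𝔽) (fun w => algebraMap (TensorRing K a b) 𝔽 (X w)) v :=
    fun v => map_contract _ _ _ _
  rw [h]
  conv_rhs => rw [← funext (normMat_mul (K := K) J 𝔽)]
  rw [← contract_contract]
  congr 1
  funext w
  rw [normTensor, h]
  rfl

variable [Algebra K 𝔽] [IsScalarTower K (TensorRing K a b) 𝔽]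

/-- A chart of the resolution of the subspace variety. -/
noncomputable def chartHom : MvPolynomial (ChartVar J) K →ₐ[K] 𝔽 :=
  aeval (Sum.elim (fun v => normMat (K := K) J 𝔽 v.1.1 v.1.2.1 v.1.2.2)
    (normTensor (K := K) J 𝔽))

omit [IsScalarTower K (TensorRing K a b) 𝔽] in
lemma chartMat_map (j : Fin n) : (chartMat J j).map (chartHom (K := K) J 𝔽) = normMat (K := K) J 𝔽 j := by
  ext k i
  by_cases h : k ∈ Set.range (J j)
  · obtain ⟨i', rfl⟩ := h
    have h1 := congrFun (congrFun (chartMat_submatrix (K := K) J j) i') i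
    have h2 := congrFun (congrFun (normMat_submatrix (K := K) J 𝔽 j) i') i
    rw [Matrix.submatrix_apply, id] at h1 h2
    rw [Matrix.map_apply, h1, h2, Matrix.one_apply, Matrix.one_apply]
    split_ifs <;> simp
  · rw [Matrix.map_apply, chartMat, Matrix.of_apply, dif_neg h, chartHom, aeval_X]
    rfl

lemma exists_chartSpec_eq (p : MvPolynomial (ChartVar J) K) : ∃ (k : ℕ) (q : TensorRing K a b),
    chartHom (K := K) J 𝔽 p * algebraMap (TensorRing K a b) 𝔽 (genMinor K J) ^ k =
      algebraMap (TensorRing K a b) 𝔽 q ∧ chartSpec J q = p := by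
  have h0 : chartSpec J (genMinor K J) = 1 := by
    rw [genMinor, chartSpec_rowMinor]
    exact rowMinor_eq_one (chartMat_submatrix (K := K) J)
  induction p using MvPolynomial.induction_on with
  | C r =>
    refine ⟨0, algebraMap K _ r, ?_, (chartSpec J).commutes r⟩
    rw [pow_zero, mul_one, chartHom, aeval_C, ← IsScalarTower.algebraMap_apply]
  | add p p' h h' =>
    obtain ⟨k, q, h1, h2⟩ := h
    obtain ⟨k', q', h1', h2'⟩ := h'
    refine ⟨k + k', q * genMinor K J ^ k' + q' * genMinor K J ^ k, ?_, ?_⟩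
    · rw [map_add, map_add, map_mul, map_mul, ← h1, ← h1', map_pow, map_pow]
      ring
    · rw [map_add, map_mul, map_mul, map_pow, map_pow, h0, h2, h2', one_pow, one_pow, mul_one,
        mul_one]
  | mul_X p v h =>
    obtain ⟨k, q, h1, h2⟩ := h
    cases v with
    | inl v =>
      refine ⟨k + 1, q * rowMinor (xMat K a b) (replaceRow (fun j => J j) v.1), ?_, ?_⟩
      · have h3 : chartHom (K := K) J 𝔽 (X (Sum.inl v)) =
            rowMinor (normMat (K := K) J 𝔽) (replaceRow (fun j => J j) v.1) := by
          rw [rowMinor_replaceRow (normMat_submatrix (K := K) J 𝔽), chartHom, aeval_X]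
          rfl
        rw [map_mul, map_mul, ← rowMinor_normMat_mul (K := K) J 𝔽, ← h1, h3]
        ring
      · rw [map_mul, h2, chartSpec_rowMinor, rowMinor_replaceRow (chartMat_submatrix (K := K) J)]
        obtain ⟨⟨j, l, i⟩, hv⟩ := v
        rw [chartMat, Matrix.of_apply, dif_neg hv]
    | inr w =>
      refine ⟨k, q * genericTensor K a b fun j => J j (w j), ?_, ?_⟩
      · have h3 : chartHom (K := K) J 𝔽 (X (Sum.inr w)) = normTensor (K := K) J 𝔽 w := aeval_X _ _
        rw [map_mul, map_mul, ← h1, h3, normTensor]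
        ring
      · rw [map_mul, h2, chartSpec_genericTensor, contract_normalized (chartMat_submatrix (K := K) J)]

theorem chartHom_injective : Function.Injective (chartHom (K := K) J 𝔽) := by
  rw [injective_iff_map_eq_zero]
  intro p hp
  obtain ⟨k, q, h1, h2⟩ := exists_chartSpec_eq J 𝔽 p
  rw [hp, zero_mul, eq_comm,
    map_eq_zero_iff _ (IsFractionRing.injective (TensorRing K a b) 𝔽)] at h1
  rw [← h2, h1, map_zero]

variable {R : Type} [CommRing R] [Algebra R (TensorRing K a b)] [Algebra R 𝔽]
  [IsScalarTower R (TensorRing K a b) 𝔽]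

theorem exists_chartHom_eq_iff
    (hR : ∀ r : R, ∃ p, paramHom K a b p = algebraMap R (TensorRing K a b) r)
    (hT : ∀ v, genericTensor K a b v ∈ (1 : Submodule R (TensorRing K a b)))
    [Algebra K R] [IsScalarTower K R (TensorRing K a b)] (x : 𝔽) :
    (∃ p, chartHom (K := K) J 𝔽 p = x) ↔ IsChartElement ((minorSpan K a b R).map
      (IsScalarTower.toAlgHom R (TensorRing K a b) 𝔽).toLinearMap)
      (algebraMap (TensorRing K a b) 𝔽 (genMinor K J)) x := by
  have hΔ := algebraMap_genMinor_ne_zero (K := K) (𝔽 := 𝔽) J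
  constructor
  · rintro ⟨p, rfl⟩
    have hJ := genMinor_mem_minorSpan (K := K) (R := R) J
    suffices h : ∃ k, ∃ u ∈ minorSpan K a b R ^ k, algebraMap (TensorRing K a b) 𝔽 u =
        chartHom (K := K) J 𝔽 p * algebraMap (TensorRing K a b) 𝔽 (genMinor K J) ^ k by
      obtain ⟨k, h⟩ := h
      exact ⟨k, mem_map_minorSpan_pow.mpr h⟩
    induction p using MvPolynomial.induction_on with
    | C r =>
      refine ⟨0, algebraMap R _ (algebraMap K R r), ?_, ?_⟩
      · rw [pow_zero]
        exact Submodule.algebraMap_mem _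
      · rw [pow_zero, mul_one, chartHom, aeval_C, ← IsScalarTower.algebraMap_apply K R,
          ← IsScalarTower.algebraMap_apply]
    | add p p' h h' =>
      obtain ⟨k, u, hu, h1⟩ := h
      obtain ⟨k', u', hu', h1'⟩ := h'
      refine ⟨k + k', u * genMinor K J ^ k' + genMinor K J ^ k * u', ?_, ?_⟩
      · rw [pow_add]
        exact Submodule.add_mem _ (Submodule.mul_mem_mul hu (Submodule.pow_mem_pow _ hJ _))
          (Submodule.mul_mem_mul (Submodule.pow_mem_pow _ hJ _) hu')
      · rw [map_add, map_add, map_mul, map_mul, h1, h1', map_pow, map_pow]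
        ring
    | mul_X p v h =>
      obtain ⟨k, u, hu, h1⟩ := h
      cases v with
      | inl v =>
        refine ⟨k + 1, u * rowMinor (xMat K a b) (replaceRow (fun j => J j) v.1), ?_, ?_⟩
        · rw [pow_succ]
          exact Submodule.mul_mem_mul hu (rowMinor_mem_minorSpan K R _)
        · have h3 : chartHom (K := K) J 𝔽 (X (Sum.inl v)) =
              rowMinor (normMat (K := K) J 𝔽) (replaceRow (fun j => J j) v.1) := by
            rw [rowMinor_replaceRow (normMat_submatrix (K := K) J 𝔽), chartHom, aeval_X]
            rfl
          rw [map_mul, map_mul, ← rowMinor_normMat_mul (K := K) J 𝔽, h1, h3]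
          ring
      | inr w =>
        refine ⟨k, u * genericTensor K a b fun j => J j (w j), ?_, ?_⟩
        · have h := Submodule.mul_mem_mul hu (hT fun j => J j (w j))
          rwa [mul_one] at h
        · have h3 : chartHom (K := K) J 𝔽 (X (Sum.inr w)) = normTensor (K := K) J 𝔽 w := aeval_X _ _
          rw [map_mul, map_mul, h1, h3, normTensor]
          ring
  · rintro ⟨k, hk⟩
    obtain ⟨u, hu, h1⟩ := mem_map_minorSpan_pow.mp hk
    suffices h : ∃ p, chartHom (K := K) J 𝔽 p * algebraMap (TensorRing K a b) 𝔽 (genMinor K J) ^ k =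
        algebraMap (TensorRing K a b) 𝔽 u by
      obtain ⟨p, hp⟩ := h
      rw [h1] at hp
      exact ⟨p, mul_right_cancel₀ (pow_ne_zero _ hΔ) hp⟩
    have hr : ∀ r : R, ∃ p, chartHom (K := K) J 𝔽 p =
        algebraMap (TensorRing K a b) 𝔽 (algebraMap R (TensorRing K a b) r) := by
      intro r
      obtain ⟨p, hp⟩ := hR r
      rw [← hp]
      refine ⟨aeval (contract (chartMat J) fun w => X (Sum.inr w)) p, ?_⟩
      have h2 : (chartHom (K := K) J 𝔽).comp
          (aeval (contract (chartMat J) fun w => X (Sum.inr w))) =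
          (IsScalarTower.toAlgHom K (TensorRing K a b) 𝔽).comp (paramHom K a b) := by
        refine MvPolynomial.algHom_ext fun v => ?_
        rw [AlgHom.comp_apply, AlgHom.comp_apply, paramHom, aeval_X, aeval_X, map_contract]
        simp only [chartMat_map]
        rw [IsScalarTower.toAlgHom_apply, ← contract_normTensor J 𝔽]
        congr 1
        funext w
        exact aeval_X _ _
      exact DFunLike.congr_fun h2 p
    have hm : ∀ m ∈ minorSpan K a b R, ∃ p, chartHom (K := K) J 𝔽 p *
        algebraMap (TensorRing K a b) 𝔽 (genMinor K J) = algebraMap (TensorRing K a b) 𝔽 m := by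
      intro m hm
      induction hm using Submodule.span_induction with
      | mem x hx =>
        obtain ⟨I, rfl⟩ := hx
        refine ⟨rowMinor (chartMat J) fun j => I j, ?_⟩
        rw [map_rowMinor]
        simp only [chartMat_map]
        exact rowMinor_normMat_mul J 𝔽 _
      | zero => exact ⟨0, by simp⟩
      | add x y hx hy h h' =>
        obtain ⟨p, h⟩ := h
        obtain ⟨p', h'⟩ := h'
        exact ⟨p + p', by rw [map_add, add_mul, h, h', map_add]⟩
      | smul r x hx h =>
        obtain ⟨p, h⟩ := h
        obtain ⟨p', h'⟩ := hr r
        exact ⟨p' * p, by rw [map_mul, mul_assoc, h, h', Algebra.smul_def, map_mul]⟩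
    clear h1 hk
    induction hu using Submodule.pow_induction_on_left' with
    | algebraMap r =>
      obtain ⟨p, hp⟩ := hr r
      exact ⟨p, by rw [pow_zero, mul_one, hp]⟩
    | add x y i hx hy h h' =>
      obtain ⟨p, h⟩ := h
      obtain ⟨p', h'⟩ := h'
      exact ⟨p + p', by rw [map_add, add_mul, h, h', map_add]⟩
    | mem_mul m hm' i x hx h =>
      obtain ⟨p, h⟩ := h
      obtain ⟨p', h'⟩ := hm m hm'
      exact ⟨p' * p, by rw [map_mul, map_mul, ← h, ← h', Nat.succ_eq_add_one]; ring⟩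

end Chart

section LinearAlgebra

variable {K V : Type} [Field K] [AddCommGroup V] [Module K V]

lemma Submodule.exists_ge_finrank_eq [FiniteDimensional K V] (W : Submodule K V) {m : ℕ}
    (hW : Module.finrank K W ≤ m) (hm : m ≤ Module.finrank K V) :
    ∃ W', W ≤ W' ∧ Module.finrank K W' = m := by
  induction m, hW using Nat.le_induction with
  | base => exact ⟨W, le_rfl, rfl⟩
  | succ m hWm ih =>
    obtain ⟨W', h1, h2⟩ := ih (by omega)
    obtain ⟨v, hv⟩ : ∃ v, v ∉ W' := by
      by_contra! h
      have h3 : W' = ⊤ := Submodule.eq_top_iff'.mpr h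
      rw [h3, finrank_top] at h2
      omega
    exact ⟨W' ⊔ Submodule.span K {v}, h1.trans le_sup_left, by
      rw [Submodule.finrank_sup_span_singleton hv, h2]⟩

lemma exists_linearIndependent_of_le_finrank_span {ι : Type} (f : ι → V) [FiniteDimensional K V]
    {m : ℕ} (hm : m ≤ Module.finrank K (Submodule.span K (Set.range f))) :
    ∃ M : Fin m → ι, LinearIndependent K fun i => f (M i) := by
  obtain ⟨g, hg, -, hli⟩ := Submodule.exists_fun_fin_finrank_span_eq K (Set.range f)
  choose M hM using hg
  refine ⟨fun i => M (Fin.castLE hm i), ?_⟩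
  have h := hli.comp (Fin.castLE hm) (Fin.castLE_injective hm)
  convert h using 2 with i
  exact hM _

lemma exists_det_ne_zero_of_le_finrank_span {ι : Type} {p m : ℕ} (f : ι → Fin p → K)
    (hm : m ≤ Module.finrank K (Submodule.span K (Set.range f))) :
    ∃ (I : Fin m → Fin p) (M : Fin m → ι), (Matrix.of fun i i' => f (M i') (I i)).det ≠ 0 := by
  obtain ⟨M, hM⟩ := exists_linearIndependent_of_le_finrank_span f hm
  let A : Matrix (Fin m) (Fin p) K := Matrix.of fun i => f (M i)
  have h1 : m = A.rank := by
    rw [LinearIndependent.rank_matrix (M := A) hM, Fintype.card_fin]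
  rw [← Matrix.rank_transpose, Matrix.rank_eq_finrank_span_row] at h1
  obtain ⟨I, hI⟩ := exists_linearIndependent_of_le_finrank_span A.transpose.row h1.le
  refine ⟨I, M, ?_⟩
  rw [← isUnit_iff_ne_zero, ← Matrix.isUnit_iff_isUnit_det,
    ← Matrix.linearIndependent_rows_iff_isUnit]
  exact hI

lemma exists_matrix_mul_mulVec {p m : ℕ} (W : Submodule K (Fin p → K))
    (hW : Module.finrank K W = m) : ∃ (x : Matrix (Fin p) (Fin m) K) (y : Matrix (Fin m) (Fin p) K),
      ∀ v ∈ W, (x * y).mulVec v = v := by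
  obtain ⟨π, hπ⟩ := LinearMap.exists_leftInverse_of_injective W.subtype W.ker_subtype
  let e : W ≃ₗ[K] (Fin m → K) := LinearEquiv.ofFinrankEq _ _ (by simpa using hW)
  refine ⟨LinearMap.toMatrix' (W.subtype ∘ₗ e.symm.toLinearMap),
    LinearMap.toMatrix' (e.toLinearMap ∘ₗ π), fun v hv => ?_⟩
  rw [← LinearMap.toMatrix'_comp, LinearMap.toMatrix'_mulVec]
  have h : π v = ⟨v, hv⟩ := LinearMap.congr_fun hπ ⟨v, hv⟩
  simp [h]

end LinearAlgebra

section Slices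

variable {n : ℕ} {a b : Fin n → ℕ} {C : Type} [CommRing C]

/-- The partial contraction of a tensor, in all positions but one. -/
def partialContract (x : ∀ j, Matrix (Fin (a j)) (Fin (b j)) C) (t : Ind b → C) (j : Fin n)
    (v : Ind a) (u : Fin (b j)) : C :=
  ∑ w : Ind b, if w j = u then (∏ j' ∈ Finset.univ.erase j, x j' (v j') (w j')) * t w else 0

lemma contract_update (x : ∀ j, Matrix (Fin (a j)) (Fin (b j)) C) (t : Ind b → C) (j : Fin n)
    (v : Ind a) (k : Fin (a j)) :
    contract x t (Function.update v j k) = ∑ u, x j k u * partialContract x t j v u := by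
  simp only [partialContract, Finset.mul_sum, mul_ite, mul_zero]
  rw [Finset.sum_comm]
  simp only [Finset.sum_ite_eq, Finset.mem_univ, if_true]
  refine Finset.sum_congr rfl fun w _ => ?_
  rw [← Finset.mul_prod_erase _ _ (Finset.mem_univ j), Function.update_self, mul_assoc]
  congr 2
  refine Finset.prod_congr rfl fun j' hj' => ?_
  rw [Function.update_of_ne (Finset.ne_of_mem_erase hj')]

lemma partialContract_of_one {x : ∀ j, Matrix (Fin (a j)) (Fin (a j)) C} {j : Fin n}
    (hx : ∀ j', j' ≠ j → x j' = 1) (t : Ind a → C) (v : Ind a) (u : Fin (a j)) :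
    partialContract x t j v u = t (Function.update v j u) := by
  rw [partialContract, Finset.sum_eq_single (Function.update v j u)]
  · rw [Function.update_self, if_pos rfl, Finset.prod_eq_one, one_mul]
    intro j' hj'
    have h := Finset.ne_of_mem_erase hj'
    rw [Function.update_of_ne h, hx j' h, Matrix.one_apply_eq]
  · intro w _ hw
    split_ifs with hu
    · obtain ⟨j', hj'⟩ := Function.ne_iff.mp hw
      have h : j' ≠ j := by
        rintro rfl
        exact hj' (by rw [Function.update_self, hu])
      rw [Function.update_of_ne h] at hj'
      rw [Finset.prod_eq_zero (Finset.mem_erase.mpr ⟨h, Finset.mem_univ j'⟩), zero_mul]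
      rw [hx j' h, Matrix.one_apply_ne (Ne.symm hj')]
    · rfl
  · simp

lemma contract_eq_self {x : ∀ j, Matrix (Fin (a j)) (Fin (a j)) C} {t : Ind a → C}
    (h : ∀ j v, (x j).mulVec (fun i => t (Function.update v j i)) =
      fun i => t (Function.update v j i)) : contract x t = t := by
  have key : ∀ s : Finset (Fin n), contract (fun j => if j ∈ s then x j else 1) t = t := by
    intro s
    induction s using Finset.induction_on with
    | empty => simpa using contract_one t
    | insert j s hj ih =>
      have h1 : (fun j' => if j' ∈ insert j s then x j' else 1) =
          fun j' => (if j' = j then x j' else 1) * (if j' ∈ s then x j' else 1) := by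
        funext j'
        by_cases h2 : j' = j
        · subst h2
          simp [hj]
        · simp [h2]
      rw [h1, ← contract_contract, ih]
      funext v
      rw [← Function.update_eq_self j v, contract_update]
      have h2 := congrFun (h j v) (v j)
      rw [Matrix.mulVec, dotProduct] at h2
      rw [← h2]
      refine Finset.sum_congr rfl fun u _ => ?_
      rw [if_pos rfl, partialContract_of_one (fun j' hj' => if_neg hj')]
  simpa using key Finset.univ

variable (C) in
/-- A minor of a flattening of the generic tensor. -/
noncomputable def flatMinor {m : ℕ} (j : Fin n) (I : Fin m → Fin (a j)) (M : Fin m → Ind a) :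
    MvPolynomial (Ind a) C :=
  (Matrix.of fun i i' => X (Function.update (M i') j (I i))).det

lemma aeval_flatMinor {C' : Type} [CommRing C'] [Algebra C C'] {m : ℕ} (j : Fin n)
    (I : Fin m → Fin (a j)) (M : Fin m → Ind a) (T : Ind a → C') :
    aeval T (flatMinor C j I M) =
      (Matrix.of fun i i' => T (Function.update (M i') j (I i))).det := by
  rw [flatMinor, AlgHom.map_det]
  congr 1
  ext i i'
  simp

end Slices

section SubspaceVariety

variable {n : ℕ} {K : Type} [Field K] {a b : Fin n → ℕ}

lemma contract_mem_subspaceVariety (hba : ∀ j, b j ≤ a j)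
    (x : ∀ j, Matrix (Fin (a j)) (Fin (b j)) K) (t : Ind b → K) :
    contract x t ∈ subspaceVariety K a b := by
  have h : ∀ j, ∃ W, Submodule.span K (Set.range (x j).col) ≤ W ∧ Module.finrank K W = b j := by
    intro j
    refine Submodule.exists_ge_finrank_eq _ ?_ (by simpa using hba j)
    simpa [Set.finrank] using finrank_range_le_card (R := K) (x j).col
  choose A' hA hb using h
  refine ⟨A', hb, fun j w => ?_⟩
  have h1 : (fun i => contract x t (Function.update w j i)) =
      ∑ u, partialContract x t j w u • (x j).col u := by
    funext i
    rw [contract_update, Finset.sum_apply]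
    exact Finset.sum_congr rfl fun u _ => mul_comm _ _
  rw [h1]
  exact sum_mem fun u _ => Submodule.smul_mem _ _ (hA j (Submodule.subset_span ⟨u, rfl⟩))

lemma exists_contract_eq {T : Ind a → K} (hT : T ∈ subspaceVariety K a b) :
    ∃ (x : ∀ j, Matrix (Fin (a j)) (Fin (b j)) K) (t : Ind b → K), contract x t = T := by
  obtain ⟨A', hb, hT⟩ := hT
  choose x y hxy using fun j => exists_matrix_mul_mulVec (A' j) (hb j)
  refine ⟨x, contract y T, ?_⟩
  rw [contract_contract]
  exact contract_eq_self fun j v => hxy j _ (hT j v)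

lemma mem_subIdeal {p : MvPolynomial (Ind a) K} :
    p ∈ subIdeal K a b ↔ ∀ T ∈ subspaceVariety K a b, eval T p = 0 := by
  simp [subIdeal, Submodule.mem_iInf, RingHom.mem_ker]

/-- Evaluation of the parametrisation at a point. -/
lemma eval_paramHom (x : MatVar a b → K) (t : Ind b → K) (p : MvPolynomial (Ind a) K) :
    eval t (map (eval x) (paramHom K a b p)) =
      eval (contract (fun j => Matrix.of fun k i => x ⟨j, k, i⟩) t) p := by
  induction p using MvPolynomial.induction_on with
  | C r =>
    have h1 : paramHom K a b (MvPolynomial.C r) =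
        (MvPolynomial.C (MvPolynomial.C r) : TensorRing K a b) := aeval_C _ _
    rw [h1, map_C, eval_C, eval_C, eval_C]
  | add p q hp hq => simp only [map_add, hp, hq]
  | mul_X p v hp =>
    have h1 : paramHom K a b (X v) = genericTensor K a b v := aeval_X _ _
    rw [map_mul, map_mul, map_mul, map_mul, hp, h1, eval_X, genericTensor, map_contract,
      map_contract]
    congr 2
    · funext j
      ext k i
      simp
    · funext w
      simp

lemma ker_paramHom [CharZero K] (hba : ∀ j, b j ≤ a j) {p : MvPolynomial (Ind a) K} :
    paramHom K a b p = 0 ↔ p ∈ subIdeal K a b := by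
  rw [mem_subIdeal]
  constructor
  · intro hp T hT
    obtain ⟨x, t, rfl⟩ := exists_contract_eq hT
    have h := eval_paramHom (fun v : MatVar a b => x v.1 v.2.1 v.2.2) t p
    rw [hp, map_zero, map_zero] at h
    exact h.symm
  · intro h
    ext1 m
    refine MvPolynomial.funext fun x => ?_
    have h1 : map (eval x) (paramHom K a b p) = 0 := by
      refine MvPolynomial.funext fun t => ?_
      rw [eval_paramHom, h _ (contract_mem_subspaceVariety hba _ t), map_zero]
    rw [← coeff_map, h1, coeff_zero, coeff_zero, map_zero]

lemma paramHom_flatMinor (j : Fin n) (I : Fin (b j) → Fin (a j)) (M : Fin (b j) → Ind a) :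
    paramHom K a b (flatMinor K j I M) = ((xMat K a b j).submatrix I id).det *
      (Matrix.of fun u i' => partialContract (xMat K a b) X j (M i') u).det := by
  rw [paramHom, aeval_flatMinor, ← Matrix.det_mul]
  congr 1
  ext1 i i'
  exact contract_update _ _ _ _ _

/-- If all maximal minors of a flattening vanish, the subspace variety is a smaller one. -/
lemma subspaceVariety_update [CharZero K] (hba : ∀ j, b j ≤ a j) {j : Fin n} (hj : b j ≠ 0)
    (h : ∀ (I : Fin (b j) → Fin (a j)) (M : Fin (b j) → Ind a), paramHom K a b (flatMinor K j I M) = 0) :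
    subspaceVariety K a (Function.update b j (b j - 1)) = subspaceVariety K a b := by
  ext T
  constructor
  · rintro ⟨A', h1, h2⟩
    have h3 : ∀ j', ∃ W, A' j' ≤ W ∧ Module.finrank K W = b j' := by
      intro j'
      refine Submodule.exists_ge_finrank_eq _ ?_ (by simpa using hba j')
      rw [h1]
      by_cases hj' : j' = j
      · subst hj'
        simp
      · simp [hj']
    choose W hW hb using h3
    exact ⟨W, hb, fun j' w => hW j' (h2 j' w)⟩
  · intro hT
    have h1 : ∃ W : Submodule K (Fin (a j) → K), Submodule.span K
        (Set.range fun (w : Ind a) (i : Fin (a j)) => T (Function.update w j i)) ≤ W ∧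
        Module.finrank K W = b j - 1 := by
      refine Submodule.exists_ge_finrank_eq _ ?_ ?_
      · by_contra! hlt
        obtain ⟨I, M, hIM⟩ := exists_det_ne_zero_of_le_finrank_span (m := b j)
          (fun (w : Ind a) (i : Fin (a j)) => T (Function.update w j i)) (by omega)
        have h2 := mem_subIdeal.mp ((ker_paramHom hba).mp (h I M)) T hT
        rw [← MvPolynomial.coe_aeval_eq_eval, RingHom.coe_coe, aeval_flatMinor] at h2
        exact hIM h2
      · have := hba j
        simp only [Module.finrank_fintype_fun_eq_card, Fintype.card_fin]
        omega
    obtain ⟨W, hW, hWb⟩ := h1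
    obtain ⟨A', h3, h4⟩ := hT
    refine ⟨Function.update A' j W, fun j' => ?_, fun j' w => ?_⟩
    · by_cases hj' : j' = j
      · subst hj'
        rw [Function.update_self, Function.update_self]
        exact hWb
      · rw [Function.update_of_ne hj', Function.update_of_ne hj']
        exact h3 j'
    · by_cases hj' : j' = j
      · subst hj'
        rw [Function.update_self]
        exact hW (Submodule.subset_span ⟨w, rfl⟩)
      · rw [Function.update_of_ne hj']
        exact h4 j' w

variable {R : Type} [CommRing R] [Algebra K R] [Algebra R (TensorRing K a b)]
  [IsScalarTower K R (TensorRing K a b)]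

/-- Rational singularities of the subspace variety, when all flattenings of its generic point
have maximal rank. -/
theorem hasRationalSingularities_of_flatMinor_ne_zero [CharZero K] (hba : ∀ j, b j ≤ a j)
    (hinj : Function.Injective (algebraMap R (TensorRing K a b)))
    (hR : ∀ r : R, ∃ p, paramHom K a b p = algebraMap R (TensorRing K a b) r)
    (hR' : ∀ p, ∃ r : R, algebraMap R (TensorRing K a b) r = paramHom K a b p)
    (hM : ∀ j, ∃ (I : Fin (b j) → Fin (a j)) (M : Fin (b j) → Ind a),
      paramHom K a b (flatMinor K j I M) ≠ 0) : HasRationalSingularities K R := by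
  have : Nonempty (RowSets a b) := ⟨fun j => Fin.castLEEmb (hba j)⟩
  have hT : ∀ v, genericTensor K a b v ∈ (1 : Submodule R (TensorRing K a b)) := by
    intro v
    obtain ⟨r, hr⟩ := hR' (X v)
    exact Submodule.mem_one.mpr ⟨r, hr.trans (aeval_X _ _)⟩
  choose I M hM using hM
  let 𝔽 := FractionRing (TensorRing K a b)
  let H : TensorRing K a b :=
    ∏ j, (Matrix.of fun u i' => partialContract (xMat K a b) X j (M j i') u).det
  have hH : H ≠ 0 := by
    refine Finset.prod_ne_zero_iff.mpr fun j _ => ?_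
    have h := hM j
    rw [paramHom_flatMinor] at h
    exact right_ne_zero_of_mul h
  choose r hr using fun J : RowSets a b => hR' (∏ j, flatMinor K j (J j) (M j))
  have hr' : ∀ J : RowSets a b, algebraMap R (TensorRing K a b) (r J) = H * genMinor K J := by
    intro J
    rw [hr, map_prod]
    simp only [paramHom_flatMinor]
    rw [Finset.prod_mul_distrib, mul_comm]
    rfl
  have hinj' : Function.Injective (algebraMap (TensorRing K a b) 𝔽) :=
    IsFractionRing.injective _ _
  refine hasRationalSingularities_of_rees (N := (minorSpan K a b R).map
      (IsScalarTower.toAlgHom R (TensorRing K a b) 𝔽).toLinearMap)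
    (fun J : RowSets a b => algebraMap (TensorRing K a b) 𝔽 (genMinor K J)) ?_
    (fun J => algebraMap_genMinor_ne_zero J) ?_ (h := algebraMap _ 𝔽 H) ?_ (r := r) ?_
    (fun J => chartHom J 𝔽) (fun J => chartHom_injective J 𝔽)
    (fun J => exists_chartHom_eq_iff J 𝔽 hR hT) (rees_cech_exact hba hR hT)
  · rw [minorSpan, Submodule.map_span, ← Set.range_comp]
    rfl
  · rw [IsScalarTower.algebraMap_eq R (TensorRing K a b) 𝔽]
    exact hinj'.comp hinj
  · exact (map_ne_zero_iff _ hinj').mpr hH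
  · intro J
    rw [IsScalarTower.algebraMap_apply R (TensorRing K a b) 𝔽, hr', map_mul]

end SubspaceVariety

section Main

variable {n : ℕ} {K : Type} [Field K] [CharZero K] {a b : Fin n → ℕ}

/-- The coordinate ring of the subspace variety as a subring of the tensor ring. -/
noncomputable def coordHom (hba : ∀ j, b j ≤ a j) :
    MvPolynomial (Ind a) K ⧸ subIdeal K a b →ₐ[K] TensorRing K a b :=
  Ideal.Quotient.liftₐ _ (paramHom K a b) fun _ hp => (ker_paramHom hba).mpr hp

lemma coordHom_mk (hba : ∀ j, b j ≤ a j) (p : MvPolynomial (Ind a) K) :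
    coordHom hba (Ideal.Quotient.mk _ p) = paramHom K a b p := rfl

lemma coordHom_injective (hba : ∀ j, b j ≤ a j) : Function.Injective (coordHom (K := K) hba) := by
  rw [injective_iff_map_eq_zero]
  intro r hr
  obtain ⟨p, rfl⟩ := Ideal.Quotient.mk_surjective r
  rw [coordHom_mk, ker_paramHom hba] at hr
  exact Ideal.Quotient.eq_zero_iff_mem.mpr hr

lemma isDomain_coordinateRing (hba : ∀ j, b j ≤ a j) :
    IsDomain (MvPolynomial (Ind a) K ⧸ subIdeal K a b) :=
  (coordHom_injective hba).isDomain (coordHom hba)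

lemma isIntegrallyClosed_coordinateRing (hba : ∀ j, b j ≤ a j) :
    IsIntegrallyClosed (MvPolynomial (Ind a) K ⧸ subIdeal K a b) := by
  have : Nonempty (RowSets a b) := ⟨fun j => Fin.castLEEmb (hba j)⟩
  let := (coordHom (K := K) hba).toRingHom.toAlgebra
  have : @IsScalarTower K (MvPolynomial (Ind a) K ⧸ subIdeal K a b) (TensorRing K a b)
      Algebra.toSMul _ _ :=
    IsScalarTower.of_algebraMap_eq fun r => ((coordHom hba).commutes r).symm
  refine isIntegrallyClosed_of_paramHom (coordHom_injective hba) (fun r => ?_) fun v => ?_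
  · obtain ⟨p, rfl⟩ := Ideal.Quotient.mk_surjective r
    exact ⟨p, rfl⟩
  · exact Submodule.mem_one.mpr ⟨Ideal.Quotient.mk _ (X v), aeval_X _ _⟩

lemma hasRationalSingularities_coordinateRing (hba : ∀ j, b j ≤ a j) :
    HasRationalSingularities K (MvPolynomial (Ind a) K ⧸ subIdeal K a b) := by
  induction hs : ∑ j, b j using Nat.strong_induction_on generalizing b with
  | _ s ih =>
    by_cases hM : ∀ j, ∃ (I : Fin (b j) → Fin (a j)) (M : Fin (b j) → Ind a),
        paramHom K a b (flatMinor K j I M) ≠ 0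
    · let := (coordHom (K := K) hba).toRingHom.toAlgebra
      have : @IsScalarTower K (MvPolynomial (Ind a) K ⧸ subIdeal K a b) (TensorRing K a b)
          Algebra.toSMul _ _ :=
        IsScalarTower.of_algebraMap_eq fun r => ((coordHom hba).commutes r).symm
      refine hasRationalSingularities_of_flatMinor_ne_zero hba (coordHom_injective hba)
        (fun r => ?_) (fun p => ⟨Ideal.Quotient.mk _ p, rfl⟩) hM
      obtain ⟨p, rfl⟩ := Ideal.Quotient.mk_surjective r
      exact ⟨p, rfl⟩
    · push Not at hM
      obtain ⟨j, hj⟩ := hM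
      have hj0 : b j ≠ 0 := by
        intro h0
        have : IsEmpty (Fin (b j)) := by
          rw [h0]
          infer_instance
        have h1 := hj isEmptyElim isEmptyElim
        rw [flatMinor, Matrix.det_isEmpty, map_one] at h1
        exact one_ne_zero h1
      have h1 : subIdeal K a (Function.update b j (b j - 1)) = subIdeal K a b := by
        rw [subIdeal, subspaceVariety_update hba hj0 hj, subIdeal]
      rw [← h1]
      refine ih _ ?_ (fun j' => ?_) rfl
      · rw [← hs]
        refine Finset.sum_lt_sum (fun j' _ => ?_) ⟨j, Finset.mem_univ j, ?_⟩
        · by_cases h : j' = j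
          · subst h
            simp
          · simp [h]
        · rw [Function.update_self]
          omega
      · by_cases h : j' = j
        · subst h
          rw [Function.update_self]
          exact (Nat.sub_le _ _).trans (hba j')
        · rw [Function.update_of_ne h]
          exact hba j'

end Main

/-- **Theorem 3.1 (Landsberg–Weyman), singularity part.**  The subspace varieties
`Sub_{b₁,...,b_n}` are normal — their coordinate rings are integrally closed domains —
with rational singularities. -/
theorem subspaceVariety_normal_rational_sings (K : Type) [Field K] [CharZero K]
    (n : ℕ) (a b : Fin n → ℕ) (hba : ∀ j, b j ≤ a j) :
    IsDomain (MvPolynomial (Ind a) K ⧸ subIdeal K a b) ∧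
    IsIntegrallyClosed (MvPolynomial (Ind a) K ⧸ subIdeal K a b) ∧
    HasRationalSingularities K (MvPolynomial (Ind a) K ⧸ subIdeal K a b) :=
  ⟨isDomain_coordinateRing hba, isIntegrallyClosed_coordinateRing hba,
    hasRationalSingularities_coordinateRing hba⟩
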